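/- The projected Mather set M is a compact subset of P(𝕋^d). -/

import Mathlib

/- Common framework for "On the long time convergence of potential MFG" (M. Masoero).

We work on the flat torus `𝕋^d`, modeled as `Td d := Fin d → AddCircle 1`.
Smooth functions on the torus are represented by `ℤ^d`-periodic functions on
`Vd d := Fin d → ℝ`; a function on `Vd d` is transported to the torus through the
canonical (measurable) section `secT : Td d → Vd d`.  Probability measures on the
torus are `PTd d := ProbabilityMeasure (Td d)`, endowed with the 1-Wasserstein
distance `W1` defined through Kantorovich duality.  The Fokker--Planck equations
and their stationary analogues are stated in the sense of distributions, i.e.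
against smooth periodic test functions; `σ` is the viscosity parameter
(everywhere `σ = 1` except in the non-convex example). -/

open MeasureTheory Real Set Filter

noncomputable section

abbrev Vd (d : ℕ) : Type := Fin d → ℝ
abbrev Td (d : ℕ) : Type := Fin d → AddCircle (1 : ℝ)

instance factOneposR : Fact ((0:ℝ) < 1) := ⟨one_pos⟩

/-- The canonical measurable section of the torus, with values in `[0,1)^d`. -/
def secT {d : ℕ} (y : Td d) : Vd d := fun i => ((AddCircle.equivIco 1 0) (y i)).1

/-- The vector of `ℝ^d` associated with an integer vector. -/
def intVec {d : ℕ} (z : Fin d → ℤ) : Vd d := fun i => (z i : ℝ)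

/-- Euclidean scalar product on `ℝ^d`. -/
def dotp {d : ℕ} (a b : Vd d) : ℝ := ∑ i, a i * b i

/-- Squared euclidean norm on `ℝ^d`. -/
def sqnorm {d : ℕ} (a : Vd d) : ℝ := ∑ i, (a i)^2

/-- Spatial gradient. -/
def gradv {d : ℕ} (g : Vd d → ℝ) (x : Vd d) : Vd d := fun i => fderiv ℝ g x (Pi.single i 1)

/-- Second derivative of `g` at `x` in the directions `v, w`. -/
def D2 {d : ℕ} (g : Vd d → ℝ) (x v w : Vd d) : ℝ := fderiv ℝ (fun y => fderiv ℝ g y v) x w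

/-- Laplacian. -/
def lapl {d : ℕ} (g : Vd d → ℝ) (x : Vd d) : ℝ := ∑ i, D2 g x (Pi.single i 1) (Pi.single i 1)

/-- Divergence of a vector field. -/
def divv {d : ℕ} (b : Vd d → Vd d) (x : Vd d) : ℝ :=
  ∑ i, fderiv ℝ (fun y => b y i) x (Pi.single i 1)

/-- Time derivative of a time dependent function. -/
def tderiv {d : ℕ} (u : ℝ → Vd d → ℝ) (t : ℝ) (x : Vd d) : ℝ := deriv (fun s => u s x) t

abbrev PTd (d : ℕ) := ProbabilityMeasure (Td d)

/-- The 1-Wasserstein (Monge--Kantorovich) distance, via Kantorovich duality. -/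
def W1 {d : ℕ} (μ ν : PTd d) : ℝ :=
  sSup { r | ∃ φ : Td d → ℝ, LipschitzWith 1 φ ∧
    r = (∫ y, φ y ∂(μ : Measure (Td d))) - ∫ y, φ y ∂(ν : Measure (Td d)) }

/-- The convex combination `(1-t) μ + t ν`. -/
def lineComb {d : ℕ} (t : ℝ) (μ ν : PTd d) : Measure (Td d) :=
  ENNReal.ofReal (1 - t) • (μ : Measure (Td d)) + ENNReal.ofReal t • (ν : Measure (Td d))

/-- The standing assumptions of the paper: a Hamiltonian `H` (a `ℤ^d`-periodic function of
`(x,p)`), its convex conjugate `Hstar` in the `p` variable, a `C²` coupling function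
`Fc` on `P(𝕋^d)` with flat derivative `Fd` (represented by periodic functions on `ℝ^d`),
with the regularity and growth conditions of the paper. -/
structure MFGSetting (d : ℕ) where
  H : Vd d → Vd d → ℝ
  Hstar : Vd d → Vd d → ℝ
  Fc : PTd d → ℝ
  Fd : Measure (Td d) → Vd d → ℝ
  Cbar : ℝ
  Cbar_pos : 0 < Cbar
  θ : ℝ
  θ_mem : θ ∈ Set.Ioo (0:ℝ) 1
  Cg : ℝ
  Cg_pos : 0 < Cg
  CF : ℝ
  H_smooth : ContDiff ℝ 2 (fun q : Vd d × Vd d => H q.1 q.2)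
  H_per : ∀ (x : Vd d) (z : Fin d → ℤ) (p : Vd d), H (x + intVec z) p = H x p
  Dpp_lip : ∃ L : ℝ, 0 ≤ L ∧ ∀ (x p₁ p₂ v w : Vd d),
    |D2 (fun p => H x p) p₁ v w - D2 (fun p => H x p) p₂ v w| ≤ L * ‖p₁ - p₂‖ * ‖v‖ * ‖w‖
  Dpp_lower : ∀ x p v : Vd d, Cbar⁻¹ * sqnorm v ≤ D2 (fun p' => H x p') p v v
  Dpp_upper : ∀ x p v : Vd d, D2 (fun p' => H x p') p v v ≤ Cbar * sqnorm v
  Dxx_growth : ∀ x p v w : Vd d,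
    |D2 (fun x' => H x' p) x v w| ≤ Cg * (1 + ‖p‖) ^ (1 + θ) * ‖v‖ * ‖w‖
  Dxp_growth : ∀ x p v w : Vd d,
    |fderiv ℝ (fun x' => fderiv ℝ (fun p' => H x' p') p v) x w| ≤ Cg * (1 + ‖p‖) ^ θ * ‖v‖ * ‖w‖
  Hstar_eq : ∀ x q : Vd d, IsLUB (Set.range fun p => dotp q p - H x p) (Hstar x q)
  Fd_per : ∀ (μ : Measure (Td d)) (x : Vd d) (z : Fin d → ℤ), Fd μ (x + intVec z) = Fd μ x
  Fd_smooth : ∀ μ : Measure (Td d), IsProbabilityMeasure μ → ContDiff ℝ 2 (Fd μ)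
  Fd_D2_bound : ∀ μ : Measure (Td d), IsProbabilityMeasure μ →
    ∀ x v w : Vd d, |D2 (Fd μ) x v w| ≤ CF * ‖v‖ * ‖w‖
  flat_deriv : ∀ μ ν : PTd d,
    Fc ν - Fc μ = ∫ t in Set.Icc (0:ℝ) 1,
      ((∫ y, Fd (lineComb t μ ν) (secT y) ∂(ν : Measure (Td d))) -
        ∫ y, Fd (lineComb t μ ν) (secT y) ∂(μ : Measure (Td d)))
  Fd_normalized : ∀ μ : PTd d, (∫ y, Fd (μ : Measure (Td d)) (secT y) ∂(μ : Measure (Td d))) = 0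
  Fc_bounded : ∃ M : ℝ, ∀ μ : PTd d, |Fc μ| ≤ M
  Fd_bounded : ∃ M : ℝ, ∀ (μ : PTd d) (x : Vd d), |Fd (μ : Measure (Td d)) x| ≤ M

/-- Smooth periodic test functions on `[0,∞) × 𝕋^d` (resp. `ℝ × 𝕋^d`). -/
def IsTestFun {d : ℕ} (φ : ℝ → Vd d → ℝ) : Prop :=
  ContDiff ℝ 2 (fun q : ℝ × Vd d => φ q.1 q.2) ∧
  ∀ (t : ℝ) (x : Vd d) (z : Fin d → ℤ), φ t (x + intVec z) = φ t x

/-- The weak (distributional) formulation of the Fokker--Planck equation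
`-∂ₜ m + σ Δ m + div(m α) = 0` between times `s₁` and `s₂`. -/
def FPeq {d : ℕ} (σ : ℝ) (m : ℝ → PTd d) (α : ℝ → Td d → Vd d) (s₁ s₂ : ℝ) : Prop :=
  ∀ φ : ℝ → Vd d → ℝ, IsTestFun φ →
    (∫ y, φ s₂ (secT y) ∂(m s₂ : Measure (Td d))) -
      (∫ y, φ s₁ (secT y) ∂(m s₁ : Measure (Td d))) =
    ∫ s in s₁..s₂, ∫ y, (tderiv φ s (secT y) + σ * lapl (φ s) (secT y)
        - dotp (α s y) (gradv (φ s) (secT y))) ∂(m s : Measure (Td d))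

/-- Continuity of a curve of measures with respect to the 1-Wasserstein distance. -/
def W1ContOn {d : ℕ} (m : ℝ → PTd d) (I : Set ℝ) : Prop :=
  ∀ t ∈ I, ∀ ε > 0, ∃ η > 0, ∀ s ∈ I, |s - t| < η → W1 (m s) (m t) < ε

/-- Continuity of a function on `P(𝕋^d)` with respect to the 1-Wasserstein distance. -/
def W1Continuous {d : ℕ} (χ : PTd d → ℝ) : Prop :=
  ∀ μ : PTd d, ∀ ε > 0, ∃ η > 0, ∀ ν : PTd d, W1 μ ν < η → |χ ν - χ μ| < ε

/-- W1-closed subsets of `P(𝕋^d)`. -/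
def IsClosedW1 {d : ℕ} (C : Set (PTd d)) : Prop :=
  ∀ μ : PTd d, (∀ ε > 0, ∃ ν ∈ C, W1 μ ν < ε) → μ ∈ C

/-- The running cost `∫ H*(x,α(s)) dm(s) + 𝓕(m(s))`. -/
def runCost {d : ℕ} (S : MFGSetting d) (m : ℝ → PTd d) (α : ℝ → Td d → Vd d) (s : ℝ) : ℝ :=
  (∫ y, S.Hstar (secT y) (α s y) ∂(m s : Measure (Td d))) + S.Fc (m s)

/-- Admissible pairs `(m,α)` on `[0,T]` starting from `m₀` (with `α ∈ L²_m`). -/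
def AdmOn {d : ℕ} (S : MFGSetting d) (σ : ℝ) (m₀ : PTd d) (T : ℝ)
    (m : ℝ → PTd d) (α : ℝ → Td d → Vd d) : Prop :=
  m 0 = m₀ ∧ W1ContOn m (Set.Icc 0 T) ∧
  (∀ s₁ s₂ : ℝ, 0 ≤ s₁ → s₁ ≤ s₂ → s₂ ≤ T → FPeq σ m α s₁ s₂) ∧
  Measurable (fun q : ℝ × Td d => α q.1 q.2) ∧
  (∫⁻ s in Set.Ioc (0:ℝ) T, ∫⁻ y, ENNReal.ofReal (sqnorm (α s y)) ∂(m s : Measure (Td d))) < ⊤ ∧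
  IntervalIntegrable (runCost S m α) volume 0 T

/-- Admissible pairs `(m,α)` on `[0,T]` starting from `m₀`, with `α` merely in `L¹_m`
(the class `Π_T` used for problems with prescribed endpoints). -/
def AdmOn1 {d : ℕ} (S : MFGSetting d) (σ : ℝ) (m₀ : PTd d) (T : ℝ)
    (m : ℝ → PTd d) (α : ℝ → Td d → Vd d) : Prop :=
  m 0 = m₀ ∧ W1ContOn m (Set.Icc 0 T) ∧
  (∀ s₁ s₂ : ℝ, 0 ≤ s₁ → s₁ ≤ s₂ → s₂ ≤ T → FPeq σ m α s₁ s₂) ∧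
  Measurable (fun q : ℝ × Td d => α q.1 q.2) ∧
  (∫⁻ s in Set.Ioc (0:ℝ) T, ∫⁻ y, ENNReal.ofReal (Real.sqrt (sqnorm (α s y)))
      ∂(m s : Measure (Td d))) < ⊤ ∧
  IntervalIntegrable (runCost S m α) volume 0 T

/-- The finite horizon cost. -/
def costT {d : ℕ} (S : MFGSetting d) (m : ℝ → PTd d) (α : ℝ → Td d → Vd d) (T : ℝ) : ℝ :=
  ∫ s in (0:ℝ)..T, runCost S m α s

/-- The value `𝒰(T,m₀)` of the finite horizon problem. -/
def Ufun {d : ℕ} (S : MFGSetting d) (σ : ℝ) (T : ℝ) (m₀ : PTd d) : ℝ :=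
  sInf { r | ∃ m α, AdmOn S σ m₀ T m α ∧ r = costT S m α T }

/-- Admissible pairs for the infinite horizon `δ`-discounted problem. -/
def AdmDisc {d : ℕ} (S : MFGSetting d) (σ : ℝ) (δ : ℝ) (m₀ : PTd d)
    (m : ℝ → PTd d) (α : ℝ → Td d → Vd d) : Prop :=
  m 0 = m₀ ∧ W1ContOn m (Set.Ici 0) ∧
  (∀ s₁ s₂ : ℝ, 0 ≤ s₁ → s₁ ≤ s₂ → FPeq σ m α s₁ s₂) ∧
  Measurable (fun q : ℝ × Td d => α q.1 q.2) ∧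
  (∫⁻ s in Set.Ioi (0:ℝ), ENNReal.ofReal (Real.exp (-δ * s)) *
      ∫⁻ y, ENNReal.ofReal (sqnorm (α s y)) ∂(m s : Measure (Td d))) < ⊤ ∧
  Integrable (fun s => Real.exp (-δ * s) * runCost S m α s) (volume.restrict (Set.Ioi 0))

/-- The discounted cost. -/
def costDisc {d : ℕ} (S : MFGSetting d) (δ : ℝ) (m : ℝ → PTd d) (α : ℝ → Td d → Vd d) : ℝ :=
  ∫ s in Set.Ioi (0:ℝ), Real.exp (-δ * s) * runCost S m α s

/-- The value `𝒱_δ(m₀)` of the discounted problem. -/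
def Vfun {d : ℕ} (S : MFGSetting d) (σ : ℝ) (δ : ℝ) (m₀ : PTd d) : ℝ :=
  sInf { r | ∃ m α, AdmDisc S σ δ m₀ m α ∧ r = costDisc S δ m α }

/-- `D_p H (x, p)`. -/
def DpH {d : ℕ} (S : MFGSetting d) (x p : Vd d) : Vd d :=
  fun i => fderiv ℝ (fun p' => S.H x p') p (Pi.single i 1)

/-- `C^{1,2}` regularity on `I × 𝕋^d` of a (periodic) time-dependent function. -/
def Creg12 {d : ℕ} (u : ℝ → Vd d → ℝ) (I : Set ℝ) : Prop :=
  ContinuousOn (fun q : ℝ × Vd d => u q.1 q.2) (I ×ˢ Set.univ) ∧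
  (∀ x : Vd d, ∀ t ∈ I, DifferentiableAt ℝ (fun s => u s x) t) ∧
  (∀ t ∈ I, ContDiff ℝ 2 (u t)) ∧
  (∀ t ∈ I, ∀ (x : Vd d) (z : Fin d → ℤ), u t (x + intVec z) = u t x)

/-- `(u,m)` is a classical solution of the `δ`-discounted MFG system on `[0,∞) × 𝕋^d`:
`-∂ₜ u - Δ u + δ u + H(x,Du) = F(x,m)` and `-∂ₜ m + Δ m + div(m D_pH(x,Du)) = 0`. -/
def SolvesDiscMFG {d : ℕ} (S : MFGSetting d) (δ : ℝ) (u : ℝ → Vd d → ℝ) (m : ℝ → PTd d) : Prop :=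
  Creg12 u (Set.Ici 0) ∧
  (∀ t ∈ Set.Ici (0:ℝ), ∀ x : Vd d,
    - tderiv u t x - lapl (u t) x + δ * u t x + S.H x (gradv (u t) x)
      = S.Fd (m t : Measure (Td d)) x) ∧
  W1ContOn m (Set.Ici 0) ∧
  (∀ s₁ s₂ : ℝ, 0 ≤ s₁ → s₁ ≤ s₂ →
    FPeq 1 m (fun s y => DpH S (secT y) (gradv (u s) (secT y))) s₁ s₂)

/-- Admissible pairs for the stationary (ergodic) problem:
`σ Δ m + div(m α) = 0` in the sense of distributions and `α ∈ L²_m`. -/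
def StatAdm {d : ℕ} (σ : ℝ) (m : PTd d) (α : Td d → Vd d) : Prop :=
  Measurable α ∧
  (∫⁻ y, ENNReal.ofReal (sqnorm (α y)) ∂(m : Measure (Td d))) < ⊤ ∧
  ∀ g : Vd d → ℝ, ContDiff ℝ 2 g → (∀ (x : Vd d) (z : Fin d → ℤ), g (x + intVec z) = g x) →
    (∫ y, (σ * lapl g (secT y) - dotp (α y) (gradv g (secT y))) ∂(m : Measure (Td d))) = 0

/-- `ergInf S σ = -λ̄`, the value of the stationary minimization problem. -/
def ergInf {d : ℕ} (S : MFGSetting d) (σ : ℝ) : ℝ :=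
  sInf { r | ∃ m α, StatAdm σ m α ∧
    r = (∫ y, S.Hstar (secT y) (α y) ∂(m : Measure (Td d))) + S.Fc m }

/-- The set of values over which the dynamic programming principle for a corrector
`χ` takes its infimum. -/
def DPPval {d : ℕ} (S : MFGSetting d) (σ : ℝ) (χ : PTd d → ℝ) (lam t : ℝ) (m₀ : PTd d) :
    Set ℝ :=
  { r | ∃ m α, AdmOn S σ m₀ t m α ∧
      r = (∫ s in (0:ℝ)..t, runCost S m α s) + χ (m t) + lam * t }

/-- `χ` is a corrector function: it is continuous and satisfies the dynamic
programming principle with the critical value `λ`. -/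
def IsCorrector {d : ℕ} (S : MFGSetting d) (σ : ℝ) (lam : ℝ) (χ : PTd d → ℝ) : Prop :=
  W1Continuous χ ∧ ∀ (m₀ : PTd d) (t : ℝ), 0 < t → χ m₀ = sInf (DPPval S σ χ lam t m₀)

/-- `(m,α)` is a calibrated curve (defined on all of `ℝ`). -/
def IsCalibrated {d : ℕ} (S : MFGSetting d) (σ : ℝ) (lam : ℝ)
    (m : ℝ → PTd d) (α : ℝ → Td d → Vd d) : Prop :=
  W1ContOn m Set.univ ∧
  (∀ s₁ s₂ : ℝ, s₁ ≤ s₂ → FPeq σ m α s₁ s₂) ∧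
  Measurable (fun q : ℝ × Td d => α q.1 q.2) ∧
  (∀ t₁ t₂ : ℝ, (∫⁻ s in Set.Ioc t₁ t₂,
      ∫⁻ y, ENNReal.ofReal (sqnorm (α s y)) ∂(m s : Measure (Td d))) < ⊤) ∧
  (∀ t₁ t₂ : ℝ, IntervalIntegrable (runCost S m α) volume t₁ t₂) ∧
  ∃ χ : PTd d → ℝ, IsCorrector S σ lam χ ∧ ∀ t₁ t₂ : ℝ, t₁ < t₂ →
    χ (m t₁) = lam * (t₂ - t₁) + (∫ s in t₁..t₂, runCost S m α s) + χ (m t₂)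

/-- The projected Mather set. -/
def MatherSet {d : ℕ} (S : MFGSetting d) (σ : ℝ) (lam : ℝ) : Set (PTd d) :=
  { μ | ∃ m α, IsCalibrated S σ lam m α ∧ m 0 = μ }

/-- Invariant subsets of the projected Mather set. -/
def IsInvariantMFG {d : ℕ} (S : MFGSetting d) (σ : ℝ) (lam : ℝ) (C : Set (PTd d)) : Prop :=
  ∀ μ ∈ C, ∃ m α, IsCalibrated S σ lam m α ∧ m 0 = μ ∧ ∀ t : ℝ, m t ∈ C

/-- Minimal invariant subsets of the projected Mather set. -/
def IsMinimalInvariant {d : ℕ} (S : MFGSetting d) (σ : ℝ) (lam : ℝ) (N : Set (PTd d)) : Prop :=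
  N.Nonempty ∧ N ⊆ MatherSet S σ lam ∧ IsClosedW1 N ∧ IsInvariantMFG S σ lam N ∧
  ∀ C : Set (PTd d), C ⊆ N → C.Nonempty → IsClosedW1 C → IsInvariantMFG S σ lam C → C = N

/-- `δ 𝒱_δ → -λ` uniformly as `δ → 0⁺`. -/
def IsLimitValueV {d : ℕ} (S : MFGSetting d) (σ : ℝ) (lam : ℝ) : Prop :=
  ∀ ε > 0, ∃ δ₀ > 0, ∀ δ : ℝ, 0 < δ → δ ≤ δ₀ → ∀ μ : PTd d,
    |δ * Vfun S σ δ μ - (-lam)| < ε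

/-- `𝒰(T,·)/T → -λ` uniformly as `T → ∞`. -/
def IsLimitValueU {d : ℕ} (S : MFGSetting d) (σ : ℝ) (lam : ℝ) : Prop :=
  ∀ ε > 0, ∃ T₀ : ℝ, ∀ T : ℝ, T₀ ≤ T → ∀ μ : PTd d,
    |Ufun S σ T μ / T - (-lam)| < ε

/-- A function `Φ` on `P(𝕋^d)` is `C¹` with flat derivative `dΦ` (normalized so that
`∫ dΦ(m,·) dm = 0`, periodic in the space variable and jointly continuous). -/
def IsC1Flat {d : ℕ} (Φ : PTd d → ℝ) (dΦ : Measure (Td d) → Vd d → ℝ) : Prop :=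
  (∀ (μ : Measure (Td d)) (x : Vd d) (z : Fin d → ℤ), dΦ μ (x + intVec z) = dΦ μ x) ∧
  (∀ μ ν : PTd d,
    Φ ν - Φ μ = ∫ t in Set.Icc (0:ℝ) 1,
      ((∫ y, dΦ (lineComb t μ ν) (secT y) ∂(ν : Measure (Td d))) -
        ∫ y, dΦ (lineComb t μ ν) (secT y) ∂(μ : Measure (Td d)))) ∧
  (∀ μ : PTd d, (∫ y, dΦ (μ : Measure (Td d)) (secT y) ∂(μ : Measure (Td d))) = 0) ∧
  (∀ ε > 0, ∀ (μ : PTd d) (x : Vd d), ∃ η > 0, ∀ (ν : PTd d) (x' : Vd d),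
    W1 μ ν < η → ‖x' - x‖ < η → |dΦ (ν : Measure (Td d)) x' - dΦ (μ : Measure (Td d)) x| < ε)

section
variable {d : ℕ}



def pj (v : Vd d) : Td d := fun i => (v i : AddCircle (1:ℝ))

lemma pj_secT (y : Td d) : pj (secT y) = y := by
  funext i
  exact AddCircle.coe_equivIco (a := (0:ℝ)) (p := (1:ℝ))

lemma pj_add (v w : Vd d) : pj (v + w) = pj v + pj w := by
  funext i; simp [pj]

lemma pj_zero : pj (0 : Vd d) = 0 := by
  funext i; simp [pj]

lemma pj_eq_imp {v w : Vd d} (h : pj v = pj w) : ∃ z : Fin d → ℤ, w = v + intVec z := by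
  have h1 : ∀ i, ∃ n : ℤ, w i = v i + n := by
    intro i
    have h2 : ((v i : ℝ) : AddCircle (1:ℝ)) = (w i : ℝ) := congrFun h i
    have h3 : ((w i - v i : ℝ) : AddCircle (1:ℝ)) = 0 := by
      rw [AddCircle.coe_sub, h2, sub_self]
    rw [AddCircle.coe_eq_zero_iff] at h3
    obtain ⟨n, hn⟩ := h3
    exact ⟨n, by simp at hn; linarith⟩
  choose z hz using h1
  exact ⟨z, funext hz⟩

def Per {β : Type*} (g : Vd d → β) : Prop :=
  ∀ (x : Vd d) (z : Fin d → ℤ), g (x + intVec z) = g x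

lemma Per.pj {β : Type*} {g : Vd d → β} (hg : Per g) {v w : Vd d} (h : pj v = pj w) :
    g v = g w := by
  obtain ⟨z, rfl⟩ := pj_eq_imp h
  exact (hg v z).symm

lemma Per.sec {β : Type*} {g : Vd d → β} (hg : Per g) (v : Vd d) :
    g (secT (_root_.pj v)) = g v := hg.pj (pj_secT _)

lemma Per.sec_add {β : Type*} {g : Vd d → β} (hg : Per g) (y : Td d) (v : Vd d) :
    g (secT (y + _root_.pj v)) = g (secT y + v) :=
  hg.pj (by rw [pj_secT, pj_add, pj_secT])

lemma pj_quot : IsOpenQuotientMap (pj : Vd d → Td d) :=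
  IsOpenQuotientMap.piMap (fun _ => QuotientAddGroup.isOpenQuotientMap_mk)

lemma continuous_pj : Continuous (pj : Vd d → Td d) := pj_quot.continuous

lemma Per.cont {β : Type*} [TopologicalSpace β] {g : Vd d → β} (hg : Per g)
    (hc : Continuous g) : Continuous (fun y : Td d => g (secT y)) := by
  rw [← pj_quot.continuous_comp_iff]
  convert hc using 1
  funext v; exact hg.sec v

lemma Per.cont2 {X β : Type*} [TopologicalSpace X] [TopologicalSpace β]
    {g : X → Vd d → β} (hg : ∀ s, Per (g s))
    (hc : Continuous (fun q : X × Vd d => g q.1 q.2)) :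
    Continuous (fun q : X × Td d => g q.1 (secT q.2)) := by
  have h : IsOpenQuotientMap (Prod.map (id : X → X) (_root_.pj : Vd d → Td d)) :=
    IsOpenQuotientMap.id.prodMap pj_quot
  rw [← h.continuous_comp_iff]
  convert hc using 1
  funext v; exact (hg v.1).sec v.2

lemma measurable_secT : Measurable (secT : Td d → Vd d) := by
  refine measurable_pi_lambda _ (fun i => ?_)
  exact measurable_subtype_coe.comp
    ((AddCircle.measurableEquivIco 1 0).measurable.comp (measurable_pi_apply i))

lemma secT_mem (y : Td d) (i : Fin d) : 0 ≤ secT y i ∧ secT y i < 1 := by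
  have := ((AddCircle.equivIco 1 0) (y i)).2
  simpa [secT] using this

lemma norm_secT_le (y : Td d) : ‖secT y‖ ≤ 1 := by
  rw [pi_norm_le_iff_of_nonneg zero_le_one]
  intro i
  rw [Real.norm_eq_abs, abs_le]
  have := secT_mem y i
  constructor <;> linarith

/-- centered lift -/
def lft (y : Td d) : Vd d := fun i => secT y i - round (secT y i)

lemma pj_lft (y : Td d) : pj (lft y) = y := by
  conv_rhs => rw [← pj_secT y]
  funext i
  simp only [pj, lft]
  rw [AddCircle.coe_sub]
  have : (((round (secT y i) : ℤ) : ℝ) : AddCircle (1:ℝ)) = 0 := by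
    rw [AddCircle.coe_eq_zero_iff]; exact ⟨round (secT y i), by simp⟩
  rw [this, sub_zero]

lemma norm_lft (y : Td d) : ‖lft y‖ ≤ ‖y‖ := by
  rw [pi_norm_le_iff_of_nonneg (norm_nonneg _)]
  intro i
  refine le_trans ?_ (norm_le_pi_norm y i)
  conv_rhs => rw [← pj_secT y]
  simp only [pj, lft]
  rw [UnitAddCircle.norm_eq, Real.norm_eq_abs]

lemma measurable_lft : Measurable (lft : Td d → Vd d) := by
  refine measurable_pi_lambda _ (fun i => ?_)
  have h := (measurable_pi_apply i).comp (measurable_secT (d := d))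
  have h2 : Measurable (fun r : ℝ => ((round r : ℤ) : ℝ)) := by
    have : (fun r : ℝ => ((round r : ℤ) : ℝ)) = fun r => ((⌊r + 1/2⌋ : ℤ) : ℝ) := by
      funext r; rw [round_eq]
    rw [this]
    exact measurable_from_top.comp (Int.measurable_floor.comp (measurable_id.add_const _))
  exact h.sub (h2.comp h)

lemma norm_Td_le (y : Td d) : ‖y‖ ≤ 1 := by
  rw [pi_norm_le_iff_of_nonneg zero_le_one]
  intro i
  have := AddCircle.norm_le_half_period (1:ℝ) (x := y i) one_ne_zero
  rw [abs_one] at this; linarith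

lemma norm_pj_le (v : Vd d) : ‖pj v‖ ≤ ‖v‖ := by
  rw [pi_norm_le_iff_of_nonneg (norm_nonneg _)]
  intro i
  refine le_trans ?_ (norm_le_pi_norm v i)
  simp only [pj]
  rw [UnitAddCircle.norm_eq, Real.norm_eq_abs]
  simpa using round_le (v i) 0

instance : IsProbabilityMeasure (volume : Measure (AddCircle (1:ℝ))) :=
  ⟨by rw [AddCircle.measure_univ]; simp⟩

def haar (d : ℕ) : PTd d := ⟨(volume : Measure (Td d)), inferInstance⟩


open BoundedContinuousFunction in
lemma cont_pairB : Continuous (fun p : (BoundedContinuousFunction (Td d) ℝ) × PTd d =>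
    ∫ y, p.1 y ∂(p.2 : Measure (Td d))) := by
  rw [continuous_iff_continuousAt]
  rintro ⟨f, μ⟩
  have h1 : Tendsto (fun p : (BoundedContinuousFunction (Td d) ℝ) × PTd d =>
      ∫ y, f y ∂(p.2 : Measure (Td d))) (nhds (f, μ)) (nhds (∫ y, f y ∂(μ : Measure (Td d)))) :=
    (ProbabilityMeasure.tendsto_iff_forall_integral_tendsto.1 (continuous_snd.tendsto (f, μ))) f
  have h2 : Tendsto (fun p : (BoundedContinuousFunction (Td d) ℝ) × PTd d =>
      ∫ y, (p.1 - f) y ∂(p.2 : Measure (Td d))) (nhds (f, μ)) (nhds 0) := by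
    have h3 : Tendsto (fun p : (BoundedContinuousFunction (Td d) ℝ) × PTd d => ‖p.1 - f‖)
        (nhds (f, μ)) (nhds 0) := by
      have : Continuous (fun p : (BoundedContinuousFunction (Td d) ℝ) × PTd d => ‖p.1 - f‖) := by
        fun_prop
      simpa using this.tendsto (f, μ)
    refine squeeze_zero_norm (fun p => ?_) h3
    have := norm_integral_le_of_norm_le_const (μ := (p.2 : Measure (Td d)))
      (f := fun y => (p.1 - f) y) (C := ‖p.1 - f‖)
      (Eventually.of_forall (fun y => (p.1 - f).norm_coe_le_norm y))
    simpa using this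
  have h4 := h1.add h2
  rw [add_zero] at h4
  refine h4.congr (fun p => ?_)
  rw [← integral_add (f.integrable _) ((p.1 - f).integrable _)]
  simp

lemma cont_pair {X : Type*} [TopologicalSpace X] {f : X → Td d → ℝ}
    (hf : Continuous (fun q : X × Td d => f q.1 q.2)) {m : X → PTd d} {s : Set X}
    (hm : ContinuousOn m s) :
    ContinuousOn (fun x => ∫ y, f x y ∂(m x : Measure (Td d))) s := by
  let F : X → C(Td d, ℝ) := fun x => ⟨f x, hf.comp (by fun_prop : Continuous fun y => (x, y))⟩
  have hF : Continuous F := ContinuousMap.continuous_of_continuous_uncurry F hf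
  have hB : Continuous (fun x => BoundedContinuousFunction.mkOfCompact (F x)) := by
    exact (ContinuousMap.isometryEquivBoundedOfCompact (Td d) ℝ).continuous.comp hF
  exact cont_pairB.comp_continuousOn (hB.continuousOn.prodMk hm)

lemma cont_pair' {X : Type*} [TopologicalSpace X] {f : X → Td d → ℝ}
    (hf : Continuous (fun q : X × Td d => f q.1 q.2)) {m : X → PTd d}
    (hm : Continuous m) :
    Continuous (fun x => ∫ y, f x y ∂(m x : Measure (Td d))) := by
  rw [← continuousOn_univ] at *
  exact cont_pair (continuousOn_univ.1 hf) hm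

lemma int_cont {f : Td d → ℝ} (hf : Continuous f) (μ : Measure (Td d)) [IsFiniteMeasure μ] :
    Integrable f μ := by
  obtain ⟨C, hC⟩ := isCompact_univ.exists_bound_of_continuousOn hf.continuousOn
  exact Integrable.of_bound hf.aestronglyMeasurable C (Eventually.of_forall (fun x => hC x trivial))

lemma cont_of_pair {X : Type*} [TopologicalSpace X] {m : X → PTd d} {s : Set X}
    (h : ∀ f : Td d → ℝ, Continuous f →
      ContinuousOn (fun x => ∫ y, f y ∂(m x : Measure (Td d))) s) : ContinuousOn m s := by
  intro x hx
  exact ProbabilityMeasure.tendsto_iff_forall_integral_tendsto.2 (fun f => h f f.continuous x hx)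

lemma ptd_ext {μ ν : PTd d} (h : ∀ f : Td d → ℝ, Continuous f →
    ∫ y, f y ∂(μ : Measure (Td d)) = ∫ y, f y ∂(ν : Measure (Td d))) : μ = ν := by
  have : (μ : Measure (Td d)) = ν :=
    ext_of_forall_integral_eq_of_IsFiniteMeasure (fun f => h f f.continuous)
  exact Subtype.ext this


lemma W1_bd (μ ν : PTd d) {φ : Td d → ℝ} {K : NNReal} (hφ : LipschitzWith K φ) :
    (∫ y, φ y ∂(μ : Measure (Td d))) - ∫ y, φ y ∂(ν : Measure (Td d)) ≤ 2 * K := by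
  have h1 : ∀ y, |φ y - φ 0| ≤ K := by
    intro y
    have := hφ.dist_le_mul y 0
    rw [Real.dist_eq, dist_zero_right] at this
    exact this.trans (by
      have := norm_Td_le y
      have hK : (0:ℝ) ≤ K := K.2
      nlinarith)
  have h2 : ∫ y, φ y ∂(μ : Measure (Td d)) ≤ φ 0 + K := by
    have : ∫ y, φ y ∂(μ : Measure (Td d)) ≤ ∫ y, (φ 0 + K) ∂(μ : Measure (Td d)) := by
      refine integral_mono (int_cont hφ.continuous _) (integrable_const _) (fun y => ?_)
      have := (abs_le.1 (h1 y)).2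
      simp only; linarith
    simpa using this
  have h3 : φ 0 - K ≤ ∫ y, φ y ∂(ν : Measure (Td d)) := by
    have : ∫ y, (φ 0 - K) ∂(ν : Measure (Td d)) ≤ ∫ y, φ y ∂(ν : Measure (Td d)) := by
      refine integral_mono (integrable_const _) (int_cont hφ.continuous _) (fun y => ?_)
      have := (abs_le.1 (h1 y)).1
      simp only; linarith
    simpa using this
  linarith

lemma W1_bddAbove (μ ν : PTd d) : BddAbove { r | ∃ φ : Td d → ℝ, LipschitzWith 1 φ ∧
    r = (∫ y, φ y ∂(μ : Measure (Td d))) - ∫ y, φ y ∂(ν : Measure (Td d)) } := by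
  refine ⟨2, ?_⟩
  rintro r ⟨φ, hφ, rfl⟩
  simpa using W1_bd μ ν hφ

lemma le_W1 (μ ν : PTd d) {φ : Td d → ℝ} (hφ : LipschitzWith 1 φ) :
    (∫ y, φ y ∂(μ : Measure (Td d))) - ∫ y, φ y ∂(ν : Measure (Td d)) ≤ W1 μ ν :=
  le_csSup (W1_bddAbove μ ν) ⟨φ, hφ, rfl⟩

lemma W1_le (μ ν : PTd d) {r : ℝ} (h : ∀ φ : Td d → ℝ, LipschitzWith 1 φ →
    (∫ y, φ y ∂(μ : Measure (Td d))) - ∫ y, φ y ∂(ν : Measure (Td d)) ≤ r) : W1 μ ν ≤ r := by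
  refine csSup_le ⟨0, fun _ => 0, LipschitzWith.const' 0 , by simp⟩ ?_
  rintro r ⟨φ, hφ, rfl⟩
  exact h φ hφ

lemma W1_nonneg (μ ν : PTd d) : 0 ≤ W1 μ ν := by
  have := le_W1 μ ν (φ := fun _ => 0) (LipschitzWith.const' 0)
  simpa using this

lemma W1_symm (μ ν : PTd d) : W1 μ ν = W1 ν μ := by
  have key : ∀ μ ν : PTd d, W1 μ ν ≤ W1 ν μ := by
    intro μ ν
    refine W1_le _ _ (fun φ hφ => ?_)
    have := le_W1 ν μ (φ := fun y => - φ y) hφ.neg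
    rw [integral_neg, integral_neg] at this
    linarith
  exact le_antisymm (key _ _) (key _ _)

lemma W1_self (μ : PTd d) : W1 μ μ = 0 := by
  refine le_antisymm (W1_le _ _ (fun φ hφ => by simp)) (W1_nonneg _ _)

lemma W1_triangle (μ ν ρ : PTd d) : W1 μ ρ ≤ W1 μ ν + W1 ν ρ := by
  refine W1_le _ _ (fun φ hφ => ?_)
  have := le_W1 μ ν hφ
  have := le_W1 ν ρ hφ
  linarith

lemma lip_le_W1 (μ ν : PTd d) {φ : Td d → ℝ} {K : ℝ} (hK : 0 ≤ K)
    (hφ : ∀ x y, |φ x - φ y| ≤ K * dist x y) :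
    (∫ y, φ y ∂(μ : Measure (Td d))) - ∫ y, φ y ∂(ν : Measure (Td d)) ≤ K * W1 μ ν := by
  have hL : ∀ K : ℝ, 0 < K → (∀ x y, |φ x - φ y| ≤ K * dist x y) →
    (∫ y, φ y ∂(μ : Measure (Td d))) - ∫ y, φ y ∂(ν : Measure (Td d)) ≤ K * W1 μ ν := by
    intro K hK hφ
    have := le_W1 μ ν (φ := fun y => K⁻¹ * φ y) (by
      refine LipschitzWith.of_dist_le_mul (fun x y => ?_)
      rw [Real.dist_eq, ← mul_sub, abs_mul, abs_of_pos (inv_pos.2 hK)]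
      have := hφ x y
      rw [inv_mul_le_iff₀ hK]
      simpa using this)
    rw [integral_const_mul, integral_const_mul, ← mul_sub, inv_mul_le_iff₀ hK] at this
    exact this
  rcases hK.eq_or_lt with h | h
  · subst h
    refine le_of_forall_pos_le_add (fun ε hε => ?_)
    have := hL (ε / 2) (by positivity) (fun x y => (hφ x y).trans (by
      rw [zero_mul]; positivity))
    have h2 : W1 μ ν ≤ 2 := W1_le _ _ (fun φ hφ => by simpa using W1_bd μ ν hφ)
    nlinarith
  · exact hL K h hφ

lemma W1_cont (μ : PTd d) : Continuous (fun p : PTd d => W1 p μ) := by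
  let A : Set (BoundedContinuousFunction (Td d) ℝ) := {f | LipschitzWith 1 f ∧ f 0 = 0}
  have hA : IsCompact A := by
    refine BoundedContinuousFunction.arzela_ascoli₂ (Icc (-1:ℝ) 1) isCompact_Icc A ?_ ?_ ?_
    · have : A = {f | f 0 = 0} ∩ ⋂ x : Td d, ⋂ y : Td d, {f | dist (f x) (f y) ≤ dist x y} := by
        ext f
        simp only [A, mem_ofPred_eq, mem_inter_iff, mem_iInter]
        rw [and_comm]
        refine and_congr Iff.rfl ⟨fun h x y => by simpa using h.dist_le_mul x y, fun h =>
          LipschitzWith.of_dist_le_mul (by simpa using h)⟩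
      rw [this]
      refine IsClosed.inter (isClosed_eq (by fun_prop) (by fun_prop))
        (isClosed_iInter (fun x => isClosed_iInter (fun y => isClosed_le ?_ (by fun_prop))))
      exact Continuous.dist (by fun_prop) (by fun_prop)
    · rintro f x ⟨hf, h0⟩
      have := hf.dist_le_mul x 0
      rw [h0, Real.dist_eq, dist_zero_right] at this
      have h1 := norm_Td_le x
      simp at this
      rw [mem_Icc, ← abs_le]
      linarith
    · exact (LipschitzWith.uniformEquicontinuous _ 1 (fun f => f.2.1)).equicontinuous
  have h := hA.continuous_sSup (γ := PTd d)
    (f := fun p f => (∫ y, f y ∂(p : Measure (Td d))) - ∫ y, f y ∂(μ : Measure (Td d))) (by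
      have h1 := cont_pairB (d := d)
      have e1 : Continuous (fun q : PTd d × BoundedContinuousFunction (Td d) ℝ =>
        (q.2, q.1)) := by fun_prop
      have e2 : Continuous (fun q : PTd d × BoundedContinuousFunction (Td d) ℝ =>
        (q.2, μ)) := by fun_prop
      exact (h1.comp e1).sub (h1.comp e2))
  convert h using 1
  funext p
  unfold W1
  congr 1
  ext r
  constructor
  · rintro ⟨φ, hφ, rfl⟩
    have hc : Continuous (fun y => φ y - φ 0) := hφ.continuous.sub continuous_const
    refine ⟨BoundedContinuousFunction.mkOfCompact ⟨fun y => φ y - φ 0, hc⟩, ⟨?_, ?_⟩, ?_⟩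
    · refine LipschitzWith.of_dist_le_mul (fun x y => ?_)
      have := hφ.dist_le_mul x y
      simpa using this
    · simp
    · simp only [BoundedContinuousFunction.mkOfCompact_apply, ContinuousMap.coe_mk]
      rw [integral_sub (int_cont hφ.continuous _) (integrable_const _),
        integral_sub (int_cont hφ.continuous _) (integrable_const _)]
      simp
  · rintro ⟨f, hf, rfl⟩
    exact ⟨f, hf.1, rfl⟩

lemma tendsto_of_W1 {ι : Type*} {l : Filter ι} {m : ι → PTd d} {μ : PTd d}
    (h : Tendsto (fun i => W1 (m i) μ) l (nhds 0)) : Tendsto m l (nhds μ) := by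
  refine tendsto_nhds_of_unique_mapClusterPt (fun x hx => ?_)
  have h1 : Continuous (fun ν : PTd d => W1 ν μ) := W1_cont μ
  have h2 : MapClusterPt (W1 x μ) l (fun i => W1 (m i) μ) := hx.continuousAt_comp h1.continuousAt
  have h3 : W1 x μ = 0 := by
    have h4 : (nhds (W1 x μ) ⊓ map (fun i => W1 (m i) μ) l).NeBot := h2
    have h5 : (nhds (W1 x μ) ⊓ nhds (0:ℝ)).NeBot := h4.mono (inf_le_inf_left _ h)
    exact eq_of_nhds_neBot h5
  have hxμ : Tendsto (fun _ : ℕ => x) atTop (nhds μ) := by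
    rw [tendsto_iff_forall_lipschitz_integral_tendsto]
    rintro f - ⟨L, hL⟩
    have key : ∀ μ ν : PTd d, W1 μ ν = 0 → (∫ y, f y ∂(μ : Measure (Td d))) ≤
        ∫ y, f y ∂(ν : Measure (Td d)) := by
      intro μ ν h
      have := lip_le_W1 μ ν (φ := f) L.2 (fun x y => hL.dist_le_mul x y)
      rw [h] at this; linarith
    rw [le_antisymm (key _ _ h3) (key _ _ (by rw [W1_symm]; exact h3))]
    exact tendsto_const_nhds
  exact tendsto_nhds_unique tendsto_const_nhds hxμ

lemma W1_of_tendsto {ι : Type*} {l : Filter ι} {m : ι → PTd d} {μ : PTd d}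
    (h : Tendsto m l (nhds μ)) : Tendsto (fun i => W1 (m i) μ) l (nhds 0) := by
  have h1 : Continuous (fun ν : PTd d => W1 ν μ) := W1_cont μ
  have := (h1.tendsto μ).comp h
  rwa [W1_self] at this

lemma W1ContOn_iff (m : ℝ → PTd d) (I : Set ℝ) : W1ContOn m I ↔ ContinuousOn m I := by
  constructor
  · intro h t ht
    refine tendsto_of_W1 ?_
    rw [Metric.tendsto_nhds]
    intro ε hε
    obtain ⟨η, hη, H⟩ := h t ht ε hε
    rw [eventually_iff, mem_nhdsWithin_iff_exists_mem_nhds_inter]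
    refine ⟨Metric.ball t η, Metric.ball_mem_nhds _ hη, ?_⟩
    rintro s ⟨hs, hsI⟩
    have := H s hsI (by simpa [Real.dist_eq] using hs)
    simpa [Real.dist_eq, abs_of_nonneg (W1_nonneg _ _)] using this
  · intro h t ht ε hε
    have h1 := W1_of_tendsto (h t ht)
    rw [Metric.tendsto_nhds] at h1
    have h2 := h1 ε hε
    rw [eventually_iff, mem_nhdsWithin_iff_exists_mem_nhds_inter] at h2
    obtain ⟨u, hu, H⟩ := h2
    obtain ⟨η, hη, hb⟩ := Metric.mem_nhds_iff.1 hu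
    refine ⟨η, hη, fun s hs hst => ?_⟩
    have := H ⟨hb (by simpa [Real.dist_eq] using hst), hs⟩
    simpa [Real.dist_eq, abs_of_nonneg (W1_nonneg _ _)] using this

lemma W1Continuous_iff (χ : PTd d → ℝ) : W1Continuous χ ↔ Continuous χ := by
  constructor
  · intro h
    rw [continuous_iff_continuousAt]
    intro μ
    unfold ContinuousAt
    rw [Metric.tendsto_nhds]
    intro ε hε
    obtain ⟨η, hη, H⟩ := h μ ε hε
    have h1 := W1_of_tendsto (tendsto_id (x := nhds μ))
    have h2 := (Metric.tendsto_nhds.1 h1) η hη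
    filter_upwards [h2] with ν hν
    rw [Real.dist_eq]
    refine H ν ?_
    rw [W1_symm]
    simpa [Real.dist_eq, abs_of_nonneg (W1_nonneg _ _)] using hν
  · intro h μ ε hε
    by_contra hcon
    push Not at hcon
    have : ∀ n : ℕ, ∃ ν : PTd d, W1 μ ν < 1 / ((n:ℝ) + 1) ∧ ε ≤ |χ ν - χ μ| :=
      fun n => hcon _ (by positivity)
    choose ν h1 h2 using this
    have h3 : Tendsto ν atTop (nhds μ) := by
      refine tendsto_of_W1 (squeeze_zero (fun n => W1_nonneg _ _) (fun n => ?_)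
        tendsto_one_div_add_atTop_nhds_zero_nat)
      rw [W1_symm]; exact (h1 n).le
    have h4 := (h.tendsto μ).comp h3
    rw [Metric.tendsto_nhds] at h4
    obtain ⟨n, hn⟩ := (h4 ε hε).exists
    exact absurd (h2 n) (not_le.2 hn)



def unc (φ : ℝ → Vd d → ℝ) : ℝ × Vd d → ℝ := fun q => φ q.1 q.2

lemma IsTestFun.cd {φ : ℝ → Vd d → ℝ} (h : IsTestFun φ) : ContDiff ℝ 2 (unc φ) := h.1

lemma IsTestFun.per {φ : ℝ → Vd d → ℝ} (h : IsTestFun φ) (s : ℝ) : Per (φ s) := h.2 s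

lemma IsTestFun.diff {φ : ℝ → Vd d → ℝ} (h : IsTestFun φ) : Differentiable ℝ (unc φ) :=
  h.cd.differentiable (by norm_num)

lemma IsTestFun.cd1 {φ : ℝ → Vd d → ℝ} (h : IsTestFun φ) (V : ℝ × Vd d) :
    ContDiff ℝ 1 (fun q => fderiv ℝ (unc φ) q V) :=
  (h.cd.fderiv_right (m := 1) (by norm_num)).clm_apply contDiff_const

lemma IsTestFun.cx {φ : ℝ → Vd d → ℝ} (h : IsTestFun φ) (s : ℝ) : ContDiff ℝ 2 (φ s) :=
  h.cd.comp (contDiff_const.prodMk contDiff_id)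

lemma hfd_x {Φ : ℝ × Vd d → ℝ} (h : Differentiable ℝ Φ) (s : ℝ) (x v : Vd d) :
    fderiv ℝ (fun x => Φ (s, x)) x v = fderiv ℝ Φ (s, x) (0, v) := by
  have h1 : HasFDerivAt (fun x : Vd d => (s, x)) (ContinuousLinearMap.inr ℝ ℝ (Vd d)) x :=
    hasFDerivAt_prodMk_right s x
  have h2 := (h (s, x)).hasFDerivAt.comp x h1
  have h3 : fderiv ℝ (fun x => Φ (s, x)) x = _ := h2.fderiv
  rw [h3]; simp

lemma hfd_t {Φ : ℝ × Vd d → ℝ} (h : Differentiable ℝ Φ) (s : ℝ) (x : Vd d) :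
    HasDerivAt (fun s => Φ (s, x)) (fderiv ℝ Φ (s, x) (1, 0)) s := by
  have h1 : HasDerivAt (fun s : ℝ => (s, x)) ((1:ℝ), (0 : Vd d)) s :=
    (hasDerivAt_id s).prodMk (hasDerivAt_const s x)
  exact (h (s, x)).hasFDerivAt.comp_hasDerivAt s h1

lemma IsTestFun.fd {φ : ℝ → Vd d → ℝ} (h : IsTestFun φ) (s : ℝ) (x v : Vd d) :
    fderiv ℝ (φ s) x v = fderiv ℝ (unc φ) (s, x) (0, v) := hfd_x h.diff s x v

lemma IsTestFun.td {φ : ℝ → Vd d → ℝ} (h : IsTestFun φ) (s : ℝ) (x : Vd d) :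
    HasDerivAt (fun s => φ s x) (fderiv ℝ (unc φ) (s, x) (1, 0)) s := hfd_t h.diff s x

lemma IsTestFun.td' {φ : ℝ → Vd d → ℝ} (h : IsTestFun φ) (s : ℝ) (x : Vd d) :
    HasDerivAt (fun s => φ s x) (tderiv φ s x) s := by
  have := h.td s x
  unfold tderiv; rwa [this.deriv]

lemma IsTestFun.tderiv_eq {φ : ℝ → Vd d → ℝ} (h : IsTestFun φ) (s : ℝ) (x : Vd d) :
    tderiv φ s x = fderiv ℝ (unc φ) (s, x) (1, 0) := (h.td s x).deriv

lemma IsTestFun.D2_eq {φ : ℝ → Vd d → ℝ} (h : IsTestFun φ) (s : ℝ) (x v w : Vd d) :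
    D2 (φ s) x v w = fderiv ℝ (fun q => fderiv ℝ (unc φ) q (0, v)) (s, x) (0, w) := by
  unfold D2
  simp_rw [h.fd s]
  exact hfd_x (Φ := fun q => fderiv ℝ (unc φ) q (0, v))
    ((h.cd1 _).differentiable (by norm_num)) s x w

lemma fderiv_per {g : Vd d → ℝ} (hg : Per g) (v : Vd d) :
    Per (fun x => fderiv ℝ g x v) := by
  intro x z
  have : (fun y => g (y + intVec z)) = g := funext (fun y => hg y z)
  have h2 : fderiv ℝ (fun y => g (y + intVec z)) x = fderiv ℝ g (x + intVec z) :=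
    fderiv_comp_add_right _
  rw [this] at h2
  simp only [h2]

lemma gradv_per {g : Vd d → ℝ} (hg : Per g) : Per (gradv g) := by
  intro x z
  funext i
  exact fderiv_per hg _ x z

lemma lapl_per {g : Vd d → ℝ} (hg : Per g) : Per (lapl g) := by
  intro x z
  unfold lapl
  refine Finset.sum_congr rfl (fun i _ => ?_)
  exact fderiv_per (fderiv_per hg _) _ x z

lemma tderiv_per {φ : ℝ → Vd d → ℝ} (h : IsTestFun φ) (s : ℝ) : Per (tderiv φ s) := by
  intro x z
  unfold tderiv
  congr 1
  funext s
  exact h.2 s x z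

lemma IsTestFun.cont {φ : ℝ → Vd d → ℝ} (h : IsTestFun φ) :
    Continuous (fun q : ℝ × Vd d => φ q.1 q.2) := h.cd.continuous

lemma IsTestFun.cont_td {φ : ℝ → Vd d → ℝ} (h : IsTestFun φ) :
    Continuous (fun q : ℝ × Vd d => tderiv φ q.1 q.2) := by
  have : (fun q : ℝ × Vd d => tderiv φ q.1 q.2) = fun q => fderiv ℝ (unc φ) q (1, 0) :=
    funext (fun q => h.tderiv_eq q.1 q.2)
  rw [this]; exact (h.cd1 _).continuous

lemma IsTestFun.cont_grad {φ : ℝ → Vd d → ℝ} (h : IsTestFun φ) :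
    Continuous (fun q : ℝ × Vd d => gradv (φ q.1) q.2) := by
  refine continuous_pi (fun i => ?_)
  have : (fun q : ℝ × Vd d => gradv (φ q.1) q.2 i) =
      fun q => fderiv ℝ (unc φ) q (0, Pi.single i 1) :=
    funext (fun q => h.fd q.1 q.2 _)
  rw [this]; exact (h.cd1 _).continuous

lemma IsTestFun.cont_lapl {φ : ℝ → Vd d → ℝ} (h : IsTestFun φ) :
    Continuous (fun q : ℝ × Vd d => lapl (φ q.1) q.2) := by
  unfold lapl
  refine continuous_finsetSum _ (fun i _ => ?_)
  have : (fun q : ℝ × Vd d => D2 (φ q.1) q.2 (Pi.single i 1) (Pi.single i 1)) =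
      fun q => fderiv ℝ (fun q => fderiv ℝ (unc φ) q (0, Pi.single i 1)) q (0, Pi.single i 1) :=
    funext (fun q => h.D2_eq q.1 q.2 _ _)
  rw [this]
  exact (((h.cd1 _).fderiv_right (m := 0) (by norm_num)).clm_apply contDiff_const).continuous

lemma clm_dot (L : Vd d →L[ℝ] ℝ) (y : Vd d) :
    L y = dotp y (fun i => L (Pi.single i 1)) := by
  unfold dotp
  have : y = ∑ i, y i • (Pi.single i 1 : Vd d) := by
    have := pi_eq_sum_univ' y
    simpa [Pi.single, Function.update, eq_comm] using this
  conv_lhs => rw [this]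
  rw [map_sum]
  simp


lemma test_add {φ ψ : ℝ → Vd d → ℝ} (h : IsTestFun φ) (h' : IsTestFun ψ) :
    IsTestFun (fun s x => φ s x + ψ s x) :=
  ⟨h.1.add h'.1, fun t x z => by simp only [h.2, h'.2]⟩

lemma test_time_mul {φ : ℝ → Vd d → ℝ} (h : IsTestFun φ) {η : ℝ → ℝ}
    (hη : ContDiff ℝ 2 η) : IsTestFun (fun s x => η s * φ s x) :=
  ⟨(hη.comp contDiff_fst).mul h.1, fun t x z => by simp only [h.2]⟩

lemma test_space {g : Vd d → ℝ} (hg : ContDiff ℝ 2 g) (hp : Per g) :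
    IsTestFun (fun _ x => g x) :=
  ⟨hg.comp contDiff_snd, fun _ x z => hp x z⟩

lemma test_smul {φ : ℝ → Vd d → ℝ} (h : IsTestFun φ) (c : ℝ) :
    IsTestFun (fun s x => c * φ s x) := test_time_mul h contDiff_const

lemma test_zero : IsTestFun (fun (_ : ℝ) (_ : Vd d) => (0:ℝ)) :=
  ⟨contDiff_const, fun _ _ _ => rfl⟩

/-- affine change of variables -/
def tsh (φ : ℝ → Vd d → ℝ) (A h c₀ c₁ : ℝ) (y : Vd d) : ℝ → Vd d → ℝ :=
  fun s x => A * φ (s + h) (x + (c₀ + c₁ * s) • y)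

lemma test_tsh {φ : ℝ → Vd d → ℝ} (H : IsTestFun φ) (A h c₀ c₁ : ℝ) (y : Vd d) :
    IsTestFun (tsh φ A h c₀ c₁ y) := by
  constructor
  · have : ContDiff ℝ 2 (fun q : ℝ × Vd d => ((q.1 + h, q.2 + (c₀ + c₁ * q.1) • y) : ℝ × Vd d)) := by
      fun_prop
    exact contDiff_const.mul (H.cd.comp this)
  · intro t x z
    unfold tsh
    rw [add_right_comm, H.2]

lemma tderiv_tsh {φ : ℝ → Vd d → ℝ} (H : IsTestFun φ) (A h c₀ c₁ : ℝ) (y : Vd d)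
    (s : ℝ) (x : Vd d) : tderiv (tsh φ A h c₀ c₁ y) s x =
      A * (tderiv φ (s + h) (x + (c₀ + c₁ * s) • y)
        + c₁ * dotp y (gradv (φ (s + h)) (x + (c₀ + c₁ * s) • y))) := by
  have h1 : HasDerivAt (fun s : ℝ => ((s + h, x + (c₀ + c₁ * s) • y) : ℝ × Vd d))
      ((1:ℝ), c₁ • y) s := by
    refine HasDerivAt.prodMk ((hasDerivAt_id s).add_const h) ?_
    have := (((hasDerivAt_id s).const_mul c₁).const_add c₀).smul_const y
    simpa using this.const_add x
  have h2 := ((H.diff (s + h, x + (c₀ + c₁ * s) • y)).hasFDerivAt.comp_hasDerivAt s h1).const_mul A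
  unfold tderiv
  have h3 : deriv (fun s => tsh φ A h c₀ c₁ y s x) s = _ := h2.deriv
  rw [h3]
  congr 1
  have h4 : ((1:ℝ), c₁ • y) = (1, (0 : Vd d)) + c₁ • (0, y) := by simp
  rw [h4, map_add, map_smul, ← (H.td (s + h) (x + (c₀ + c₁ * s) • y)).deriv,
    ← H.fd, smul_eq_mul]
  congr 2
  exact clm_dot _ y

lemma fderiv_tsh {φ : ℝ → Vd d → ℝ} (A h c₀ c₁ : ℝ) (y : Vd d)
    (s : ℝ) (x v : Vd d) : fderiv ℝ (tsh φ A h c₀ c₁ y s) x v =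
      A * fderiv ℝ (φ (s + h)) (x + (c₀ + c₁ * s) • y) v := by
  unfold tsh
  have := fderiv_const_smul_field (𝕜 := ℝ) (R := ℝ) A
    (f := fun x => φ (s+h) (x + (c₀ + c₁ * s) • y))
  have h2 : (A • fun x => φ (s+h) (x + (c₀ + c₁ * s) • y)) =
    fun x => A * φ (s+h) (x + (c₀ + c₁ * s) • y) := rfl
  rw [h2] at this
  rw [this]
  simp only [Pi.smul_apply, fderiv_comp_add_right]
  rfl

lemma gradv_tsh {φ : ℝ → Vd d → ℝ} (A h c₀ c₁ : ℝ) (y : Vd d)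
    (s : ℝ) (x : Vd d) : gradv (tsh φ A h c₀ c₁ y s) x =
      A • gradv (φ (s + h)) (x + (c₀ + c₁ * s) • y) := by
  funext i
  exact fderiv_tsh A h c₀ c₁ y s x _

lemma lapl_tsh {φ : ℝ → Vd d → ℝ} (A h c₀ c₁ : ℝ) (y : Vd d)
    (s : ℝ) (x : Vd d) : lapl (tsh φ A h c₀ c₁ y s) x =
      A * lapl (φ (s + h)) (x + (c₀ + c₁ * s) • y) := by
  unfold lapl D2
  rw [Finset.mul_sum]
  refine Finset.sum_congr rfl (fun i _ => ?_)
  have : (fun z => fderiv ℝ (tsh φ A h c₀ c₁ y s) z (Pi.single i 1)) =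
    tsh (fun s z => fderiv ℝ (φ s) z (Pi.single i 1)) A h c₀ c₁ y s := by
    funext z; exact fderiv_tsh A h c₀ c₁ y s z _
  rw [this, fderiv_tsh]


def LLv (S : MFGSetting d) (φ : ℝ → Vd d → ℝ) (s : ℝ) (x : Vd d) : ℝ :=
  tderiv φ s x + lapl (φ s) x - S.H x (gradv (φ s) x)

lemma LLv_per (S : MFGSetting d) {φ : ℝ → Vd d → ℝ} (h : IsTestFun φ) (s : ℝ) :
    Per (LLv S φ s) := by
  intro x z
  unfold LLv
  rw [tderiv_per h s x z, lapl_per (h.per s) x z, gradv_per (h.per s) x z, S.H_per]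

lemma LLv_cont (S : MFGSetting d) {φ : ℝ → Vd d → ℝ} (h : IsTestFun φ) :
    Continuous (fun q : ℝ × Vd d => LLv S φ q.1 q.2) := by
  unfold LLv
  have hH : Continuous (fun q : Vd d × Vd d => S.H q.1 q.2) := S.H_smooth.continuous
  exact (h.cont_td.add h.cont_lapl).sub (hH.comp (continuous_snd.prodMk h.cont_grad))

def LL (S : MFGSetting d) (φ : ℝ → Vd d → ℝ) (s : ℝ) (y : Td d) : ℝ := LLv S φ s (secT y)

lemma LL_cont (S : MFGSetting d) {φ : ℝ → Vd d → ℝ} (h : IsTestFun φ) :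
    Continuous (fun q : ℝ × Td d => LL S φ q.1 q.2) :=
  Per.cont2 (fun s => LLv_per S h s) (LLv_cont S h)

lemma test_contT {φ : ℝ → Vd d → ℝ} (h : IsTestFun φ) :
    Continuous (fun q : ℝ × Td d => φ q.1 (secT q.2)) :=
  Per.cont2 (fun s => h.per s) h.cont

lemma test_contT' {φ : ℝ → Vd d → ℝ} (h : IsTestFun φ) (s : ℝ) :
    Continuous (fun y : Td d => φ s (secT y)) :=
  (test_contT h).comp (continuous_const.prodMk continuous_id)

/-- integral against a measure on the torus -/
def ig (μ : PTd d) (f : Td d → ℝ) : ℝ := ∫ y, f y ∂(μ : Measure (Td d))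

def Act (S : MFGSetting d) (m : ℝ → PTd d) (a b C : ℝ) : Prop :=
  ∀ φ : ℝ → Vd d → ℝ, IsTestFun φ →
    (∫ s in a..b, ig (m s) (LL S φ s)) + ig (m a) (fun y => φ a (secT y))
      - ig (m b) (fun y => φ b (secT y)) ≤ C


def smoothAlg (d : ℕ) : Subalgebra ℝ C(Td d, ℝ) where
  carrier := {f | ∃ g : Vd d → ℝ, ContDiff ℝ 2 g ∧ Per g ∧ ∀ y, f y = g (secT y)}
  mul_mem' := by
    rintro f f' ⟨g, h1, h2, h3⟩ ⟨g', h1', h2', h3'⟩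
    exact ⟨fun x => g x * g' x, h1.mul h1', fun x z => by simp only [h2 x z, h2' x z],
      fun y => by simp [h3, h3']⟩
  add_mem' := by
    rintro f f' ⟨g, h1, h2, h3⟩ ⟨g', h1', h2', h3'⟩
    exact ⟨fun x => g x + g' x, h1.add h1', fun x z => by simp only [h2 x z, h2' x z],
      fun y => by simp [h3, h3']⟩
  algebraMap_mem' := by
    intro r
    exact ⟨fun _ => r, contDiff_const, fun x z => rfl, fun y => by simp [algebraMap_apply]⟩

lemma smoothAlg_sep (d : ℕ) : (smoothAlg d).SeparatesPoints := by
  intro x y hxy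
  obtain ⟨i, hi⟩ := Function.ne_iff.1 hxy
  have hs : secT x i ≠ secT y i := by
    intro h
    apply hi
    have h1 := congrFun (pj_secT x) i
    have h2 := congrFun (pj_secT y) i
    rw [← h1, ← h2]
    simp only [pj, h]
  have hx := secT_mem x i
  have hy := secT_mem y i
  by_contra hcon
  have hcon' : ∀ g : Vd d → ℝ, ContDiff ℝ 2 g → Per g → g (secT x) = g (secT y) := by
    intro g h1 h2
    by_contra hne
    exact hcon ⟨fun w => g (secT w), ⟨⟨fun w => g (secT w), h2.cont h1.continuous⟩,
      ⟨g, h1, h2, fun _ => rfl⟩, rfl⟩, hne⟩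
  have hc := hcon' (fun v => Real.cos (2 * π * v i)) (by fun_prop) (by
    intro v z
    simp only [Pi.add_apply, intVec]
    rw [show 2 * π * (v i + z i) = 2 * π * v i + (z i) * (2 * π) by ring, Real.cos_add_int_mul_two_pi])
  have hsn := hcon' (fun v => Real.sin (2 * π * v i)) (by fun_prop) (by
    intro v z
    simp only [Pi.add_apply, intVec]
    rw [show 2 * π * (v i + z i) = 2 * π * v i + (z i) * (2 * π) by ring, Real.sin_add_int_mul_two_pi])
  have h1 : Real.cos (2 * π * (secT x i - secT y i)) = 1 := by
    rw [mul_sub, Real.cos_sub]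
    rw [hc, hsn, ← sq, ← sq, Real.cos_sq_add_sin_sq]
  rw [Real.cos_eq_one_iff] at h1
  obtain ⟨n, hn⟩ := h1
  have h2 : (n : ℝ) = secT x i - secT y i := by
    have : (2 * π) * ((n:ℝ) - (secT x i - secT y i)) = 0 := by linarith
    rcases mul_eq_zero.1 this with h | h
    · have := Real.pi_pos; linarith
    · linarith
  have h3 : (n : ℝ) < 1 := by linarith
  have h4 : (-1 : ℝ) < n := by linarith
  have h5 : n < 1 := by exact_mod_cast h3
  have h6 : -1 < n := by exact_mod_cast h4
  have : n = 0 := by omega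
  rw [this] at h2
  apply hs
  push_cast at h2
  linarith

lemma smooth_dense {f : Td d → ℝ} (hf : Continuous f) {ε : ℝ} (hε : 0 < ε) :
    ∃ g : Vd d → ℝ, ContDiff ℝ 2 g ∧ Per g ∧ ∀ y, |g (secT y) - f y| < ε := by
  have h := ContinuousMap.subalgebra_topologicalClosure_eq_top_of_separatesPoints
    (smoothAlg d) (smoothAlg_sep d)
  have h1 : (⟨f, hf⟩ : C(Td d, ℝ)) ∈ (smoothAlg d).topologicalClosure := by rw [h]; trivial
  have h2 : (⟨f, hf⟩ : C(Td d, ℝ)) ∈ closure ((smoothAlg d : Set C(Td d, ℝ))) := h1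
  rw [Metric.mem_closure_iff] at h2
  obtain ⟨b, ⟨g, hg1, hg2, hg3⟩, hb⟩ := h2 ε hε
  refine ⟨g, hg1, hg2, fun y => ?_⟩
  have := (ContinuousMap.dist_lt_iff hε).1 hb y
  rw [dist_comm, Real.dist_eq, hg3] at this
  exact this



lemma per_bdd {g : Vd d → ℝ} (hg : Per g) (hc : Continuous g) :
    ∃ B : ℝ, 0 ≤ B ∧ ∀ x, |g x| ≤ B := by
  obtain ⟨C, hC⟩ := isCompact_univ.exists_bound_of_continuousOn (hg.cont hc).continuousOn
  refine ⟨max C 0, le_max_right _ _, fun x => ?_⟩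
  rw [← hg.sec x]
  exact (hC (pj x) trivial).trans (le_max_left _ _)

lemma convex_of_d2 {f f' f'' : ℝ → ℝ} {c : ℝ} (h1 : ∀ t, HasDerivAt f (f' t) t)
    (h2 : ∀ t, HasDerivAt f' (f'' t) t) (h3 : ∀ t, c ≤ f'' t) :
    ConvexOn ℝ univ (fun t => f t - c / 2 * t ^ 2) := by
  have e1 : ∀ t, HasDerivAt (fun t => f t - c / 2 * t ^ 2) (f' t - c * t) t := by
    intro t
    exact ((h1 t).sub ((hasDerivAt_pow 2 t).const_mul (c/2))).congr_deriv (by simp; ring)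
  have e2 : ∀ t, HasDerivAt (fun t => f' t - c * t) (f'' t - c) t := by
    intro t
    exact ((h2 t).sub ((hasDerivAt_id' t).const_mul c)).congr_deriv (by simp)
  refine MonotoneOn.convexOn_of_deriv convex_univ (fun t _ => (e1 t).continuousAt.continuousWithinAt)
    (fun t _ => (e1 t).differentiableAt.differentiableWithinAt) ?_
  have : deriv (fun t => f t - c / 2 * t ^ 2) = fun t => f' t - c * t :=
    funext (fun t => (e1 t).deriv)
  rw [this]
  refine (monotone_of_deriv_nonneg (fun t => (e2 t).differentiableAt) (fun t => ?_)).monotoneOn _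
  rw [(e2 t).deriv]; linarith [h3 t]

lemma d2_interp {f f' f'' : ℝ → ℝ} {c : ℝ} (h1 : ∀ t, HasDerivAt f (f' t) t)
    (h2 : ∀ t, HasDerivAt f' (f'' t) t) (h3 : ∀ t, c ≤ f'' t) {t : ℝ} (h0 : 0 ≤ t) (ht : t ≤ 1) :
    f t ≤ t * f 1 + (1 - t) * f 0 - c / 2 * (t * (1 - t)) := by
  have := (convex_of_d2 h1 h2 h3).2 (mem_univ 0) (mem_univ 1) (sub_nonneg.2 ht) h0 (by ring)
  simp at this
  nlinarith

lemma d2_lower {f f' f'' : ℝ → ℝ} {c : ℝ} (h1 : ∀ t, HasDerivAt f (f' t) t)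
    (h2 : ∀ t, HasDerivAt f' (f'' t) t) (h3 : ∀ t, c ≤ f'' t) :
    f 0 + f' 0 + c / 2 ≤ f 1 := by
  have h := convex_of_d2 h1 h2 h3
  have e1 : HasDerivAt (fun t => f t - c / 2 * t ^ 2) (f' 0) 0 := by
    exact ((h1 0).sub ((hasDerivAt_pow 2 (0:ℝ)).const_mul (c/2))).congr_deriv (by simp)
  have := h.le_slope_of_hasDerivAt (mem_univ 0) (mem_univ 1) one_pos e1
  simp [slope] at this
  linarith

lemma line_d1 {g : Vd d → ℝ} (hg : Differentiable ℝ g) (p v : Vd d) (t : ℝ) :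
    HasDerivAt (fun t : ℝ => g (p + t • v)) (fderiv ℝ g (p + t • v) v) t := by
  have h1 : HasDerivAt (fun t : ℝ => p + t • v) v t := by
    simpa using ((hasDerivAt_id t).smul_const v).const_add p
  exact (hg _).hasFDerivAt.comp_hasDerivAt t h1

lemma line_d2 {g : Vd d → ℝ} (hg : ContDiff ℝ 2 g) (p v w : Vd d) (t : ℝ) :
    HasDerivAt (fun t : ℝ => fderiv ℝ g (p + t • v) w) (D2 g (p + t • v) w v) t := by
  have : ContDiff ℝ 1 (fun q => fderiv ℝ g q w) :=
    (hg.fderiv_right (m := 1) (by norm_num)).clm_apply contDiff_const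
  exact line_d1 (g := fun q => fderiv ℝ g q w) (this.differentiable (by norm_num)) p v t

lemma per_partial {g : Vd d → ℝ} (hg : ContDiff ℝ 2 g) (hp : Per g) {B : ℝ}
    (hB : ∀ x v w, |D2 g x v w| ≤ B * ‖v‖ * ‖w‖) (x : Vd d) (i : Fin d) :
    |fderiv ℝ g x (Pi.single i 1)| ≤ B := by
  set e : Vd d := Pi.single i 1 with he
  have hne : ‖e‖ = 1 := by rw [he, Pi.norm_single, norm_one]
  have hgd : Differentiable ℝ g := hg.differentiable (by norm_num)
  have h1 : ∀ t, HasDerivAt (fun t : ℝ => g (x + t • e)) _ t := fun t => line_d1 hgd x e t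
  have h2 := fun t => line_d2 hg x e e t
  obtain ⟨t0, ht0, h0⟩ := exists_hasDerivAt_eq_zero (f := fun t : ℝ => g (x + t • e)) (a := 0)
    (b := 1) one_pos (fun t _ => (h1 t).continuousAt.continuousWithinAt) (by
      have := hp x (Pi.single i 1)
      have e2 : (intVec (Pi.single i 1 : Fin d → ℤ) : Vd d) = e := by
        funext j
        simp only [intVec, he, Pi.single_apply]
        split <;> simp
      rw [e2] at this
      simp [this]) (fun t _ => h1 t)
  have h3 := Convex.norm_image_sub_le_of_norm_hasDerivWithin_le (s := univ) (C := B)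
    (f := fun t : ℝ => fderiv ℝ g (x + t • e) e) (fun t _ => (h2 t).hasDerivWithinAt)
    (fun t _ => by simpa [hne] using hB (x + t • e) e e) convex_univ (mem_univ t0) (mem_univ 0)
  simp only [h0, sub_zero, zero_smul, add_zero, Real.norm_eq_abs, zero_sub, abs_neg] at h3
  have hB0 : 0 ≤ B := by
    have := (abs_nonneg _).trans (hB x e e); simpa [hne] using this
  rw [abs_of_pos ht0.1] at h3
  nlinarith [ht0.2, ht0.1]

lemma per_lip {g : Vd d → ℝ} (hg : ContDiff ℝ 2 g) (hp : Per g) {B : ℝ}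
    (hB : ∀ x v w, |D2 g x v w| ≤ B * ‖v‖ * ‖w‖) (hB0 : 0 ≤ B) (x x' : Vd d) :
    |g x - g x'| ≤ d * B * ‖x - x'‖ := by
  have hgd : Differentiable ℝ g := hg.differentiable (by norm_num)
  refine Convex.norm_image_sub_le_of_norm_fderiv_le (s := univ) (𝕜 := ℝ) (fun y _ => hgd y)
    (fun y _ => ?_) convex_univ (mem_univ x') (mem_univ x)
  refine ContinuousLinearMap.opNorm_le_bound _ (by positivity) (fun v => ?_)
  rw [clm_dot, dotp, Real.norm_eq_abs]
  refine (Finset.abs_sum_le_sum_abs _ _).trans ?_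
  calc _ ≤ ∑ i : Fin d, B * ‖v‖ := by
        refine Finset.sum_le_sum (fun i _ => ?_)
        rw [abs_mul, mul_comm]
        exact mul_le_mul (per_partial hg hp hB y i) (norm_le_pi_norm v i) (abs_nonneg _) hB0
    _ = _ := by simp; ring

lemma sqnorm_nonneg (v : Vd d) : 0 ≤ sqnorm v := Finset.sum_nonneg (fun i _ => sq_nonneg _)

lemma norm_sq_le_sqnorm (v : Vd d) : ‖v‖ ^ 2 ≤ sqnorm v := by
  have h : ‖v‖ ≤ Real.sqrt (sqnorm v) := by
    rw [pi_norm_le_iff_of_nonneg (Real.sqrt_nonneg _)]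
    intro i
    rw [Real.norm_eq_abs]
    refine Real.abs_le_sqrt ?_
    exact Finset.single_le_sum (f := fun i => (v i)^2) (fun i _ => sq_nonneg _) (Finset.mem_univ i)
  calc ‖v‖ ^ 2 ≤ Real.sqrt (sqnorm v) ^ 2 := by gcongr
    _ = _ := Real.sq_sqrt (sqnorm_nonneg v)

lemma sqnorm_le_norm (v : Vd d) : sqnorm v ≤ d * ‖v‖ ^ 2 := by
  unfold sqnorm
  calc _ ≤ ∑ i : Fin d, ‖v‖ ^ 2 := by
        refine Finset.sum_le_sum (fun i _ => ?_)
        rw [← sq_abs]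
        have := norm_le_pi_norm v i
        rw [Real.norm_eq_abs] at this
        gcongr
    _ = _ := by simp

lemma sqnorm_smul (c : ℝ) (v : Vd d) : sqnorm (c • v) = c ^ 2 * sqnorm v := by
  unfold sqnorm
  rw [Finset.mul_sum]
  refine Finset.sum_congr rfl (fun i _ => by simp; ring)

/-- Young inequality for `dotp`. -/
lemma dotp_young (v p : Vd d) {c : ℝ} (hc : 0 < c) :
    |dotp v p| ≤ c * sqnorm p + (4 * c)⁻¹ * sqnorm v := by
  unfold dotp sqnorm
  refine (Finset.abs_sum_le_sum_abs _ _).trans ?_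
  rw [Finset.mul_sum, Finset.mul_sum, ← Finset.sum_add_distrib]
  refine Finset.sum_le_sum (fun i _ => ?_)
  have key : ∀ a b : ℝ, a * b ≤ c * b ^ 2 + (4 * c)⁻¹ * a ^ 2 := by
    intro a b
    have h1 : (4 * c)⁻¹ * a ^ 2 * (4 * c) = a ^ 2 := by field_simp
    have h2 : 0 < (4 * c)⁻¹ := by positivity
    have : 0 ≤ (4*c)⁻¹ * (a - 2 * c * b) ^ 2 := by positivity
    have h3 : (4*c)⁻¹ * (a - 2 * c * b) ^ 2 = (4 * c)⁻¹ * a ^ 2 - a * b + c * b ^ 2 := by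
      field_simp; ring
    linarith
  rw [abs_le]
  constructor
  · have := key (-(v i)) (p i)
    nlinarith
  · exact key _ _

namespace MFGSetting
variable {d : ℕ} (S : MFGSetting d)

lemma H_cont : Continuous (fun q : Vd d × Vd d => S.H q.1 q.2) := S.H_smooth.continuous

lemma H_cdp (x : Vd d) : ContDiff ℝ 2 (fun p => S.H x p) :=
  S.H_smooth.comp (contDiff_const.prodMk contDiff_id)

lemma H_cdx (p : Vd d) : ContDiff ℝ 2 (fun x => S.H x p) :=
  S.H_smooth.comp (contDiff_id.prodMk contDiff_const)

lemma H_convex (x p q : Vd d) {t : ℝ} (h0 : 0 ≤ t) (h1 : t ≤ 1) :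
    S.H x (p + t • (q - p)) ≤ t * S.H x q + (1 - t) * S.H x p := by
  have := d2_interp (c := 0) (fun t => line_d1 ((S.H_cdp x).differentiable (by norm_num)) p (q - p) t)
    (fun t => line_d2 (S.H_cdp x) p (q - p) (q - p) t)
    (fun t => (mul_nonneg (inv_nonneg.2 S.Cbar_pos.le) (sqnorm_nonneg _)).trans (S.Dpp_lower _ _ _))
    h0 h1
  simpa using this

lemma H_strong (x p : Vd d) {t : ℝ} (h0 : 0 ≤ t) (h1 : t ≤ 1) :
    S.H x (t • p) ≤ t * S.H x p + (1 - t) * S.H x 0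
      - S.Cbar⁻¹ * sqnorm p / 2 * (t * (1 - t)) := by
  have := d2_interp (c := S.Cbar⁻¹ * sqnorm p)
    (fun t => line_d1 ((S.H_cdp x).differentiable (by norm_num)) 0 p t)
    (fun t => line_d2 (S.H_cdp x) 0 p p t) (fun t => S.Dpp_lower _ _ _) h0 h1
  simpa using this

lemma H0_bdd : ∃ B : ℝ, 0 ≤ B ∧ ∀ x, |S.H x 0| ≤ B :=
  per_bdd (g := fun x => S.H x 0) (fun x z => S.H_per x z 0) (S.H_cdx 0).continuous

lemma fd_p (x p v : Vd d) : fderiv ℝ (fun p => S.H x p) p v =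
    fderiv ℝ (fun q : Vd d × Vd d => S.H q.1 q.2) (x, p) (0, v) := by
  have h1 : HasFDerivAt (fun p : Vd d => (x, p)) (ContinuousLinearMap.inr ℝ (Vd d) (Vd d)) p :=
    hasFDerivAt_prodMk_right x p
  have h2 := ((S.H_smooth.differentiable (by norm_num)) (x, p)).hasFDerivAt.comp p h1
  have h3 : fderiv ℝ (fun p => S.H x p) p = _ := h2.fderiv
  rw [h3]; simp

lemma DH0_bdd : ∃ B : ℝ, 0 ≤ B ∧ ∀ x i, |fderiv ℝ (fun p => S.H x p) 0 (Pi.single i 1)| ≤ B := by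
  have h : ∀ i : Fin d, ∃ B : ℝ, 0 ≤ B ∧ ∀ x, |fderiv ℝ (fun p => S.H x p) 0 (Pi.single i 1)| ≤ B := by
    intro i
    refine per_bdd (g := fun x => fderiv ℝ (fun p => S.H x p) 0 (Pi.single i 1)) (fun x z => ?_) ?_
    · simp only [S.H_per]
    · simp_rw [S.fd_p]
      have : ContDiff ℝ 1 (fun q => fderiv ℝ (fun q : Vd d × Vd d => S.H q.1 q.2) q
        (0, Pi.single i 1)) := (S.H_smooth.fderiv_right (m := 1) (by norm_num)).clm_apply contDiff_const
      exact this.continuous.comp (by fun_prop : Continuous fun x : Vd d => (x, (0 : Vd d)))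
  choose B h0 hB using h
  refine ⟨∑ i, B i, Finset.sum_nonneg (fun i _ => h0 i), fun x i => (hB i x).trans ?_⟩
  exact Finset.single_le_sum (fun i _ => h0 i) (Finset.mem_univ i)

lemma H_growth : ∃ b B : ℝ, 0 < b ∧ 0 ≤ B ∧ ∀ x p,
    b * sqnorm p - B ≤ S.H x p ∧ S.H x p ≤ B * sqnorm p + B := by
  obtain ⟨B0, hB0, h0⟩ := S.H0_bdd
  obtain ⟨N, hN, hN'⟩ := S.DH0_bdd
  have hc : 0 < S.Cbar⁻¹ := inv_pos.2 S.Cbar_pos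
  set c := S.Cbar⁻¹
  have hsq : ∀ x, sqnorm (fun i => fderiv ℝ (fun p => S.H x p) 0 (Pi.single i 1) : Vd d) ≤ d * N ^ 2 := by
    intro x
    unfold sqnorm
    calc _ ≤ ∑ i : Fin d, N ^ 2 := Finset.sum_le_sum (fun i _ => by
          rw [← sq_abs]; have := hN' x i; gcongr)
      _ = _ := by simp
  refine ⟨c / 4, B0 + c⁻¹ * (d * N ^ 2) + (c / 4 + S.Cbar / 2), by positivity, ?_, fun x p => ?_⟩
  · have := S.Cbar_pos; positivity
  have l1 := fun t => line_d1 ((S.H_cdp x).differentiable (by norm_num)) 0 p t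
  have l2 := fun t => line_d2 (S.H_cdp x) 0 p p t
  have e1 := d2_lower l1 l2 (fun t => S.Dpp_lower _ _ _)
  have e2 := d2_lower (fun t => (l1 t).neg) (fun t => (l2 t).neg)
    (fun t => neg_le_neg (S.Dpp_upper _ _ _))
  simp only [zero_smul, add_zero, one_smul, zero_add] at e1 e2
  have e3 : |fderiv ℝ (fun p => S.H x p) 0 p| ≤ c / 4 * sqnorm p + c⁻¹ * (d * N ^ 2) := by
    rw [clm_dot]
    have := dotp_young p (fun i => fderiv ℝ (fun p => S.H x p) 0 (Pi.single i 1)) (inv_pos.2 hc)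
    have h4 : (4 * c⁻¹)⁻¹ = c / 4 := by field_simp
    rw [h4] at this
    have := mul_le_mul_of_nonneg_left (hsq x) (inv_pos.2 hc).le
    linarith
  have e4 := abs_le.1 e3
  have e5 := abs_le.1 (h0 x)
  have hs := sqnorm_nonneg p
  have hC := S.Cbar_pos
  have q1 : 0 ≤ c⁻¹ * (d * N ^ 2) := by positivity
  change S.H x 0 + fderiv ℝ (fun p => S.H x p) 0 p + c * sqnorm p / 2 ≤ S.H x p at e1
  have e2' : -S.H x 0 + -(fderiv ℝ (fun p => S.H x p) 0) p + -(S.Cbar * sqnorm p) / 2 ≤ -S.H x p := by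
    simpa using e2
  constructor
  · nlinarith
  · have : 0 ≤ (B0 + c⁻¹ * (d * N ^ 2)) * sqnorm p := by positivity
    nlinarith

lemma H_lip : ∃ L : ℝ, 0 ≤ L ∧ ∀ x x' p, |S.H x p - S.H x' p| ≤ L * ‖x - x'‖ * (1 + sqnorm p) := by
  refine ⟨d * (S.Cg * 2), by have := S.Cg_pos; positivity, fun x x' p => ?_⟩
  have h0 : 0 ≤ ‖p‖ := norm_nonneg _
  have hb : S.Cg * (1 + ‖p‖) ^ (1 + S.θ) ≤ S.Cg * 2 * (1 + sqnorm p) := by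
    have h1 : (1 + ‖p‖) ^ (1 + S.θ) ≤ (1 + ‖p‖) ^ (2:ℝ) :=
      Real.rpow_le_rpow_of_exponent_le (by linarith) (by linarith [S.θ_mem.2])
    rw [Real.rpow_two] at h1
    have h2 := norm_sq_le_sqnorm p
    have : (1 + ‖p‖) ^ 2 ≤ 2 * (1 + sqnorm p) := by nlinarith [sq_nonneg (‖p‖ - 1)]
    have hC := S.Cg_pos
    rw [mul_assoc]
    exact mul_le_mul_of_nonneg_left (h1.trans this) hC.le
  have := per_lip (S.H_cdx p) (fun x z => S.H_per x z p) (B := S.Cg * 2 * (1 + sqnorm p))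
    (fun y v w => (S.Dxx_growth y p v w).trans (by gcongr))
    (by have := S.Cg_pos; have := sqnorm_nonneg p; positivity) x x'
  calc _ ≤ _ := this
    _ = _ := by ring

lemma H_P1 : ∃ A K : ℝ, 0 < A ∧ 0 ≤ K ∧ ∀ x x' p v,
    A * S.H x (A⁻¹ • p) ≤ S.H x' p + dotp v p + K * (1 + sqnorm v) := by
  obtain ⟨b, B, hb, hB, h⟩ := S.H_growth
  set A := 2 * B / b + 1 with hA
  have hA0 : 0 < A := by positivity
  refine ⟨A, A * B + B + (2 * b)⁻¹, hA0, by positivity, fun x x' p v => ?_⟩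
  have h1 := (h x (A⁻¹ • p)).2
  rw [sqnorm_smul] at h1
  have h2 := (h x' p).1
  have h3 := abs_le.1 (dotp_young v p (half_pos hb))
  have h4 : A * (B * (A⁻¹ ^ 2 * sqnorm p) + B) = (B * A⁻¹) * sqnorm p + A * B := by
    field_simp
  have h5 : B * A⁻¹ ≤ b / 2 := by
    rw [← div_eq_mul_inv, div_le_iff₀ hA0, hA]
    have : b / 2 * (2 * B / b + 1) = B + b / 2 := by field_simp
    rw [this]; linarith
  have h6 := mul_le_mul_of_nonneg_left h1 hA0.le
  rw [h4] at h6
  have hs := sqnorm_nonneg p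
  have hv := sqnorm_nonneg v
  have h7 := mul_le_mul_of_nonneg_right h5 hs
  have h8 : (4 * (b / 2))⁻¹ = (2 * b)⁻¹ := by ring_nf
  rw [h8] at h3
  have q1 : 0 ≤ (A * B + B) * sqnorm v := by positivity
  have q2 : 0 < (2 * b)⁻¹ := by positivity
  nlinarith

lemma H_P2 : ∃ K E r0 : ℝ, 0 ≤ K ∧ 0 ≤ E ∧ 0 < r0 ∧ ∀ r, 0 ≤ r → r ≤ r0 → ∀ x x' p v,
    ‖x - x'‖ ≤ r → ‖v‖ ≤ r →
    (1 + K * r) * S.H x ((1 + K * r)⁻¹ • p) ≤ S.H x' p + dotp v p + E * r := by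
  obtain ⟨L, hL, hl⟩ := S.H_lip
  obtain ⟨B0, hB0, h0⟩ := S.H0_bdd
  have hc : 0 < S.Cbar⁻¹ := inv_pos.2 S.Cbar_pos
  set c := S.Cbar⁻¹
  set K := 4 * c⁻¹ * (2 * L + 1) with hK
  have hK0 : 0 < K := by positivity
  refine ⟨K, K * B0 + 2 * L + d, min 1 K⁻¹, hK0.le, by positivity, by positivity, ?_⟩
  intro r hr hr0 x x' p v hx hv
  have hr1 : r ≤ 1 := hr0.trans (min_le_left _ _)
  have hKr : K * r ≤ 1 := by
    have := hr0.trans (min_le_right _ _)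
    calc K * r ≤ K * K⁻¹ := by gcongr
      _ = 1 := by field_simp
  set A := 1 + K * r with hA
  have hKr0 : 0 ≤ K * r := by positivity
  have hA1 : 1 ≤ A := by linarith
  have hA2 : A ≤ 2 := by linarith
  have hA0 : 0 < A := by linarith
  have hAi : A⁻¹ ≤ 1 := inv_le_one_of_one_le₀ hA1
  have hAi0 : 0 < A⁻¹ := inv_pos.2 hA0
  have e1 := S.H_strong x' p hAi0.le hAi
  have e2 := (abs_le.1 (hl x x' (A⁻¹ • p))).2
  rw [sqnorm_smul] at e2
  have hs := sqnorm_nonneg p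
  have e3 : L * ‖x - x'‖ * (1 + A⁻¹ ^ 2 * sqnorm p) ≤ L * r * (1 + sqnorm p) := by
    have : A⁻¹ ^ 2 * sqnorm p ≤ 1 * sqnorm p :=
      mul_le_mul_of_nonneg_right (pow_le_one₀ hAi0.le hAi) hs
    gcongr
    linarith
  have e4 : |dotp v p| ≤ r * (sqnorm p + d) := by
    rcases hr.eq_or_lt with h | h
    · have : v = 0 := by rw [← norm_le_zero_iff]; linarith
      rw [this]; simp [dotp, ← h]
    · have h1 := dotp_young v p h
      have h2 : sqnorm v ≤ d * r ^ 2 := (sqnorm_le_norm v).trans (by gcongr)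
      have h3 : (4 * r)⁻¹ * sqnorm v ≤ (4 * r)⁻¹ * (d * r ^ 2) := by gcongr
      have h4 : (4 * r)⁻¹ * (d * r ^ 2) = r * d / 4 := by field_simp
      have h5 : 0 ≤ r * d := by positivity
      nlinarith
  have e5 := (abs_le.1 e4).1
  -- multiply by A
  have e6 : A * S.H x (A⁻¹ • p) ≤ A * (A⁻¹ * S.H x' p + (1 - A⁻¹) * S.H x' 0
      - c * sqnorm p / 2 * (A⁻¹ * (1 - A⁻¹)) + L * r * (1 + sqnorm p)) := by
    refine mul_le_mul_of_nonneg_left ?_ hA0.le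
    linarith
  have e7 : A * (A⁻¹ * S.H x' p + (1 - A⁻¹) * S.H x' 0
      - c * sqnorm p / 2 * (A⁻¹ * (1 - A⁻¹)) + L * r * (1 + sqnorm p)) =
      S.H x' p + (K * r) * S.H x' 0 - c * sqnorm p / 2 * (1 - A⁻¹) + A * (L * r * (1 + sqnorm p)) := by
    have : A * A⁻¹ = 1 := mul_inv_cancel₀ hA0.ne'
    have h2 : A * (1 - A⁻¹) = K * r := by rw [mul_sub, this]; linarith
    linear_combination (S.H x' p - c * sqnorm p / 2 * (1 - A⁻¹)) * this + S.H x' 0 * h2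
  have e8 : K * r / 2 ≤ 1 - A⁻¹ := by
    have : 1 - A⁻¹ = K * r * A⁻¹ := by field_simp; linarith
    rw [this]
    have : (2:ℝ)⁻¹ ≤ A⁻¹ := inv_anti₀ hA0 hA2
    nlinarith
  have e9 : c * sqnorm p / 2 * (K * r / 2) ≤ c * sqnorm p / 2 * (1 - A⁻¹) := by gcongr
  have e10 : c * sqnorm p / 2 * (K * r / 2) = (2 * L + 1) * r * sqnorm p := by
    rw [hK]; field_simp; ring
  have e11 : A * (L * r * (1 + sqnorm p)) ≤ 2 * (L * r * (1 + sqnorm p)) := by gcongr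
  have e12 : (K * r) * S.H x' 0 ≤ K * r * B0 := by
    have := (abs_le.1 (h0 x')).2
    gcongr
  nlinarith


lemma le_Hstar (x q p : Vd d) : dotp q p - S.H x p ≤ S.Hstar x q :=
  (S.Hstar_eq x q).1 ⟨p, rfl⟩

lemma Hstar_bounds : ∃ K : ℝ, 0 ≤ K ∧ ∀ x q, -K ≤ S.Hstar x q ∧ S.Hstar x q ≤ K * sqnorm q + K := by
  obtain ⟨b, B, hb, hB, h⟩ := S.H_growth
  obtain ⟨B0, hB0, h0⟩ := S.H0_bdd
  refine ⟨(4 * b)⁻¹ + B + B0, by positivity, fun x q => ⟨?_, ?_⟩⟩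
  · have := S.le_Hstar x q 0
    simp [dotp] at this
    have h2 := (abs_le.1 (h0 x)).2
    have : 0 < (4 * b)⁻¹ := by positivity
    linarith
  · refine (S.Hstar_eq x q).2 ?_
    rintro _ ⟨p, rfl⟩
    have h1 := (h x p).1
    have h2 := (abs_le.1 (dotp_young q p hb)).2
    have h3 := sqnorm_nonneg q
    have h4 : 0 ≤ (B + B0) * sqnorm q := by positivity
    have : 0 < (4 * b)⁻¹ := by positivity
    simp only
    nlinarith

lemma cont_dotp : Continuous (fun q : Vd d × Vd d => dotp q.1 q.2) := by
  unfold dotp; fun_prop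

lemma Hstar_lub_dense (x q : Vd d) :
    IsLUB (range fun n : ℕ => dotp q (TopologicalSpace.denseSeq (Vd d) n)
      - S.H x (TopologicalSpace.denseSeq (Vd d) n)) (S.Hstar x q) := by
  constructor
  · rintro _ ⟨n, rfl⟩
    exact S.le_Hstar x q _
  · intro u hu
    refine (S.Hstar_eq x q).2 ?_
    rintro _ ⟨p, rfl⟩
    have hcont : Continuous (fun p => dotp q p - S.H x p) :=
      (cont_dotp.comp (continuous_const.prodMk continuous_id)).sub (S.H_cdp x).continuous
    have hcl : IsClosed {p | dotp q p - S.H x p ≤ u} := isClosed_le hcont continuous_const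
    have hsub : range (TopologicalSpace.denseSeq (Vd d)) ⊆ {p | dotp q p - S.H x p ≤ u} := by
      rintro _ ⟨n, rfl⟩
      exact hu ⟨n, rfl⟩
    have := hcl.closure_subset_iff.2 hsub
    rw [(TopologicalSpace.denseRange_denseSeq (Vd d)).closure_range] at this
    exact this (mem_univ p)

lemma Hstar_meas : Measurable (fun q : Vd d × Vd d => S.Hstar q.1 q.2) := by
  refine Measurable.isLUB (f := fun (n : ℕ) (q : Vd d × Vd d) =>
    dotp q.2 (TopologicalSpace.denseSeq (Vd d) n)
      - S.H q.1 (TopologicalSpace.denseSeq (Vd d) n)) (fun n => ?_) (fun q => S.Hstar_lub_dense q.1 q.2)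
  have h1 : Continuous (fun q : Vd d × Vd d => dotp q.2 (TopologicalSpace.denseSeq (Vd d) n)) :=
    cont_dotp.comp (continuous_snd.prodMk continuous_const)
  exact (h1.sub ((S.H_cdx _).continuous.comp continuous_fst)).measurable

end MFGSetting


open ProbabilityTheory in
lemma exists_kernel {m : ℝ → PTd d} {a b : ℝ} (hab : a ≤ b) (hm : ContinuousOn m (Icc a b)) :
    ∃ κ : Kernel ℝ (Td d), IsMarkovKernel κ ∧ ∀ s ∈ Icc a b, κ s = (m s : Measure (Td d)) := by
  let mt : ℝ → PTd d := fun s => m (projIcc a b hab s)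
  have hmt : Continuous mt := hm.domRestrict.comp continuous_projIcc
  have hmeas : Measurable (fun s => (mt s : Measure (Td d))) := by
    refine Measurable.measure_of_isPiSystem_of_isProbabilityMeasure
      (S := {s | IsClosed s}) ?_ isPiSystem_isClosed ?_
    · rw [BorelSpace.measurable_eq (α := Td d), borel_eq_generateFrom_isClosed]
    · intro F hF
      have hF : IsClosed F := hF
      refine measurable_of_tendsto_metrizable (f := fun (n : ℕ) s =>
        ENNReal.ofReal (∫ y, (thickenedIndicator (Nat.one_div_pos_of_nat (α := ℝ) (n := n)) F y : ℝ)
          ∂(mt s : Measure (Td d)))) (fun n => ?_) ?_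
      · refine ENNReal.measurable_ofReal.comp (Continuous.measurable ?_)
        refine cont_pair' ?_ hmt
        exact NNReal.continuous_coe.comp ((thickenedIndicator _ F).continuous.comp continuous_snd)
      · rw [tendsto_pi_nhds]
        intro s
        have := tendsto_integral_thickenedIndicator_of_isClosed (mt s : Measure (Td d)) hF
          (fun n => Nat.one_div_pos_of_nat (α := ℝ) (n := n)) tendsto_one_div_add_atTop_nhds_zero_nat
        have h2 := (ENNReal.continuous_ofReal.tendsto _).comp this
        simpa [Measure.real, Function.comp_def] using h2
  refine ⟨⟨fun s => (mt s : Measure (Td d)), hmeas⟩, ⟨fun s => ?_⟩, fun s hs => ?_⟩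
  · change IsProbabilityMeasure (mt s : Measure (Td d)); infer_instance
  · change (mt s : Measure (Td d)) = m s
    simp only [mt, projIcc_of_mem hab hs]

open ProbabilityTheory in
def stm (κ : Kernel ℝ (Td d)) (a b : ℝ) : Measure (ℝ × Td d) :=
  (volume.restrict (Ioc a b)) ⊗ₘ κ

open ProbabilityTheory in
instance {d : ℕ} (κ : Kernel ℝ (Td d)) [IsMarkovKernel κ] (a b : ℝ) : IsFiniteMeasure (stm κ a b) := by
  unfold stm; infer_instance

open ProbabilityTheory in
lemma stm_ae (κ : Kernel ℝ (Td d)) [IsMarkovKernel κ] {a b : ℝ} :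
    ∀ᵐ q ∂(stm κ a b), q.1 ∈ Ioc a b := by
  have h : ∀ᵐ s ∂(volume.restrict (Ioc a b)), ∀ᵐ y ∂(κ s), ((s, y) : ℝ × Td d).1 ∈ Ioc a b := by
    filter_upwards [ae_restrict_mem measurableSet_Ioc] with s hs
    exact Eventually.of_forall (fun y => hs)
  exact Measure.ae_compProd_of_ae_ae (measurable_fst measurableSet_Ioc) h

open ProbabilityTheory in
lemma st_eq {κ : Kernel ℝ (Td d)} [IsMarkovKernel κ] {a b : ℝ} (hab : a ≤ b)
    {m : ℝ → PTd d} (hκ : ∀ s ∈ Icc a b, κ s = (m s : Measure (Td d))) {f : ℝ × Td d → ℝ}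
    (hf : Integrable f (stm κ a b)) :
    IntervalIntegrable (fun s => ig (m s) (fun y => f (s, y))) volume a b ∧
    (∀ᵐ s ∂(volume.restrict (Ioc a b)), Integrable (fun y => f (s, y)) (m s : Measure (Td d))) ∧
    ∫ q, f q ∂(stm κ a b) = ∫ s in a..b, ig (m s) (fun y => f (s, y)) := by
  have hE : ∀ᵐ s ∂(volume.restrict (Ioc a b)), κ s = (m s : Measure (Td d)) := by
    filter_upwards [ae_restrict_mem measurableSet_Ioc] with s hs
    exact hκ s (Ioc_subset_Icc_self hs)
  have h0 : ∀ᵐ s ∂(volume.restrict (Ioc a b)), ∫ y, f (s, y) ∂(κ s) = ig (m s) (fun y => f (s, y)) := by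
    filter_upwards [hE] with s hs
    rw [hs]; rfl
  have hi := (Measure.integrable_compProd_iff hf.aestronglyMeasurable).1 hf
  refine ⟨?_, ?_, ?_⟩
  · rw [intervalIntegrable_iff_integrableOn_Ioc_of_le hab]
    have : Integrable (fun s => ∫ y, f (s, y) ∂(κ s)) (volume.restrict (Ioc a b)) :=
      by
      have := hf.integral_compProd
      simpa using this
    exact this.congr h0
  · filter_upwards [hE, hi.1] with s hs h
    rwa [hs] at h
  · rw [stm, Measure.integral_compProd hf, intervalIntegral.integral_of_le hab]
    exact integral_congr_ae h0

lemma meas_sqnorm : Measurable (sqnorm : Vd d → ℝ) := by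
  unfold sqnorm; fun_prop

open ProbabilityTheory in
lemma st_l2 {κ : Kernel ℝ (Td d)} [IsMarkovKernel κ] {a b : ℝ}
    {m : ℝ → PTd d} (hκ : ∀ s ∈ Icc a b, κ s = (m s : Measure (Td d))) {α : ℝ → Td d → Vd d}
    (hα : Measurable (fun q : ℝ × Td d => α q.1 q.2)) :
    (∫⁻ s in Ioc a b, ∫⁻ y, ENNReal.ofReal (sqnorm (α s y)) ∂(m s : Measure (Td d))) < ⊤ ↔
    Integrable (fun q : ℝ × Td d => sqnorm (α q.1 q.2)) (stm κ a b) := by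
  have hms : Measurable (fun q : ℝ × Td d => sqnorm (α q.1 q.2)) := meas_sqnorm.comp hα
  have e : ∫⁻ q, ENNReal.ofReal (sqnorm (α q.1 q.2)) ∂(stm κ a b) =
      ∫⁻ s in Ioc a b, ∫⁻ y, ENNReal.ofReal (sqnorm (α s y)) ∂(m s : Measure (Td d)) := by
    rw [stm, Measure.lintegral_compProd (f := fun q : ℝ × Td d => ENNReal.ofReal (sqnorm (α q.1 q.2)))
      hms.ennreal_ofReal]
    refine lintegral_congr_ae ?_
    filter_upwards [ae_restrict_mem measurableSet_Ioc] with s hs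
    rw [hκ s (Ioc_subset_Icc_self hs)]
  rw [← e]
  constructor
  · intro h
    refine ⟨hms.aestronglyMeasurable, ?_⟩
    rw [hasFiniteIntegral_iff_ofReal (Eventually.of_forall fun q => sqnorm_nonneg _)]
    exact h
  · intro h
    have := h.2
    rwa [hasFiniteIntegral_iff_ofReal (Eventually.of_forall fun q => sqnorm_nonneg _)] at this

open ProbabilityTheory in
lemma st_cont {κ : Kernel ℝ (Td d)} [IsMarkovKernel κ] {a b : ℝ} {f : ℝ × Td d → ℝ}
    (hf : Continuous f) : Integrable f (stm κ a b) := by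
  obtain ⟨C, hC⟩ := (isCompact_Icc (a := a) (b := b)).prod (isCompact_univ (X := Td d))
    |>.exists_bound_of_continuousOn hf.continuousOn
  refine Integrable.of_bound hf.aestronglyMeasurable C ?_
  filter_upwards [stm_ae κ] with q hq
  exact hC q ⟨Ioc_subset_Icc_self hq, trivial⟩

open ProbabilityTheory in
lemma st_quad {κ : Kernel ℝ (Td d)} [IsMarkovKernel κ] {a b : ℝ} {α : ℝ → Td d → Vd d}
    (hi : Integrable (fun q : ℝ × Td d => sqnorm (α q.1 q.2)) (stm κ a b)) {f : ℝ × Td d → ℝ}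
    (hf : AEStronglyMeasurable f (stm κ a b)) {g : ℝ × Td d → ℝ} (hg : Continuous g) {C : ℝ}
    (hb : ∀ q, |f q| ≤ C * sqnorm (α q.1 q.2) + g q) : Integrable f (stm κ a b) :=
  Integrable.mono' ((hi.const_mul C).add (st_cont hg)) hf (Eventually.of_forall hb)

/-- control properties on `[a,b]` -/
structure Ctl {d : ℕ} (m : ℝ → PTd d) (α : ℝ → Td d → Vd d) (a b : ℝ) : Prop where
  meas : Measurable (fun q : ℝ × Td d => α q.1 q.2)
  l2 : (∫⁻ s in Ioc a b, ∫⁻ y, ENNReal.ofReal (sqnorm (α s y)) ∂(m s : Measure (Td d))) < ⊤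
  fp : ∀ s₁ s₂ : ℝ, a ≤ s₁ → s₁ ≤ s₂ → s₂ ≤ b → FPeq 1 m α s₁ s₂

/-- the kinetic cost density -/
def kin (S : MFGSetting d) (m : ℝ → PTd d) (α : ℝ → Td d → Vd d) (s : ℝ) : ℝ :=
  ig (m s) (fun y => S.Hstar (secT y) (α s y))

lemma hstar_comp_meas (S : MFGSetting d) {α : ℝ → Td d → Vd d}
    (hα : Measurable (fun q : ℝ × Td d => α q.1 q.2)) :
    Measurable (fun q : ℝ × Td d => S.Hstar (secT q.2) (α q.1 q.2)) :=
  S.Hstar_meas.comp ((measurable_secT.comp measurable_snd).prodMk hα)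

open ProbabilityTheory in
lemma hstar_int (S : MFGSetting d) {κ : Kernel ℝ (Td d)} [IsMarkovKernel κ] {a b : ℝ}
    {α : ℝ → Td d → Vd d} (hα : Measurable (fun q : ℝ × Td d => α q.1 q.2))
    (hi : Integrable (fun q : ℝ × Td d => sqnorm (α q.1 q.2)) (stm κ a b)) :
    Integrable (fun q : ℝ × Td d => S.Hstar (secT q.2) (α q.1 q.2)) (stm κ a b) := by
  obtain ⟨K, hK0, hK⟩ := S.Hstar_bounds
  refine st_quad hi (hstar_comp_meas S hα).aestronglyMeasurable (g := fun _ => K) (C := K)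
    continuous_const (fun q => ?_)
  have := hK (secT q.2) (α q.1 q.2)
  have := sqnorm_nonneg (α q.1 q.2)
  rw [abs_le]
  constructor <;> nlinarith

lemma Ctl.sub {m : ℝ → PTd d} {α : ℝ → Td d → Vd d} {a b : ℝ} (h : Ctl m α a b)
    {s t : ℝ} (hs : a ≤ s) (ht : t ≤ b) : Ctl m α s t :=
  ⟨h.meas, lt_of_le_of_lt (lintegral_mono_set (Ioc_subset_Ioc hs ht)) h.l2,
    fun s₁ s₂ h1 h2 h3 => h.fp s₁ s₂ (hs.trans h1) h2 (h3.trans ht)⟩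

lemma dotp_meas_grad {φ : ℝ → Vd d → ℝ} (h : IsTestFun φ) {α : ℝ → Td d → Vd d}
    (hα : Measurable (fun q : ℝ × Td d => α q.1 q.2)) :
    Measurable (fun q : ℝ × Td d => dotp (α q.1 q.2) (gradv (φ q.1) (secT q.2))) := by
  have hg : Continuous (fun q : ℝ × Td d => gradv (φ q.1) (secT q.2)) :=
    Per.cont2 (fun s => gradv_per (h.per s)) h.cont_grad
  exact MFGSetting.cont_dotp.measurable.comp (hα.prodMk hg.measurable)

lemma test_gradT {φ : ℝ → Vd d → ℝ} (h : IsTestFun φ) :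
    Continuous (fun q : ℝ × Td d => gradv (φ q.1) (secT q.2)) :=
  Per.cont2 (fun s => gradv_per (h.per s)) h.cont_grad

lemma test_tlT {φ : ℝ → Vd d → ℝ} (h : IsTestFun φ) :
    Continuous (fun q : ℝ × Td d => tderiv φ q.1 (secT q.2) + lapl (φ q.1) (secT q.2)) :=
  (Per.cont2 (fun s => tderiv_per h s) h.cont_td).add
    (Per.cont2 (fun s => lapl_per (h.per s)) h.cont_lapl)

lemma sqnorm_cont : Continuous (sqnorm : Vd d → ℝ) := by
  unfold sqnorm; fun_prop

open ProbabilityTheory in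
lemma dotp_int {κ : Kernel ℝ (Td d)} [IsMarkovKernel κ] {a b : ℝ}
    {φ : ℝ → Vd d → ℝ} (h : IsTestFun φ) {α : ℝ → Td d → Vd d}
    (hα : Measurable (fun q : ℝ × Td d => α q.1 q.2))
    (hi : Integrable (fun q : ℝ × Td d => sqnorm (α q.1 q.2)) (stm κ a b)) :
    Integrable (fun q : ℝ × Td d => dotp (α q.1 q.2) (gradv (φ q.1) (secT q.2))) (stm κ a b) := by
  refine st_quad hi (dotp_meas_grad h hα).aestronglyMeasurable (C := (4 * 1)⁻¹)
    (sqnorm_cont.comp (test_gradT h)) (fun q => ?_)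
  have := dotp_young (α q.1 q.2) (gradv (φ q.1) (secT q.2)) one_pos
  simp only [Function.comp]
  linarith

/-- Lemma A -/
lemma lemA (S : MFGSetting d) {m : ℝ → PTd d} {α : ℝ → Td d → Vd d} {a b : ℝ} (hab : a ≤ b)
    (hm : ContinuousOn m (Icc a b)) (h : Ctl m α a b) :
    IntervalIntegrable (kin S m α) volume a b ∧ Act S m a b (∫ s in a..b, kin S m α s) := by
  obtain ⟨κ, hκM, hκ⟩ := exists_kernel hab hm
  have hi := (st_l2 hκ h.meas).1 h.l2
  have hH := hstar_int S h.meas hi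
  have hH' := st_eq hab hκ hH
  refine ⟨hH'.1, fun φ hφ => ?_⟩
  have hfp := h.fp a b le_rfl hab le_rfl φ hφ
  have hD := dotp_int hφ h.meas hi
  have hT : Integrable _ (stm κ a b) := st_cont (test_tlT hφ)
  have hL : Integrable _ (stm κ a b) := st_cont (LL_cont S hφ)
  have hTD : Integrable (fun q : ℝ × Td d => tderiv φ q.1 (secT q.2) + lapl (φ q.1) (secT q.2)
        - dotp (α q.1 q.2) (gradv (φ q.1) (secT q.2))) (stm κ a b) := hT.sub hD
  have hL : Integrable (fun q : ℝ × Td d => LL S φ q.1 q.2) (stm κ a b) := hL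
  have e1 := (st_eq hab hκ hTD).2.2
  have e2 := (st_eq hab hκ hL).2.2
  have e3 := hH'.2.2
  unfold ig at e1 e2 e3 ⊢
  simp only [one_mul] at hfp
  rw [← e1] at hfp
  unfold kin ig
  rw [← e2, ← e3]
  have e4 : ∫ q, LL S φ q.1 q.2 ∂(stm κ a b) -
      ∫ q, (tderiv φ q.1 (secT q.2) + lapl (φ q.1) (secT q.2)
        - dotp (α q.1 q.2) (gradv (φ q.1) (secT q.2))) ∂(stm κ a b) ≤
      ∫ q, S.Hstar (secT q.2) (α q.1 q.2) ∂(stm κ a b) := by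
    rw [← integral_sub hL hTD]
    refine integral_mono (hL.sub hTD) hH (fun q => ?_)
    have := S.le_Hstar (secT q.2) (α q.1 q.2) (gradv (φ q.1) (secT q.2))
    simp only [LL, LLv, Pi.sub_apply]
    linarith
  linarith


/-- convex Hahn--Banach -/
lemma HB {W E : Type*} [AddCommGroup W] [Module ℝ W] [AddCommGroup E] [Module ℝ E]
    (G : W →ₗ[ℝ] E) (l : W →ₗ[ℝ] ℝ) (Φ : E → ℝ)
    (hc : ∀ x y : E, ∀ s t : ℝ, 0 < s → 0 < t → s + t = 1 → Φ (s • x + t • y) ≤ s * Φ x + t * Φ y)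
    (h : ∀ w, l w ≤ Φ (G w)) :
    ∃ L : E →ₗ[ℝ] ℝ, (∀ w, L (G w) = l w) ∧ ∀ g, L g ≤ Φ g := by
  have h0 : 0 ≤ Φ 0 := by simpa using h 0
  let N : E → ℝ := fun g => ⨅ t : {t : ℝ // 0 < t}, Φ (t.1 • g) / t.1
  have hlow : ∀ g (t : ℝ), 0 < t → - Φ (-g) ≤ Φ (t • g) / t := by
    intro g t ht
    have := hc (t • g) (-g) (1 / (1 + t)) (t / (1 + t)) (by positivity) (by positivity) (by field_simp)
    have e : (1 / (1 + t)) • t • g + (t / (1 + t)) • -g = 0 := by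
      rw [smul_smul, smul_neg]
      have : 1 / (1 + t) * t = t / (1 + t) := by ring
      rw [this, add_neg_cancel]
    rw [e] at this
    rw [le_div_iff₀ ht]
    have h2 : 0 ≤ (1 / (1 + t)) * (Φ (t • g) + t * Φ (-g)) := by
      calc (0:ℝ) ≤ _ := h0.trans this
        _ = _ := by ring
    have h3 : 0 ≤ Φ (t • g) + t * Φ (-g) := nonneg_of_mul_nonneg_right h2 (by positivity)
    linarith
  have hbdd : ∀ g, BddBelow (range fun t : {t : ℝ // 0 < t} => Φ (t.1 • g) / t.1) := by
    rintro g
    refine ⟨- Φ (-g), ?_⟩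
    rintro _ ⟨t, rfl⟩
    exact hlow g t.1 t.2
  have hle : ∀ g (t : ℝ), 0 < t → N g ≤ Φ (t • g) / t := fun g t ht => ciInf_le (hbdd g) ⟨t, ht⟩
  haveI : Nonempty {t : ℝ // 0 < t} := ⟨⟨1, one_pos⟩⟩
  have hge : ∀ g (c : ℝ), (∀ t : ℝ, 0 < t → c ≤ Φ (t • g) / t) → c ≤ N g :=
    fun g c hh => le_ciInf fun t => hh t.1 t.2
  have hom1 : ∀ c : ℝ, 0 < c → ∀ x, N (c • x) ≤ c * N x := by
    intro c hc0 x
    have : N (c • x) / c ≤ N x := by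
      refine hge _ _ fun t ht => ?_
      have := hle (c • x) (t / c) (by positivity)
      rw [smul_smul, div_mul_cancel₀ _ hc0.ne'] at this
      rw [div_le_iff₀ hc0]
      calc _ ≤ _ := this
        _ = _ := by field_simp
    rw [div_le_iff₀ hc0] at this
    linarith
  have hom : ∀ c : ℝ, 0 < c → ∀ x, N (c • x) = c * N x := by
    intro c hc0 x
    refine le_antisymm (hom1 c hc0 x) ?_
    have := hom1 c⁻¹ (by positivity) (c • x)
    rw [smul_smul, inv_mul_cancel₀ hc0.ne', one_smul] at this
    have := mul_le_mul_of_nonneg_left this hc0.le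
    rwa [← mul_assoc, mul_inv_cancel₀ hc0.ne', one_mul] at this
  have hadd : ∀ x y, N (x + y) ≤ N x + N y := by
    intro x y
    have h1 : N (x + y) - N y ≤ N x := by
      refine hge _ _ fun t ht => ?_
      have h2 : N (x + y) - Φ (t • x) / t ≤ N y := by
        refine hge _ _ fun s hs => ?_
        have h3 := hle (x + y) (t * s / (t + s)) (by positivity)
        have h4 := hc (t • x) (s • y) (s / (t + s)) (t / (t + s)) (by positivity) (by positivity)
          (by field_simp; ring)
        have e : (s / (t + s)) • t • x + (t / (t + s)) • s • y = (t * s / (t + s)) • (x + y) := by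
          rw [smul_smul, smul_smul, smul_add]; congr 2 <;> ring
        rw [e] at h4
        have h5 : Φ ((t * s / (t + s)) • (x + y)) / (t * s / (t + s)) ≤
            (s / (t + s) * Φ (t • x) + t / (t + s) * Φ (s • y)) / (t * s / (t + s)) :=
          div_le_div_of_nonneg_right h4 (by positivity)
        have h6 : (s / (t + s) * Φ (t • x) + t / (t + s) * Φ (s • y)) / (t * s / (t + s)) =
          Φ (t • x) / t + Φ (s • y) / s := by field_simp
        linarith
      linarith
    linarith
  have hker : ∀ w, G w = 0 → l w = 0 := by
    intro w hw
    by_contra hne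
    have := h (((Φ 0 + 1) / l w) • w)
    rw [map_smul, map_smul, hw, smul_zero, smul_eq_mul, div_mul_cancel₀ _ hne] at this
    linarith
  obtain ⟨R, hR⟩ := LinearMap.exists_rightInverse_of_surjective G.rangeRestrict
    (LinearMap.range_rangeRestrict G)
  have hR' : ∀ x, G (R x) = x := fun x => by
    have := congrArg Subtype.val (LinearMap.congr_fun hR x)
    simpa using this
  obtain ⟨L, hL1, hL2⟩ := exists_extension_of_le_sublinear ⟨LinearMap.range G, l ∘ₗ R⟩ N hom hadd (by
    intro x
    refine hge _ _ fun t ht => ?_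
    change l (R x) ≤ _
    have := h (t • R x)
    rw [map_smul, map_smul, hR', smul_eq_mul] at this
    rw [le_div_iff₀ ht]; linarith)
  refine ⟨L, fun w => ?_, fun g => ?_⟩
  · have := hL1 ⟨G w, ⟨w, rfl⟩⟩
    rw [this]
    change l (R ⟨G w, ⟨w, rfl⟩⟩) = l w
    have h2 := hker (R ⟨G w, ⟨w, rfl⟩⟩ - w) (by rw [map_sub, hR', sub_self])
    rw [map_sub] at h2; linarith
  · have := hle g 1 one_pos
    rw [one_smul, div_one] at this
    exact (hL2 g).trans this

lemma IsTestFun.dx {φ : ℝ → Vd d → ℝ} (h : IsTestFun φ) (s : ℝ) : Differentiable ℝ (φ s) :=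
  (h.cx s).differentiable (by norm_num)

lemma IsTestFun.ddx {φ : ℝ → Vd d → ℝ} (h : IsTestFun φ) (s : ℝ) (v : Vd d) :
    Differentiable ℝ (fun x => fderiv ℝ (φ s) x v) :=
  (((h.cx s).fderiv_right (m := 1) (by norm_num)).clm_apply contDiff_const).differentiable (by norm_num)

lemma tderiv_add' {φ ψ : ℝ → Vd d → ℝ} (h : IsTestFun φ) (h' : IsTestFun ψ) (s : ℝ) (x : Vd d) :
    tderiv (fun s x => φ s x + ψ s x) s x = tderiv φ s x + tderiv ψ s x :=
  ((h.td' s x).add (h'.td' s x)).deriv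

lemma fderiv_add' {φ ψ : ℝ → Vd d → ℝ} (h : IsTestFun φ) (h' : IsTestFun ψ) (s : ℝ) (x v : Vd d) :
    fderiv ℝ (fun x => φ s x + ψ s x) x v = fderiv ℝ (φ s) x v + fderiv ℝ (ψ s) x v := by
  rw [fderiv_fun_add (h.dx s x) (h'.dx s x)]; rfl

lemma gradv_add' {φ ψ : ℝ → Vd d → ℝ} (h : IsTestFun φ) (h' : IsTestFun ψ) (s : ℝ) (x : Vd d) :
    gradv (fun x => φ s x + ψ s x) x = gradv (φ s) x + gradv (ψ s) x := by
  funext i; exact fderiv_add' h h' s x _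

lemma lapl_add' {φ ψ : ℝ → Vd d → ℝ} (h : IsTestFun φ) (h' : IsTestFun ψ) (s : ℝ) (x : Vd d) :
    lapl (fun x => φ s x + ψ s x) x = lapl (φ s) x + lapl (ψ s) x := by
  unfold lapl D2
  rw [← Finset.sum_add_distrib]
  refine Finset.sum_congr rfl fun i _ => ?_
  simp_rw [fderiv_add' h h' s]
  rw [fderiv_fun_add (h.ddx s _ x) (h'.ddx s _ x)]; rfl

lemma tderiv_mul' {φ : ℝ → Vd d → ℝ} (h : IsTestFun φ) {η : ℝ → ℝ} (hη : ContDiff ℝ 2 η)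
    (s : ℝ) (x : Vd d) :
    tderiv (fun s x => η s * φ s x) s x = deriv η s * φ s x + η s * tderiv φ s x :=
  (((hη.differentiable (by norm_num)) s).hasDerivAt.mul (h.td' s x)).deriv

lemma fderiv_cmul' {φ : ℝ → Vd d → ℝ} (h : IsTestFun φ) (c : ℝ) (s : ℝ) (x v : Vd d) :
    fderiv ℝ (fun x => c * φ s x) x v = c * fderiv ℝ (φ s) x v := by
  rw [fderiv_const_mul (h.dx s x)]; rfl

lemma gradv_mul' {φ : ℝ → Vd d → ℝ} (h : IsTestFun φ) (c : ℝ) (s : ℝ) (x : Vd d) :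
    gradv (fun x => c * φ s x) x = c • gradv (φ s) x := by
  funext i; exact fderiv_cmul' h c s x _

lemma lapl_mul' {φ : ℝ → Vd d → ℝ} (h : IsTestFun φ) (c : ℝ) (s : ℝ) (x : Vd d) :
    lapl (fun x => c * φ s x) x = c * lapl (φ s) x := by
  unfold lapl D2
  rw [Finset.mul_sum]
  refine Finset.sum_congr rfl fun i _ => ?_
  simp_rw [fderiv_cmul' h c s]
  rw [fderiv_const_mul (h.ddx s _ x)]; rfl

lemma du_bois {a b : ℝ} (hab : a < b) {g h : ℝ → ℝ} (hg : ContinuousOn g (Icc a b))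
    (hh : IntervalIntegrable h volume a b)
    (H : ∀ η : ℝ → ℝ, ContDiff ℝ 2 η →
      η b * g b - η a * g a = ∫ s in a..b, (deriv η s * g s + η s * h s)) :
    ∀ s₁ s₂, a ≤ s₁ → s₁ ≤ s₂ → s₂ ≤ b → g s₂ - g s₁ = ∫ s in s₁..s₂, h s := by
  have hIac := hh.absolutelyContinuousOnInterval_intervalIntegral (c := a) left_mem_uIcc
  set I : ℝ → ℝ := fun s => ∫ t in a..s, h t with hI
  have hIc : ContinuousOn I (Icc a b) := by
    have := hIac.continuousOn; rwa [uIcc_of_le hab.le] at this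
  set D : ℝ → ℝ := fun s => g s - g a - I s with hD
  have hDc : ContinuousOn D (Icc a b) := (hg.sub continuousOn_const).sub hIc
  have key : ∀ η : ℝ → ℝ, ContDiff ℝ 2 η → ∫ s in a..b, deriv η s * D s = η b * D b := by
    intro η hη
    have hηc : Continuous (deriv η) := hη.continuous_deriv (by norm_num)
    have i1 : IntervalIntegrable (fun s => deriv η s * g s) volume a b := by
      refine ContinuousOn.intervalIntegrable ?_
      rw [uIcc_of_le hab.le]; exact hηc.continuousOn.mul hg
    have i2 : IntervalIntegrable (fun s => η s * h s) volume a b :=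
      hh.continuousOn_mul hη.continuous.continuousOn
    have i3 : IntervalIntegrable (fun s => deriv η s * I s) volume a b := by
      refine ContinuousOn.intervalIntegrable ?_
      rw [uIcc_of_le hab.le]; exact hηc.continuousOn.mul hIc
    have i4 : IntervalIntegrable (fun s => deriv η s * g a) volume a b :=
      (hηc.mul continuous_const).intervalIntegrable _ _
    have hb := AbsolutelyContinuousOnInterval.integral_mul_deriv_eq_deriv_mul
      (f := η) (g := I) (a := a) (b := b)
      ((hη.of_le (by norm_num)).contDiffOn.absolutelyContinuousOnInterval) hIac
    have e1 : ∫ s in a..b, η s * deriv I s = ∫ s in a..b, η s * h s := by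
      refine intervalIntegral.integral_congr_ae ?_
      filter_upwards [hh.ae_hasDerivAt_integral] with s hs hs'
      have hd := hs (uIoc_subset_uIcc hs') a left_mem_uIcc
      rw [hd.deriv]
    have e2 : ∫ s in a..b, deriv η s = η b - η a :=
      intervalIntegral.integral_deriv_eq_sub (fun x _ => hη.differentiable (by norm_num) x)
        (hηc.intervalIntegrable _ _)
    have e3 : I a = 0 := intervalIntegral.integral_same
    have e4 := H η hη
    rw [intervalIntegral.integral_add i1 i2] at e4
    have e5 : (fun s => deriv η s * D s) = fun s => deriv η s * g s - deriv η s * g a - deriv η s * I s := by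
      funext s; simp only [hD]; ring
    rw [e5, intervalIntegral.integral_sub (i1.sub i4) i3, intervalIntegral.integral_sub i1 i4,
      intervalIntegral.integral_mul_const, e2]
    rw [e1, e3] at hb
    simp only [hD]
    linarith
  have hDb : D b = 0 := by
    have := key (fun _ => 1) contDiff_const
    simpa using this.symm
  have hz : ∀ᵐ s : ℝ, s ∈ Ioo a b → D s = 0 := by
    refine isOpen_Ioo.ae_eq_zero_of_integral_contDiff_smul_eq_zero
      ((hDc.mono Ioo_subset_Icc_self).locallyIntegrableOn measurableSet_Ioo) ?_
    intro θ hθ hθc hθs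
    have hc : Continuous θ := hθ.continuous
    have hd : deriv (fun s => ∫ t in a..s, θ t) = θ := by
      funext s; exact hc.deriv_integral _ a s
    have hη : ContDiff ℝ 2 (fun s => ∫ t in a..s, θ t) := by
      rw [show (2 : WithTop ℕ∞) = 1 + 1 by norm_num, contDiff_succ_iff_deriv]
      refine ⟨fun s => (hc.integral_hasStrictDerivAt a s).hasDerivAt.differentiableAt, by simp, ?_⟩
      rw [hd]; exact hθ.of_le (by exact_mod_cast le_top)
    have := key _ hη
    rw [hDb, mul_zero, hd] at this
    rw [← this, intervalIntegral.integral_of_le hab.le]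
    simp only [smul_eq_mul]
    symm
    refine setIntegral_eq_integral_of_forall_compl_eq_zero fun s hs => ?_
    have : θ s = 0 := by
      by_contra hne
      exact hs (Ioo_subset_Ioc_self (hθs (subset_tsupport _ hne)))
    rw [this, zero_mul]
  have hz2 : EqOn D (fun _ => 0) (Icc a b) := by
    refine Measure.eqOn_Icc_of_ae_eq volume hab.ne ?_ hDc continuousOn_const
    rw [← restrict_Ioo_eq_restrict_Icc]
    exact (ae_restrict_iff' measurableSet_Ioo).2 hz
  intro s₁ s₂ h1 h12 h2
  have z1 := hz2 ⟨h1, h12.trans h2⟩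
  have z2 := hz2 ⟨h1.trans h12, h2⟩
  simp only [hD, hI] at z1 z2
  have hu : uIcc a b = Icc a b := uIcc_of_le hab.le
  have j1 : IntervalIntegrable h volume a s₁ := hh.mono_set (by
    rw [hu, uIcc_of_le h1]; exact Icc_subset_Icc le_rfl (h12.trans h2))
  have j2 : IntervalIntegrable h volume s₁ s₂ := hh.mono_set (by
    rw [hu, uIcc_of_le h12]; exact Icc_subset_Icc h1 h2)
  have := intervalIntegral.integral_add_adjacent_intervals j1 j2
  linarith


abbrev Ed (d : ℕ) := EuclideanSpace ℝ (Fin d)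

lemma Ed_norm (v : Ed d) : ‖v‖ ^ 2 = sqnorm (v.ofLp) := by
  rw [EuclideanSpace.norm_sq_eq]; simp [sqnorm]

lemma Ed_inner (v w : Ed d) : inner ℝ v w = dotp v.ofLp w.ofLp := by
  simp [PiLp.inner_apply, dotp, mul_comm]

lemma cont_ofLp : Continuous (fun v : Ed d => v.ofLp) := PiLp.continuous_ofLp 2 _
lemma cont_toLp : Continuous (fun v : Vd d => (WithLp.toLp 2 v : Ed d)) := PiLp.continuous_toLp 2 _

/-- test functions as a submodule -/
def TF (d : ℕ) : Submodule ℝ (ℝ → Vd d → ℝ) where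
  carrier := {φ | IsTestFun φ}
  add_mem' := fun h h' => test_add h h'
  zero_mem' := test_zero
  smul_mem' := fun c _ h => test_smul h c

lemma memLp_sq {M : Measure (ℝ × Td d)} (g : Lp (Ed d) 2 M) :
    Integrable (fun q => sqnorm (g q).ofLp) M := by
  have := (memLp_two_iff_integrable_sq_norm (Lp.aestronglyMeasurable g)).1 (Lp.memLp g)
  simpa [Ed_norm] using this

lemma norm_sq_Lp {M : Measure (ℝ × Td d)} (g : Lp (Ed d) 2 M) :
    ‖g‖ ^ 2 = ∫ q, sqnorm (g q).ofLp ∂M := by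
  rw [← real_inner_self_eq_norm_sq, L2.inner_def]
  refine integral_congr_ae (Eventually.of_forall fun q => ?_)
  simp only [real_inner_self_eq_norm_sq, Ed_norm]

lemma bdd_memLp {M : Measure (ℝ × Td d)} [IsFiniteMeasure M] {f : ℝ × Td d → Vd d}
    (hf : Measurable f) (C : ℝ) (hb : ∀ᵐ q ∂M, sqnorm (f q) ≤ C) :
    MemLp (fun q => (WithLp.toLp 2 (f q) : Ed d)) 2 M := by
  refine (memLp_two_iff_integrable_sq_norm (cont_toLp.measurable.comp hf).aestronglyMeasurable).2 ?_
  refine Integrable.of_bound (C := C) ((cont_toLp.measurable.comp hf).norm.pow_const 2).aestronglyMeasurable ?_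
  filter_upwards [hb] with q hq
  rw [Real.norm_of_nonneg (by positivity), Ed_norm]
  exact hq

lemma H_comp_int (S : MFGSetting d) {M : Measure (ℝ × Td d)} [IsFiniteMeasure M]
    (g : Lp (Ed d) 2 M) : Integrable (fun q => S.H (secT q.2) (g q).ofLp) M := by
  obtain ⟨b, B, hb, hB, h⟩ := S.H_growth
  have hm : Measurable (fun q : ℝ × Td d => S.H (secT q.2) (g q).ofLp) :=
    S.H_cont.measurable.comp ((measurable_secT.comp measurable_snd).prodMk
      (cont_ofLp.measurable.comp (Lp.stronglyMeasurable g).measurable))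
  refine Integrable.mono' (((memLp_sq g).const_mul B).add (integrable_const B)) hm.aestronglyMeasurable
    (Eventually.of_forall fun q => ?_)
  have := h (secT q.2) (g q).ofLp
  have h2 := sqnorm_nonneg (g q).ofLp
  simp only [Pi.add_apply, Real.norm_eq_abs]
  rw [abs_le]
  constructor <;> nlinarith

open ProbabilityTheory in
lemma grad_memLp {κ : Kernel ℝ (Td d)} [IsMarkovKernel κ] {a b : ℝ} {φ : ℝ → Vd d → ℝ}
    (h : IsTestFun φ) :
    MemLp (fun q : ℝ × Td d => (WithLp.toLp 2 (gradv (φ q.1) (secT q.2)) : Ed d)) 2 (stm κ a b) := by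
  have hc := sqnorm_cont.comp (test_gradT h)
  obtain ⟨C, hC⟩ := (isCompact_Icc (a := a) (b := b)).prod (isCompact_univ (X := Td d))
    |>.exists_bound_of_continuousOn hc.continuousOn
  refine bdd_memLp (test_gradT h).measurable C ?_
  filter_upwards [stm_ae κ] with q hq
  exact (le_abs_self _).trans (hC q ⟨Ioc_subset_Icc_self hq, trivial⟩)

lemma ig_add (μ : PTd d) {f g : Td d → ℝ} (hf : Continuous f) (hg : Continuous g) :
    ig μ (fun y => f y + g y) = ig μ f + ig μ g :=
  integral_add (int_cont hf _) (int_cont hg _)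

lemma ig_smul (μ : PTd d) (c : ℝ) (f : Td d → ℝ) :
    ig μ (fun y => c * f y) = c * ig μ f := integral_const_mul c f

/-- the linear functional -/
def lin (M : Measure (ℝ × Td d)) (μa μb : PTd d) (a b : ℝ) (φ : ℝ → Vd d → ℝ) : ℝ :=
  (∫ q, (tderiv φ q.1 (secT q.2) + lapl (φ q.1) (secT q.2)) ∂M)
    + ig μa (fun y => φ a (secT y)) - ig μb (fun y => φ b (secT y))

open ProbabilityTheory in
lemma lin_add {κ : Kernel ℝ (Td d)} [IsMarkovKernel κ] {a b : ℝ} (μa μb : PTd d)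
    {φ ψ : ℝ → Vd d → ℝ} (h : IsTestFun φ) (h' : IsTestFun ψ) :
    lin (stm κ a b) μa μb a b (fun s x => φ s x + ψ s x) =
      lin (stm κ a b) μa μb a b φ + lin (stm κ a b) μa μb a b ψ := by
  unfold lin
  rw [ig_add μa (test_contT' h a) (test_contT' h' a), ig_add μb (test_contT' h b) (test_contT' h' b)]
  simp_rw [tderiv_add' h h', lapl_add' h h']
  have : ∫ q : ℝ × Td d, (tderiv φ q.1 (secT q.2) + tderiv ψ q.1 (secT q.2) + (lapl (φ q.1) (secT q.2)
      + lapl (ψ q.1) (secT q.2))) ∂(stm κ a b) =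
      ∫ q : ℝ × Td d, (tderiv φ q.1 (secT q.2) + lapl (φ q.1) (secT q.2)) ∂(stm κ a b) +
      ∫ q : ℝ × Td d, (tderiv ψ q.1 (secT q.2) + lapl (ψ q.1) (secT q.2)) ∂(stm κ a b) := by
    rw [← integral_add (st_cont (test_tlT h)) (st_cont (test_tlT h'))]
    congr 1; funext q; ring
  rw [this]; ring

open ProbabilityTheory in
lemma lin_smul {κ : Kernel ℝ (Td d)} [IsMarkovKernel κ] {a b : ℝ} (μa μb : PTd d)
    {φ : ℝ → Vd d → ℝ} (h : IsTestFun φ) (c : ℝ) :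
    lin (stm κ a b) μa μb a b (fun s x => c * φ s x) = c * lin (stm κ a b) μa μb a b φ := by
  unfold lin
  rw [ig_smul, ig_smul]
  have h1 : ∀ s x, tderiv (fun s x => c * φ s x) s x = c * tderiv φ s x := fun s x => by
    have := tderiv_mul' h (contDiff_const (c := c)) s x
    simpa using this
  simp_rw [h1, lapl_mul' h, ← mul_add]
  rw [integral_const_mul]; ring

open ProbabilityTheory in
lemma exists_L (S : MFGSetting d) {κ : Kernel ℝ (Td d)} [IsMarkovKernel κ] {a b C : ℝ}
    {μa μb : PTd d} (h : ∀ φ : ℝ → Vd d → ℝ, IsTestFun φ → lin (stm κ a b) μa μb a b φ ≤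
      ∫ q, S.H (secT q.2) (gradv (φ q.1) (secT q.2)) ∂(stm κ a b) + C) :
    ∃ α : Lp (Ed d) 2 (stm κ a b),
      (∀ φ : ℝ → Vd d → ℝ, IsTestFun φ → ∫ q, dotp (α q).ofLp (gradv (φ q.1) (secT q.2)) ∂(stm κ a b) =
        lin (stm κ a b) μa μb a b φ) ∧
      ∀ g : Lp (Ed d) 2 (stm κ a b), ∫ q, dotp (α q).ofLp (g q).ofLp ∂(stm κ a b) ≤
        ∫ q, S.H (secT q.2) (g q).ofLp ∂(stm κ a b) + C := by
  set M := stm κ a b with hM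
  let G : TF d →ₗ[ℝ] Lp (Ed d) 2 M :=
    { toFun := fun φ => (grad_memLp (κ := κ) (a := a) (b := b) φ.2).toLp _
      map_add' := fun φ ψ => by
        rw [← MemLp.toLp_add]
        congr 1
        funext q
        change WithLp.toLp 2 (gradv (fun x => φ.1 q.1 x + ψ.1 q.1 x) (secT q.2)) = _
        rw [gradv_add' φ.2 ψ.2]; rfl
      map_smul' := fun c φ => by
        rw [RingHom.id_apply, ← MemLp.toLp_const_smul]
        congr 1
        funext q
        change WithLp.toLp 2 (gradv (fun x => c * φ.1 q.1 x) (secT q.2)) = _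
        rw [gradv_mul' φ.2]; rfl }
  let l : TF d →ₗ[ℝ] ℝ :=
    { toFun := fun φ => lin M μa μb a b φ.1
      map_add' := fun φ ψ => lin_add μa μb φ.2 ψ.2
      map_smul' := fun c φ => lin_smul μa μb φ.2 c }
  have hG : ∀ φ : TF d, (G φ : ℝ × Td d → Ed d) =ᵐ[M] fun q => WithLp.toLp 2 (gradv (φ.1 q.1) (secT q.2)) :=
    fun φ => MemLp.coeFn_toLp (grad_memLp (κ := κ) (a := a) (b := b) φ.2)
  obtain ⟨L, hL1, hL2⟩ := HB G l (fun g => ∫ q, S.H (secT q.2) (g q).ofLp ∂M + C) (by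
    intro x y s t hs ht hst
    have h1 : ∫ q, S.H (secT q.2) ((s • x + t • y : Lp (Ed d) 2 M) q).ofLp ∂M ≤
        ∫ q, (s * S.H (secT q.2) (x q).ofLp + t * S.H (secT q.2) (y q).ofLp) ∂M := by
      refine integral_mono_ae (H_comp_int S _) (((H_comp_int S x).const_mul s).add
        ((H_comp_int S y).const_mul t)) ?_
      filter_upwards [Lp.coeFn_add (s • x) (t • y), Lp.coeFn_smul s x, Lp.coeFn_smul t y] with q e1 e2 e3
      rw [e1, Pi.add_apply, e2, e3]
      have := S.H_convex (secT q.2) (x q).ofLp (y q).ofLp ht.le (by linarith)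
      have e4 : ((s • (x : ℝ × Td d → Ed d)) q + (t • (y : ℝ × Td d → Ed d)) q : Ed d).ofLp
          = (x q).ofLp + t • ((y q).ofLp - (x q).ofLp) := by
        have : s = 1 - t := by linarith
        subst this
        funext i
        simp
        ring
      rw [e4]
      have : s = 1 - t := by linarith
      subst this
      linarith
    rw [integral_add ((H_comp_int S x).const_mul s) ((H_comp_int S y).const_mul t),
      integral_const_mul, integral_const_mul] at h1
    have : s = 1 - t := by linarith
    subst this
    linarith) (by
    intro φ
    have := h φ.1 φ.2
    have e : ∫ q, S.H (secT q.2) (G φ q).ofLp ∂M = ∫ q, S.H (secT q.2) (gradv (φ.1 q.1) (secT q.2)) ∂M := by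
      refine integral_congr_ae ?_
      filter_upwards [hG φ] with q hq
      rw [hq]
    rw [e]; exact this)
  obtain ⟨b0, B, hb0, hB, hgr⟩ := S.H_growth
  have hb1 : ∀ g : Lp (Ed d) 2 M, L g ≤ B * ‖g‖ ^ 2 + (B * M.real univ + C) := by
    intro g
    refine (hL2 g).trans ?_
    have : ∫ q, S.H (secT q.2) (g q).ofLp ∂M ≤ ∫ q, (B * sqnorm (g q).ofLp + B) ∂M :=
      integral_mono (H_comp_int S g) (((memLp_sq g).const_mul B).add (integrable_const B))
        fun q => (hgr _ _).2
    rw [integral_add ((memLp_sq g).const_mul B) (integrable_const B), integral_const_mul, ← norm_sq_Lp,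
      integral_const, smul_eq_mul] at this
    linarith
  set K := B + (B * M.real univ + C) with hK
  have hb2 : ∀ g : Lp (Ed d) 2 M, L g ≤ K * ‖g‖ := by
    intro g
    by_cases hg : g = 0
    · simp [hg]
    have hn : 0 < ‖g‖ := norm_pos_iff.2 hg
    have := hb1 (‖g‖⁻¹ • g)
    rw [map_smul, norm_smul, norm_inv, norm_norm, inv_mul_cancel₀ hn.ne', smul_eq_mul] at this
    have h2 : ‖g‖⁻¹ * L g ≤ K := by rw [hK]; linarith
    rw [inv_mul_le_iff₀ hn] at h2
    linarith
  have hb3 : ∀ g : Lp (Ed d) 2 M, ‖L g‖ ≤ K * ‖g‖ := by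
    intro g
    rw [Real.norm_eq_abs, abs_le]
    refine ⟨?_, hb2 g⟩
    have := hb2 (-g)
    rw [map_neg, norm_neg] at this; linarith
  let Lc : StrongDual ℝ (Lp (Ed d) 2 M) := L.mkContinuous K hb3
  let α := (InnerProductSpace.toDual ℝ (Lp (Ed d) 2 M)).symm Lc
  have hα : ∀ g : Lp (Ed d) 2 M, ∫ q, dotp (α q).ofLp (g q).ofLp ∂M = L g := by
    intro g
    have : inner ℝ α g = L g := InnerProductSpace.toDual_symm_apply
    rw [← this, L2.inner_def]
    simp_rw [Ed_inner]
  refine ⟨α, fun φ hφ => ?_, fun g => by rw [hα]; exact hL2 g⟩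
  have e := hα (G ⟨φ, hφ⟩)
  rw [hL1] at e
  change _ = lin M μa μb a b φ at e
  rw [← e]
  refine integral_congr_ae ?_
  filter_upwards [hG ⟨φ, hφ⟩] with q hq
  rw [hq]

lemma ig_sub (μ : PTd d) {f g : Td d → ℝ} (hf : Continuous f) (hg : Continuous g) :
    ig μ (fun y => f y - g y) = ig μ f - ig μ g :=
  integral_sub (int_cont hf _) (int_cont hg _)

lemma meas_max (S : MFGSetting d) {α : ℝ × Td d → Vd d} (hα : Measurable α) (N : ℕ) :
    ∃ g : ℝ × Td d → Vd d, Measurable g ∧ (∃ C, ∀ q, sqnorm (g q) ≤ C) ∧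
      ∀ q, ∀ n ≤ N, dotp (α q) (TopologicalSpace.denseSeq (Vd d) n)
        - S.H (secT q.2) (TopologicalSpace.denseSeq (Vd d) n) ≤
        dotp (α q) (g q) - S.H (secT q.2) (g q) := by
  have hv : ∀ g : ℝ × Td d → Vd d, Measurable g →
      Measurable (fun q => dotp (α q) (g q) - S.H (secT q.2) (g q)) := fun g hg =>
    (MFGSetting.cont_dotp.measurable.comp (hα.prodMk hg)).sub
      (S.H_cont.measurable.comp ((measurable_secT.comp measurable_snd).prodMk hg))
  induction N with
  | zero =>
    refine ⟨fun _ => TopologicalSpace.denseSeq (Vd d) 0, measurable_const, ⟨_, fun _ => le_rfl⟩, ?_⟩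
    intro q n hn
    obtain rfl : n = 0 := by omega
    rfl
  | succ N ih =>
    obtain ⟨g, hg, ⟨C, hC⟩, hq⟩ := ih
    set p := TopologicalSpace.denseSeq (Vd d) (N + 1) with hp
    have hset : MeasurableSet {q | dotp (α q) (g q) - S.H (secT q.2) (g q) ≤
      dotp (α q) p - S.H (secT q.2) p} := measurableSet_le (hv g hg) (hv _ measurable_const)
    classical
    refine ⟨fun q => if dotp (α q) (g q) - S.H (secT q.2) (g q) ≤
      dotp (α q) p - S.H (secT q.2) p then p else g q, Measurable.ite hset measurable_const hg,
      ⟨max C (sqnorm p), fun q => ?_⟩, fun q n hn => ?_⟩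
    · dsimp only
      split_ifs
      · exact le_max_right _ _
      · exact (hC q).trans (le_max_left _ _)
    · dsimp only
      rcases Nat.lt_or_ge n (N + 1) with h | h
      · have := hq q n (by omega)
        split_ifs with h'
        · exact this.trans h'
        · exact this
      · obtain rfl : n = N + 1 := by omega
        split_ifs with h'
        · exact le_rfl
        · exact (not_le.1 h').le

open ProbabilityTheory in
lemma hstar_le (S : MFGSetting d) {κ : Kernel ℝ (Td d)} [IsMarkovKernel κ] {a b C : ℝ}
    (α : Lp (Ed d) 2 (stm κ a b))
    (h : ∀ g : Lp (Ed d) 2 (stm κ a b), ∫ q, dotp (α q).ofLp (g q).ofLp ∂(stm κ a b) ≤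
        ∫ q, S.H (secT q.2) (g q).ofLp ∂(stm κ a b) + C) :
    ∫ q, S.Hstar (secT q.2) (α q).ofLp ∂(stm κ a b) ≤ C := by
  have hα : Measurable (fun q => (α q).ofLp) :=
    cont_ofLp.measurable.comp (Lp.stronglyMeasurable α).measurable
  choose g hg hb hq using meas_max S hα
  set p0 := TopologicalSpace.denseSeq (Vd d) 0
  have hdi : ∀ f : ℝ × Td d → Vd d, Measurable f → (∃ C, ∀ q, sqnorm (f q) ≤ C) →
      Integrable (fun q => dotp (α q).ofLp (f q)) (stm κ a b) := by
    rintro f hf ⟨C, hC⟩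
    refine Integrable.mono' (((memLp_sq α).const_mul (4 * 1)⁻¹).add (integrable_const (1 * C)))
      (MFGSetting.cont_dotp.measurable.comp (hα.prodMk hf)).aestronglyMeasurable
      (Eventually.of_forall fun q => ?_)
    have := dotp_young (α q).ofLp (f q) one_pos
    have := hC q
    simp only [Pi.add_apply, Real.norm_eq_abs]
    linarith
  have hHi : ∀ f : ℝ × Td d → Vd d, Measurable f → (∃ C, ∀ q, sqnorm (f q) ≤ C) →
      Integrable (fun q => S.H (secT q.2) (f q)) (stm κ a b) := by
    rintro f hf ⟨C, hC⟩
    have := H_comp_int S ((bdd_memLp (M := stm κ a b) hf C (Eventually.of_forall hC)).toLp _)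
    refine this.congr ?_
    filter_upwards [MemLp.coeFn_toLp (bdd_memLp (M := stm κ a b) hf C (Eventually.of_forall hC))] with q hq
    rw [hq]
  have hle : ∀ N, ∫ q, (dotp (α q).ofLp (g N q) - S.H (secT q.2) (g N q)) ∂(stm κ a b) ≤ C := by
    intro N
    rw [integral_sub (hdi _ (hg N) (hb N)) (hHi _ (hg N) (hb N))]
    obtain ⟨C', hC'⟩ := hb N
    have hm := bdd_memLp (M := stm κ a b) (hg N) C' (Eventually.of_forall hC')
    have := h (hm.toLp _)
    have e1 : ∫ q, dotp (α q).ofLp ((hm.toLp _ : Lp (Ed d) 2 (stm κ a b)) q).ofLp ∂(stm κ a b) = ∫ q, dotp (α q).ofLp (g N q) ∂(stm κ a b) := by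
      refine integral_congr_ae ?_
      filter_upwards [MemLp.coeFn_toLp hm] with q hq
      rw [hq]
    have e2 : ∫ q, S.H (secT q.2) ((hm.toLp _ : Lp (Ed d) 2 (stm κ a b)) q).ofLp ∂(stm κ a b) = ∫ q, S.H (secT q.2) (g N q) ∂(stm κ a b) := by
      refine integral_congr_ae ?_
      filter_upwards [MemLp.coeFn_toLp hm] with q hq
      rw [hq]
    rw [e1, e2] at this
    linarith
  have hSi : Integrable (fun q => S.Hstar (secT q.2) (α q).ofLp) (stm κ a b) :=
    hstar_int S (α := fun s y => (α (s, y)).ofLp) hα (memLp_sq α)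
  have h0i : Integrable (fun q => dotp (α q).ofLp p0 - S.H (secT q.2) p0) (stm κ a b) :=
    (hdi (fun _ => p0) measurable_const ⟨_, fun _ => le_rfl⟩).sub
      (hHi (fun _ => p0) measurable_const ⟨_, fun _ => le_rfl⟩)
  refine le_of_tendsto (tendsto_integral_of_dominated_convergence
    (F := fun N q => dotp (α q).ofLp (g N q) - S.H (secT q.2) (g N q))
    (f := fun q => S.Hstar (secT q.2) (α q).ofLp)
    (fun q => |dotp (α q).ofLp p0 - S.H (secT q.2) p0| + |S.Hstar (secT q.2) (α q).ofLp|)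
    (fun N => ((hdi _ (hg N) (hb N)).sub (hHi _ (hg N) (hb N))).aestronglyMeasurable)
    (h0i.abs.add hSi.abs) (fun N => Eventually.of_forall fun q => ?_)
    (Eventually.of_forall fun q => ?_)) (Eventually.of_forall hle)
  · have h1 := hq N q 0 (Nat.zero_le _)
    have h2 := S.le_Hstar (secT q.2) (α q).ofLp (g N q)
    rw [Real.norm_eq_abs, abs_le]
    have h3 := abs_nonneg (dotp (α q).ofLp p0 - S.H (secT q.2) p0)
    have h4 := abs_nonneg (S.Hstar (secT q.2) (α q).ofLp)
    have h5 := neg_abs_le (dotp (α q).ofLp p0 - S.H (secT q.2) p0)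
    have h6 := le_abs_self (S.Hstar (secT q.2) (α q).ofLp)
    constructor <;> linarith
  · rw [Metric.tendsto_atTop]
    intro ε hε
    obtain ⟨_, ⟨n, rfl⟩, hn⟩ := (S.Hstar_lub_dense (secT q.2) (α q).ofLp).exists_between
      (sub_lt_self _ hε)
    refine ⟨n, fun N hN => ?_⟩
    have h1 := hq N q n hN
    have h2 := S.le_Hstar (secT q.2) (α q).ofLp (g N q)
    rw [Real.dist_eq, abs_lt]
    have := hn.1
    constructor <;> linarith

/-- Lemma R -/
lemma lemR (S : MFGSetting d) {m : ℝ → PTd d} {a b C : ℝ} (hab : a < b)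
    (hm : ContinuousOn m (Icc a b)) (h : Act S m a b C) :
    ∃ α : ℝ → Td d → Vd d, Ctl m α a b ∧ ∫ s in a..b, kin S m α s ≤ C := by
  obtain ⟨κ, hκM, hκ⟩ := exists_kernel hab.le hm
  have hHgi : ∀ {φ : ℝ → Vd d → ℝ}, IsTestFun φ →
      Integrable (fun q : ℝ × Td d => S.H (secT q.2) (gradv (φ q.1) (secT q.2))) (stm κ a b) := by
    intro φ hφ
    have := (st_cont (κ := κ) (a := a) (b := b) (test_tlT hφ)).sub (st_cont (LL_cont S hφ))
    refine this.congr (Eventually.of_forall fun q => ?_)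
    simp only [Pi.sub_apply, LL, LLv]; ring
  obtain ⟨α, hα1, hα2⟩ := exists_L S (κ := κ) (a := a) (b := b) (C := C) (μa := m a) (μb := m b) (by
    intro φ hφ
    have h1 := h φ hφ
    rw [← (st_eq hab.le hκ (st_cont (LL_cont S hφ))).2.2] at h1
    simp only [LL, LLv] at h1
    rw [integral_sub (st_cont (test_tlT hφ)) (hHgi hφ)] at h1
    unfold lin; linarith)
  have hmeas : Measurable (fun q => (α q).ofLp) :=
    cont_ofLp.measurable.comp (Lp.stronglyMeasurable α).measurable
  have hsq := memLp_sq α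
  let A : ℝ → Td d → Vd d := fun s y => (α (s, y)).ofLp
  have hi2 : Integrable (fun q : ℝ × Td d => sqnorm (A q.1 q.2)) (stm κ a b) := hsq
  have hDi : ∀ {φ : ℝ → Vd d → ℝ}, IsTestFun φ → Integrable (fun q : ℝ × Td d =>
      dotp (A q.1 q.2) (gradv (φ q.1) (secT q.2))) (stm κ a b) := fun hφ => dotp_int hφ hmeas hi2
  have hTDi : ∀ {φ : ℝ → Vd d → ℝ}, IsTestFun φ → Integrable (fun q : ℝ × Td d =>
      tderiv φ q.1 (secT q.2) + 1 * lapl (φ q.1) (secT q.2) -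
      dotp (A q.1 q.2) (gradv (φ q.1) (secT q.2))) (stm κ a b) := fun hφ => by
    refine ((st_cont (test_tlT hφ)).sub (hDi hφ)).congr (Eventually.of_forall fun q => ?_)
    simp only [Pi.sub_apply, one_mul]
  have hfp : ∀ {φ : ℝ → Vd d → ℝ}, IsTestFun φ → ig (m b) (fun y => φ b (secT y)) -
      ig (m a) (fun y => φ a (secT y)) = ∫ s in a..b, ig (m s) (fun y => tderiv φ s (secT y) +
        1 * lapl (φ s) (secT y) - dotp (A s y) (gradv (φ s) (secT y))) := by
    intro φ hφ
    rw [← (st_eq hab.le hκ (hTDi hφ)).2.2, integral_sub]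
    · have := hα1 φ hφ
      unfold lin at this
      simp only [one_mul]
      linarith
    · simpa using st_cont (κ := κ) (a := a) (b := b) (test_tlT hφ)
    · exact hDi hφ
  refine ⟨A, ⟨hmeas, (st_l2 hκ hmeas).2 hi2, ?_⟩, ?_⟩
  · intro s₁ s₂ h1 h12 h2 φ hφ
    have hs := st_eq hab.le hκ (hTDi hφ)
    refine du_bois hab (g := fun s => ig (m s) (fun y => φ s (secT y)))
      (h := fun s => ig (m s) (fun y => tderiv φ s (secT y) +
        1 * lapl (φ s) (secT y) - dotp (A s y) (gradv (φ s) (secT y))))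
      (cont_pair (test_contT hφ) hm) hs.1 ?_ s₁ s₂ h1 h12 h2
    intro η hη
    have e := hfp (test_time_mul hφ hη)
    rw [ig_smul, ig_smul] at e
    rw [e, intervalIntegral.integral_of_le hab.le, intervalIntegral.integral_of_le hab.le]
    refine integral_congr_ae ?_
    filter_upwards [hs.2.1] with s hs'
    have e2 : ∀ y, tderiv (fun s x => η s * φ s x) s (secT y) +
        1 * lapl (fun x => η s * φ s x) (secT y) - dotp (A s y) (gradv (fun x => η s * φ s x) (secT y)) =
        deriv η s * φ s (secT y) + η s * (tderiv φ s (secT y) +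
        1 * lapl (φ s) (secT y) - dotp (A s y) (gradv (φ s) (secT y))) := by
      intro y
      rw [tderiv_mul' hφ hη, lapl_mul' hφ, gradv_mul' hφ]
      have : ∀ v w : Vd d, dotp v (η s • w) = η s * dotp v w := by
        intro v w; simp only [dotp, Finset.mul_sum]
        refine Finset.sum_congr rfl fun i _ => ?_
        simp; ring
      rw [this]; ring
    simp_rw [e2]
    unfold ig
    rw [integral_add ((int_cont (test_contT' hφ s) _).const_mul _) (hs'.const_mul _),
      integral_const_mul, integral_const_mul]
  · have := hstar_le S α hα2
    rwa [(st_eq hab.le hκ (hstar_int S (α := A) hmeas hi2)).2.2] at this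



lemma Act.mono {S : MFGSetting d} {m : ℝ → PTd d} {a b C C' : ℝ} (h : Act S m a b C)
    (hC : C ≤ C') : Act S m a b C' := fun φ hφ => (h φ hφ).trans hC

lemma Act.congr {S : MFGSetting d} {m m' : ℝ → PTd d} {a b C : ℝ} (hab : a ≤ b)
    (h : Act S m a b C) (e : ∀ s ∈ Icc a b, m' s = m s) : Act S m' a b C := by
  intro φ hφ
  rw [e a (left_mem_Icc.2 hab), e b (right_mem_Icc.2 hab)]
  have : ∫ s in a..b, ig (m' s) (LL S φ s) = ∫ s in a..b, ig (m s) (LL S φ s) := by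
    refine intervalIntegral.integral_congr fun s hs => ?_
    rw [uIcc_of_le hab] at hs
    simp only [e s hs]
  rw [this]
  exact h φ hφ

lemma LL_contOn (S : MFGSetting d) {m : ℝ → PTd d} {I : Set ℝ} (hm : ContinuousOn m I)
    {φ : ℝ → Vd d → ℝ} (hφ : IsTestFun φ) : ContinuousOn (fun s => ig (m s) (LL S φ s)) I :=
  cont_pair (LL_cont S hφ) hm

lemma LL_ii (S : MFGSetting d) {m : ℝ → PTd d} {a b : ℝ} (hab : a ≤ b)
    (hm : ContinuousOn m (Icc a b)) {φ : ℝ → Vd d → ℝ} (hφ : IsTestFun φ) :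
    IntervalIntegrable (fun s => ig (m s) (LL S φ s)) volume a b := by
  refine ContinuousOn.intervalIntegrable ?_
  rw [uIcc_of_le hab]; exact LL_contOn S hm hφ

lemma Act.concat {S : MFGSetting d} {m : ℝ → PTd d} {a b c C C' : ℝ} (hab : a ≤ b) (hbc : b ≤ c)
    (hm : ContinuousOn m (Icc a b)) (hm' : ContinuousOn m (Icc b c))
    (h : Act S m a b C) (h' : Act S m b c C') : Act S m a c (C + C') := by
  intro φ hφ
  have := h φ hφ
  have := h' φ hφ
  rw [← intervalIntegral.integral_add_adjacent_intervals (LL_ii S hab hm hφ) (LL_ii S hbc hm' hφ)]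
  linarith

lemma LL_tsh (S : MFGSetting d) {φ : ℝ → Vd d → ℝ} (H : IsTestFun φ) (A h c₀ c₁ : ℝ) (y : Vd d)
    (s : ℝ) (x : Vd d) : LLv S (tsh φ A h c₀ c₁ y) s x =
      A * (tderiv φ (s + h) (x + (c₀ + c₁ * s) • y)
        + c₁ * dotp y (gradv (φ (s + h)) (x + (c₀ + c₁ * s) • y))
        + lapl (φ (s + h)) (x + (c₀ + c₁ * s) • y))
      - S.H x (A • gradv (φ (s + h)) (x + (c₀ + c₁ * s) • y)) := by
  unfold LLv
  rw [tderiv_tsh H, lapl_tsh, gradv_tsh]; ring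

lemma Act.shift {S : MFGSetting d} {m : ℝ → PTd d} {a b C : ℝ} (h : Act S m a b C) (t : ℝ) :
    Act S (fun s => m (s + t)) (a - t) (b - t) C := by
  intro φ hφ
  have h1 := h _ (test_tsh hφ 1 (-t) 0 0 0)
  have h2 : ∀ s (y : Td d), LL S (tsh φ 1 (-t) 0 0 0) s y = LL S φ (s - t) y := by
    intro s y
    unfold LL
    rw [LL_tsh S hφ, LLv]
    simp [sub_eq_add_neg, dotp]
  have h3 : ∀ s x, tsh φ 1 (-t) 0 0 0 s x = φ (s - t) x := by
    intro s x; simp [tsh, sub_eq_add_neg]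
  simp_rw [funext (h2 _), h3] at h1
  have h4 := intervalIntegral.integral_comp_sub_right (a := a) (b := b)
    (fun s => ig (m (s + t)) (LL S φ s)) t
  simp only [sub_add_cancel] at h4 ⊢
  rw [← h4]; exact h1

def mix (e : ℝ) (μ ν : PTd d) : PTd d :=
  open Classical in
  if h : e ∈ Icc (0:ℝ) 1 then ⟨lineComb e μ ν, ⟨by
    simp only [lineComb, Measure.add_apply, Measure.smul_apply, measure_univ, smul_eq_mul, mul_one]
    rw [← ENNReal.ofReal_add (by linarith [h.2]) h.1]; simp⟩⟩ else μ

lemma mix_coe {e : ℝ} (h : e ∈ Icc (0:ℝ) 1) (μ ν : PTd d) :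
    (mix e μ ν : Measure (Td d)) = lineComb e μ ν := by
  exact congrArg Subtype.val (dif_pos h)

lemma ig_mix {e : ℝ} (h : e ∈ Icc (0:ℝ) 1) (μ ν : PTd d) {f : Td d → ℝ} (hf : Continuous f) :
    ig (mix e μ ν) f = (1 - e) * ig μ f + e * ig ν f := by
  unfold ig
  rw [mix_coe h, lineComb, integral_add_measure ((int_cont hf _).smul_measure (by simp))
    ((int_cont hf _).smul_measure (by simp)), integral_smul_measure, integral_smul_measure,
    ENNReal.toReal_ofReal (by linarith [h.2]), ENNReal.toReal_ofReal h.1]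
  rfl

lemma contOn_mix {e : ℝ} (h : e ∈ Icc (0:ℝ) 1) {m m' : ℝ → PTd d} {I : Set ℝ}
    (hm : ContinuousOn m I) (hm' : ContinuousOn m' I) : ContinuousOn (fun s => mix e (m s) (m' s)) I := by
  refine cont_of_pair fun f hf => ?_
  have e1 : ∀ s, ∫ y, f y ∂(mix e (m s) (m' s) : Measure (Td d)) =
    (1 - e) * ∫ y, f y ∂(m s : Measure (Td d)) + e * ∫ y, f y ∂(m' s : Measure (Td d)) :=
    fun s => ig_mix h _ _ hf
  simp_rw [e1]
  have hf' : Continuous (fun q : ℝ × Td d => f q.2) := hf.comp continuous_snd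
  exact (continuousOn_const.mul (cont_pair hf' hm)).add (continuousOn_const.mul (cont_pair hf' hm'))

lemma Act.mix {S : MFGSetting d} {m m' : ℝ → PTd d} {a b C C' e : ℝ} (hab : a ≤ b)
    (he : e ∈ Icc (0:ℝ) 1) (hm : ContinuousOn m (Icc a b)) (hm' : ContinuousOn m' (Icc a b))
    (h : Act S m a b C) (h' : Act S m' a b C') :
    Act S (fun s => mix e (m s) (m' s)) a b ((1 - e) * C + e * C') := by
  intro φ hφ
  have e1 : ∀ s, ig (_root_.mix e (m s) (m' s)) (LL S φ s) = (1 - e) * ig (m s) (LL S φ s)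
      + e * ig (m' s) (LL S φ s) := fun s => ig_mix he _ _ ((LL_cont S hφ).comp (by fun_prop : Continuous fun y => (s, y)))
  simp_rw [e1]
  rw [intervalIntegral.integral_add ((LL_ii S hab hm hφ).const_mul _) ((LL_ii S hab hm' hφ).const_mul _),
    intervalIntegral.integral_const_mul, intervalIntegral.integral_const_mul,
    ig_mix he _ _ (test_contT' hφ a), ig_mix he _ _ (test_contT' hφ b)]
  have h1 := mul_le_mul_of_nonneg_left (h φ hφ) (by linarith [he.2] : 0 ≤ 1 - e)
  have h2 := mul_le_mul_of_nonneg_left (h' φ hφ) he.1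
  linarith

lemma cv_meas (c : ℝ) : Continuous (fun q : Td d × Vd d => q.1 + pj (c • q.2)) :=
  continuous_fst.add (continuous_pj.comp (by fun_prop))

def cv (μ : PTd d) (κ : ProbabilityMeasure (Vd d)) (c : ℝ) : PTd d :=
  ⟨((μ : Measure (Td d)).prod (κ : Measure (Vd d))).map (fun q => q.1 + pj (c • q.2)),
    Measure.isProbabilityMeasure_map (cv_meas c).aemeasurable⟩

lemma cv_int (μ : PTd d) (κ : ProbabilityMeasure (Vd d)) (c : ℝ) {f : Td d → ℝ}
    (hf : Continuous f) : Integrable (fun q : Td d × Vd d => f (q.1 + pj (c • q.2)))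
      ((μ : Measure (Td d)).prod (κ : Measure (Vd d))) := by
  obtain ⟨C, hC⟩ := isCompact_univ.exists_bound_of_continuousOn hf.continuousOn
  exact Integrable.of_bound (hf.comp (cv_meas c)).aestronglyMeasurable C
    (Eventually.of_forall fun q => hC _ trivial)

lemma ig_cv (μ : PTd d) (κ : ProbabilityMeasure (Vd d)) (c : ℝ) {f : Td d → ℝ}
    (hf : Continuous f) : ig (cv μ κ c) f =
      ∫ y, ig μ (fun x => f (x + pj (c • y))) ∂(κ : Measure (Vd d)) := by
  have h : ig (cv μ κ c) f = ∫ y, f y ∂(((μ : Measure (Td d)).prod (κ : Measure (Vd d))).map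
    (fun q => q.1 + pj (c • q.2))) := rfl
  rw [h, integral_map (cv_meas c).aemeasurable hf.aestronglyMeasurable,
    integral_prod_symm _ (cv_int μ κ c hf)]
  rfl

lemma ig_cv' (μ : PTd d) (κ : ProbabilityMeasure (Vd d)) (c : ℝ) {f : Td d → ℝ}
    (hf : Continuous f) : ig (cv μ κ c) f =
      ig μ (fun x => ∫ y, f (x + pj (c • y)) ∂(κ : Measure (Vd d))) := by
  have h : ig (cv μ κ c) f = ∫ y, f y ∂(((μ : Measure (Td d)).prod (κ : Measure (Vd d))).map
    (fun q => q.1 + pj (c • q.2))) := rfl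
  rw [h, integral_map (cv_meas c).aemeasurable hf.aestronglyMeasurable,
    integral_prod _ (cv_int μ κ c hf)]
  rfl

lemma cv_zero (μ : PTd d) (κ : ProbabilityMeasure (Vd d)) : cv μ κ 0 = μ := by
  refine ptd_ext fun f hf => ?_
  have := ig_cv μ κ 0 hf
  simp only [zero_smul, pj_zero, add_zero, integral_const, probReal_univ, one_smul] at this
  exact this

lemma abs_ig_le (μ : PTd d) {f : Td d → ℝ} {C : ℝ} (hC : ∀ y, |f y| ≤ C) : |ig μ f| ≤ C := by
  have := norm_integral_le_of_norm_le_const (μ := (μ : Measure (Td d))) (f := f) (C := C)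
    (Eventually.of_forall hC)
  simpa [ig] using this

lemma ig_mono (μ : PTd d) {f g : Td d → ℝ} (hf : Continuous f) (hg : Continuous g)
    (h : ∀ y, f y ≤ g y) : ig μ f ≤ ig μ g :=
  integral_mono (int_cont hf _) (int_cont hg _) h

/-- joint continuity in `(s,y)` of the shifted pairings -/
lemma shift_cont {f : ℝ → Td d → ℝ} (hf : Continuous (fun q : ℝ × Td d => f q.1 q.2))
    {m : ℝ → PTd d} (hm : Continuous m) {c : ℝ → ℝ} (hc : Continuous c) :
    Continuous (fun q : ℝ × Vd d => ig (m q.1) (fun x => f q.1 (x + pj (c q.1 • q.2)))) := by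
  refine cont_pair' (X := ℝ × Vd d) (m := fun q => m q.1)
    (f := fun q x => f q.1 (x + pj (c q.1 • q.2))) ?_ (hm.comp continuous_fst)
  have h1 : Continuous (fun q : (ℝ × Vd d) × Td d => (q.1.1, q.2 + pj (c q.1.1 • q.1.2))) := by
    refine Continuous.prodMk (by fun_prop) (continuous_snd.add (continuous_pj.comp ?_))
    exact (hc.comp (by fun_prop)).smul (by fun_prop)
  exact hf.comp h1

lemma cont_cv {m : ℝ → PTd d} (hm : Continuous m) (κ : ProbabilityMeasure (Vd d))
    {c : ℝ → ℝ} (hc : Continuous c) : Continuous (fun s => cv (m s) κ (c s)) := by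
  rw [← continuousOn_univ]
  refine cont_of_pair fun f hf => ?_
  rw [continuousOn_univ]
  have e1 : ∀ s, ∫ y, f y ∂(cv (m s) κ (c s) : Measure (Td d)) = _ := fun s => ig_cv (m s) κ (c s) hf
  simp_rw [e1]
  have h1 := shift_cont (f := fun _ => f) (hf.comp continuous_snd) hm hc
  obtain ⟨C, hC⟩ := isCompact_univ.exists_bound_of_continuousOn hf.continuousOn
  refine continuous_of_dominated (bound := fun _ => C) (fun s => ?_) (fun s => ?_) (integrable_const C) ?_
  · exact (h1.comp (by fun_prop : Continuous fun y : Vd d => (s, y))).aestronglyMeasurable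
  · exact Eventually.of_forall fun y => abs_ig_le _ fun x => hC _ trivial
  · exact Eventually.of_forall fun y => h1.comp (by fun_prop : Continuous fun s : ℝ => (s, y))

lemma act_cv0 (S : MFGSetting d) {m : ℝ → PTd d} {a b C : ℝ} (hab : a ≤ b)
    (hm : Continuous m) (h : Act S m a b C) (κ : ProbabilityMeasure (Vd d)) {A E c₀ c₁ : ℝ} (hA : 0 < A)
    (hH : ∀ᵐ y ∂(κ : Measure (Vd d)), ∀ s ∈ Icc a b, ∀ x p, A * S.H x (A⁻¹ • p) ≤
      S.H (x + (c₀ + c₁ * s) • y) p + dotp (c₁ • y) p + E) :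
    Act S (fun s => cv (m s) κ (c₀ + c₁ * s)) a b (A * C + E * (b - a)) := by
  intro φ hφ
  have hL := LL_cont S hφ
  have hLs : ∀ s, Continuous (LL S φ s) := fun s => hL.comp (by fun_prop : Continuous fun y => (s, y))
  set c : ℝ → ℝ := fun s => c₀ + c₁ * s with hc
  have hcc : Continuous c := by fun_prop
  have hj := shift_cont hL hm hcc
  obtain ⟨B, hB⟩ := (isCompact_Icc (a := a) (b := b)).prod (isCompact_univ (X := Td d))
    |>.exists_bound_of_continuousOn hL.continuousOn
  have hjb : ∀ s ∈ Icc a b, ∀ y, |ig (m s) (fun x => LL S φ s (x + pj (c s • y)))| ≤ B :=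
    fun s hs y => abs_ig_le _ fun x => hB (s, x + pj (c s • y)) ⟨hs, trivial⟩
  have e1 : ∫ s in a..b, ig (cv (m s) κ (c s)) (LL S φ s) =
      ∫ y, (∫ s in a..b, ig (m s) (fun x => LL S φ s (x + pj (c s • y)))) ∂(κ : Measure (Vd d)) := by
    simp_rw [ig_cv _ κ _ (hLs _), intervalIntegral.integral_of_le hab]
    refine integral_integral_swap ?_
    refine Integrable.of_bound (C := B) hj.aestronglyMeasurable ?_
    have : ∀ᵐ q ∂((volume.restrict (Ioc a b)).prod (κ : Measure (Vd d))), q.1 ∈ Ioc a b :=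
      Measure.quasiMeasurePreserving_fst.ae (ae_restrict_mem measurableSet_Ioc)
    filter_upwards [this] with q hq
    exact hjb q.1 (Ioc_subset_Icc_self hq) q.2
  have hbi : ∀ s, Integrable (fun y => ig (m s) (fun x => φ s (secT (x + pj (c s • y)))))
      (κ : Measure (Vd d)) := by
    intro s
    have h1 := shift_cont (f := fun s y => φ s (secT y)) (test_contT hφ) hm hcc
    obtain ⟨B, hB⟩ := isCompact_univ.exists_bound_of_continuousOn (test_contT' hφ s).continuousOn
    refine Integrable.of_bound (C := B) (h1.comp (by fun_prop : Continuous fun y : Vd d => (s, y))).aestronglyMeasurable ?_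
    exact Eventually.of_forall fun y => abs_ig_le _ fun x => hB _ trivial
  have hii : Integrable (fun y => ∫ s in a..b, ig (m s) (fun x => LL S φ s (x + pj (c s • y))))
      (κ : Measure (Vd d)) := by
    refine Integrable.of_bound (C := B * |b - a|) ?_ (Eventually.of_forall fun y => ?_)
    · refine Continuous.aestronglyMeasurable ?_
      have : Continuous (fun q : Vd d × ℝ => ig (m q.2) (fun x => LL S φ q.2 (x + pj (c q.2 • q.1)))) :=
        hj.comp (by fun_prop : Continuous fun q : Vd d × ℝ => (q.2, q.1))
      exact intervalIntegral.continuous_parametric_intervalIntegral_of_continuous' this a b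
    · refine intervalIntegral.norm_integral_le_of_norm_le_const fun s hs => ?_
      rw [uIoc_of_le hab] at hs
      exact hjb s (Ioc_subset_Icc_self hs) y
  have e2 := ig_cv (m a) κ (c a) (test_contT' hφ a)
  have e3 := ig_cv (m b) κ (c b) (test_contT' hφ b)
  change (∫ s in a..b, ig (cv (m s) κ (c s)) (LL S φ s)) + ig (cv (m a) κ (c a)) _
    - ig (cv (m b) κ (c b)) _ ≤ _
  have hsum : Integrable (fun y => (∫ s in a..b, ig (m s) (fun x => LL S φ s (x + pj (c s • y))))
      + ig (m a) (fun x => φ a (secT (x + pj (c a • y))))) (κ : Measure (Vd d)) := hii.add (hbi a)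
  rw [e1, e2, e3, ← integral_add hii (hbi a), ← integral_sub hsum (hbi b)]
  have hfin : ∀ᵐ y ∂(κ : Measure (Vd d)),
      ((∫ s in a..b, ig (m s) (fun x => LL S φ s (x + pj (c s • y))))
      + ig (m a) (fun x => φ a (secT (x + pj (c a • y))))) -
      ig (m b) (fun x => φ b (secT (x + pj (c b • y)))) ≤ A * C + E * (b - a) := by
    filter_upwards [hH] with y hy
    have hψ := test_tsh hφ A⁻¹ 0 c₀ c₁ y
    have h1 := mul_le_mul_of_nonneg_left (h _ hψ) hA.le
    have hψv : ∀ s (x : Td d), φ s (secT (x + pj (c s • y))) = A * tsh φ A⁻¹ 0 c₀ c₁ y s (secT x) := by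
      intro s x
      rw [(hφ.per s).sec_add, tsh, ← mul_assoc, mul_inv_cancel₀ hA.ne', add_zero, one_mul]
    simp_rw [hψv]
    rw [ig_smul, ig_smul]
    have hLψ := LL_cont S hψ
    have hpt : ∀ s ∈ Icc a b, ∀ x : Td d, LL S φ s (x + pj (c s • y)) ≤
        A * LL S (tsh φ A⁻¹ 0 c₀ c₁ y) s x + E := by
      intro s hs x
      have e4 : LL S φ s (x + pj (c s • y)) = LLv S φ s (secT x + c s • y) := (LLv_per S hφ s).sec_add _ _
      rw [e4]
      unfold LL
      rw [LL_tsh S hφ]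
      simp only [add_zero]
      have h3 := hy s hs (secT x) (gradv (φ s) (secT x + c s • y))
      have e5 : dotp (c₁ • y) (gradv (φ s) (secT x + c s • y)) =
          c₁ * dotp y (gradv (φ s) (secT x + c s • y)) := by
        simp only [dotp, Finset.mul_sum, Pi.smul_apply, smul_eq_mul, mul_assoc]
      rw [e5] at h3
      unfold LLv
      have e6 : A * (A⁻¹ * (tderiv φ s (secT x + c s • y) + c₁ * dotp y (gradv (φ s) (secT x + c s • y)) +
        lapl (φ s) (secT x + c s • y))) = tderiv φ s (secT x + c s • y) + c₁ * dotp y (gradv (φ s) (secT x + c s • y)) +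
        lapl (φ s) (secT x + c s • y) := by rw [← mul_assoc, mul_inv_cancel₀ hA.ne', one_mul]
      simp only [hc] at h3 e6 ⊢
      rw [mul_sub, e6]
      linarith
    have h2 : ∫ s in a..b, ig (m s) (fun x => LL S φ s (x + pj (c s • y))) ≤
        ∫ s in a..b, (A * ig (m s) (LL S (tsh φ A⁻¹ 0 c₀ c₁ y) s) + E) := by
      refine intervalIntegral.integral_mono_on hab
        ((hj.comp (by fun_prop : Continuous fun s : ℝ => (s, y))).intervalIntegrable _ _)
        (((LL_ii S hab hm.continuousOn hψ).const_mul A).add intervalIntegrable_const) fun s hs => ?_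
      have hc1 : Continuous (LL S (tsh φ A⁻¹ 0 c₀ c₁ y) s) :=
        hLψ.comp (by fun_prop : Continuous fun x => (s, x))
      have h4 := ig_mono (m s) (f := fun x => LL S φ s (x + pj (c s • y)))
        (g := fun x => A * LL S (tsh φ A⁻¹ 0 c₀ c₁ y) s x + E)
        ((hLs s).comp (by fun_prop)) ((continuous_const.mul hc1).add continuous_const) (hpt s hs)
      refine h4.trans (le_of_eq ?_)
      rw [ig_add (m s) (f := fun x => A * LL S (tsh φ A⁻¹ 0 c₀ c₁ y) s x) (g := fun _ => E) (continuous_const.mul hc1) continuous_const, ig_smul]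
      simp [ig]
    rw [intervalIntegral.integral_add ((LL_ii S hab hm.continuousOn hψ).const_mul A) intervalIntegrable_const,
      intervalIntegral.integral_const_mul, intervalIntegral.integral_const, smul_eq_mul] at h2
    linarith
  have := integral_mono_ae (hsum.sub (hbi b)) (integrable_const (A * C + E * (b - a))) hfin
  simpa using this

lemma act_cv (S : MFGSetting d) {m : ℝ → PTd d} {a b C : ℝ} (hab : a ≤ b)
    (hm : ContinuousOn m (Icc a b)) (h : Act S m a b C) (κ : ProbabilityMeasure (Vd d)) {A E c₀ c₁ : ℝ}
    (hA : 0 < A)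
    (hH : ∀ᵐ y ∂(κ : Measure (Vd d)), ∀ s ∈ Icc a b, ∀ x p, A * S.H x (A⁻¹ • p) ≤
      S.H (x + (c₀ + c₁ * s) • y) p + dotp (c₁ • y) p + E) :
    ContinuousOn (fun s => cv (m s) κ (c₀ + c₁ * s)) (Icc a b) ∧
    Act S (fun s => cv (m s) κ (c₀ + c₁ * s)) a b (A * C + E * (b - a)) := by
  set m' : ℝ → PTd d := fun s => m (projIcc a b hab s)
  have hm' : Continuous m' := continuousOn_iff_continuous_domRestrict.1 hm |>.comp continuous_projIcc
  have e : ∀ s ∈ Icc a b, m' s = m s := fun s hs => by simp only [m', projIcc_of_mem hab hs]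
  refine ⟨((cont_cv hm' κ (c := fun s => c₀ + c₁ * s) (by fun_prop)).continuousOn).congr
    fun s hs => by simp only [e s hs], ?_⟩
  exact (act_cv0 S hab hm' (h.congr hab e) κ hA hH).congr hab fun s hs => by simp only [e s hs]


def gz (z : Vd d) : ℝ := exp (-(sqnorm z) / 2)

lemma gz_pos (z : Vd d) : 0 < gz z := exp_pos _

lemma gz_cd : ContDiff ℝ 2 (gz : Vd d → ℝ) := by unfold gz sqnorm; fun_prop

lemma gz_int0 {b : ℝ} (hb : 0 < b) : Integrable (fun z : Vd d => exp (-b * sqnorm z)) := by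
  have : (fun z : Vd d => exp (-b * sqnorm z)) = fun z => ∏ i, exp (-b * (z i) ^ 2) := by
    funext z; rw [← Real.exp_sum, sqnorm, Finset.mul_sum]
  rw [this]
  exact Integrable.fintype_prod (f := fun _ x => exp (-b * x ^ 2)) fun i => integrable_exp_neg_mul_sq hb

lemma gz_int : Integrable (gz : Vd d → ℝ) := by
  have := gz_int0 (d := d) (b := 1 / 2) (by norm_num)
  refine this.congr (Eventually.of_forall fun z => ?_)
  simp only [gz]; ring_nf

lemma gz_int1 : Integrable (fun z : Vd d => ‖z‖ * gz z) := by
  refine (gz_int0 (d := d) (b := 1 / 4) (by norm_num)).mono'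
    (by have := (gz_cd (d := d)).continuous; fun_prop) (Eventually.of_forall fun z => ?_)
  rw [norm_mul, norm_norm, Real.norm_of_nonneg (gz_pos z).le]
  have h1 : ‖z‖ ≤ exp (sqnorm z / 4) := by
    have := norm_sq_le_sqnorm z
    have := add_one_le_exp (sqnorm z / 4)
    nlinarith [sq_nonneg (1 - ‖z‖ / 2)]
  calc ‖z‖ * gz z ≤ exp (sqnorm z / 4) * gz z := mul_le_mul_of_nonneg_right h1 (gz_pos z).le
    _ = _ := by rw [gz, ← Real.exp_add]; ring_nf

lemma gz_fd (z : Vd d) (i : Fin d) : fderiv ℝ gz z (Pi.single i 1) = - z i * gz z := by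
  have h1 : HasFDerivAt (fun z : Vd d => -(sqnorm z) / 2)
      ((2:ℝ)⁻¹ • -(∑ j, (2 * z j) • ContinuousLinearMap.proj (R := ℝ) (φ := fun _ : Fin d => ℝ) j)) z := by
    have : ∀ j ∈ (Finset.univ : Finset (Fin d)), HasFDerivAt (fun z : Vd d => (z j) ^ 2)
        ((2 * z j) • ContinuousLinearMap.proj (R := ℝ) (φ := fun _ : Fin d => ℝ) j) z := by
      intro j _
      have := (hasFDerivAt_apply (𝕜 := ℝ) j z).pow 2
      simpa using this
    have := ((HasFDerivAt.fun_sum this).neg).const_smul (2:ℝ)⁻¹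
    refine this.congr_of_eventuallyEq (Eventually.of_forall fun z => ?_)
    simp [sqnorm]; ring
  have h2 := h1.exp
  have : fderiv ℝ gz z = _ := h2.fderiv
  rw [this]
  simp [Pi.single_apply, gz]
  ring

lemma stein {ψ : Vd d → ℝ} (hψ : ContDiff ℝ 1 ψ) {B : ℝ} (i : Fin d) (h0 : ∀ z, |ψ z| ≤ B)
    (h1 : ∀ z, |fderiv ℝ ψ z (Pi.single i 1)| ≤ B) :
    ∫ z, z i * ψ z * gz z = ∫ z, fderiv ℝ ψ z (Pi.single i 1) * gz z := by
  have hB : 0 ≤ B := (abs_nonneg _).trans (h0 0)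
  have hgc := (gz_cd (d := d)).continuous
  have hψc := hψ.continuous
  have hdc : Continuous (fun z => fderiv ℝ ψ z (Pi.single i 1)) :=
    (hψ.continuous_fderiv (by norm_num)).clm_apply continuous_const
  have hgz : ∀ z : Vd d, |gz z| = gz z := fun z => abs_of_pos (gz_pos z)
  have := integral_mul_fderiv_eq_neg_fderiv_mul_of_integrable (μ := (volume : Measure (Vd d)))
    (f := ψ) (g := gz) (v := Pi.single i 1) ?_ ?_ ?_
    (fun x _ => hψ.differentiable (by norm_num) x) (fun x _ => gz_cd.differentiable (by norm_num) x)
  · rw [← neg_eq_iff_eq_neg, ← integral_neg] at this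
    rw [← this]
    refine integral_congr_ae (Eventually.of_forall fun z => ?_)
    simp only [gz_fd]; ring
  · refine (gz_int.const_mul B).mono' (by fun_prop) (Eventually.of_forall fun z => ?_)
    rw [Real.norm_eq_abs, abs_mul, hgz]
    exact mul_le_mul_of_nonneg_right (h1 z) (gz_pos z).le
  · simp_rw [gz_fd]
    refine (gz_int1.const_mul B).mono' (by fun_prop) (Eventually.of_forall fun z => ?_)
    rw [Real.norm_eq_abs, abs_mul, abs_mul, hgz, abs_neg]
    exact mul_le_mul (h0 z) (mul_le_mul_of_nonneg_right (norm_le_pi_norm z i) (gz_pos z).le)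
      (mul_nonneg (abs_nonneg _) (gz_pos z).le) hB
  · refine (gz_int.const_mul B).mono' (by fun_prop) (Eventually.of_forall fun z => ?_)
    rw [Real.norm_eq_abs, abs_mul, hgz]
    exact mul_le_mul_of_nonneg_right (h0 z) (gz_pos z).le

lemma per2_bdd {f : ℝ → Vd d → ℝ} (hp : ∀ s, Per (f s))
    (hc : Continuous (fun q : ℝ × Vd d => f q.1 q.2)) (T : ℝ) :
    ∃ B, ∀ s ∈ Icc (-T) T, ∀ x, |f s x| ≤ B := by
  obtain ⟨B, hB⟩ := ((isCompact_Icc (a := -T) (b := T)).prod (isCompact_univ (X := Td d))).exists_bound_of_continuousOn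
    (Per.cont2 hp hc).continuousOn
  refine ⟨B, fun s hs x => ?_⟩
  rw [← (hp s).sec x]
  exact hB (s, pj x) ⟨hs, trivial⟩

lemma dotp_abs_le (v p : Vd d) : |dotp v p| ≤ d * (‖v‖ * ‖p‖) := by
  unfold dotp
  refine (Finset.abs_sum_le_sum_abs _ _).trans ?_
  have : ∀ i ∈ (Finset.univ : Finset (Fin d)), |v i * p i| ≤ ‖v‖ * ‖p‖ := fun i _ => by
    rw [abs_mul]
    exact mul_le_mul (norm_le_pi_norm v i) (norm_le_pi_norm p i) (abs_nonneg _) (norm_nonneg _)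
  simpa using Finset.sum_le_card_nsmul _ _ _ this

/-- pointwise heat identity -/
lemma heat_pt {φ : ℝ → Vd d → ℝ} (H : IsTestFun φ) (x : Vd d) (c : ℝ) :
    HasDerivAt (fun c : ℝ => ∫ z, φ (c ^ 2 / 2) (x + c • z) * gz z)
      (c * ∫ z, (tderiv φ (c ^ 2 / 2) (x + c • z) + lapl (φ (c ^ 2 / 2)) (x + c • z)) * gz z) c := by
  set T : ℝ := (|c| + 1) ^ 2 with hT
  obtain ⟨B0, hB0⟩ := per2_bdd H.per H.cont T
  obtain ⟨B1, hB1⟩ := per2_bdd (tderiv_per H) H.cont_td T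
  have hgp : ∀ i s, Per (fun x => gradv (φ s) x i) := fun i s x z => congrFun (gradv_per (H.per s) x z) i
  have hgc : ∀ i, Continuous (fun q : ℝ × Vd d => gradv (φ q.1) q.2 i) := fun i =>
    (continuous_apply i).comp H.cont_grad
  have hgb : ∃ B, 0 ≤ B ∧ ∀ s ∈ Icc (-T) T, ∀ x, ‖gradv (φ s) x‖ ≤ B := by
    choose B hB using fun i => per2_bdd (f := fun s x => gradv (φ s) x i) (hgp i) (hgc i) T
    refine ⟨∑ i, |B i|, Finset.sum_nonneg fun _ _ => abs_nonneg _, fun s hs x => ?_⟩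
    rw [pi_norm_le_iff_of_nonneg (Finset.sum_nonneg fun _ _ => abs_nonneg _)]
    intro i
    exact (hB i s hs x).trans ((le_abs_self _).trans
      (Finset.single_le_sum (f := fun i => |B i|) (fun _ _ => abs_nonneg _) (Finset.mem_univ i)))
  obtain ⟨B2, hB2p, hB2⟩ := hgb
  have hmem : ∀ e ∈ Metric.ball c 1, e ^ 2 / 2 ∈ Icc (-T) T ∧ |e| ≤ |c| + 1 := by
    intro e he
    rw [Metric.mem_ball, Real.dist_eq] at he
    have h1 : |e| ≤ |c| + 1 := by
      have := abs_add_le (e - c) c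
      rw [sub_add_cancel] at this; linarith
    refine ⟨⟨by nlinarith [sq_nonneg e, sq_nonneg (|c| + 1)], ?_⟩, h1⟩
    rw [hT, ← sq_abs e]
    have := abs_nonneg e
    nlinarith
  have hcm := hmem c (Metric.mem_ball_self one_pos)
  have hgzc := (gz_cd (d := d)).continuous
  have hpath : ∀ e : ℝ, Continuous (fun z : Vd d => ((e ^ 2 / 2, x + e • z) : ℝ × Vd d)) := fun e => by fun_prop
  have hder : ∀ z e, HasDerivAt (fun c : ℝ => φ (c ^ 2 / 2) (x + c • z) * gz z)
      ((e * tderiv φ (e ^ 2 / 2) (x + e • z) + dotp z (gradv (φ (e ^ 2 / 2)) (x + e • z))) * gz z) e := by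
    intro z e
    refine HasDerivAt.mul_const ?_ _
    have h1 : HasDerivAt (fun s : ℝ => ((s ^ 2 / 2, x + s • z) : ℝ × Vd d)) (e, z) e := by
      refine HasDerivAt.prodMk ?_ ?_
      · exact ((hasDerivAt_pow 2 e).div_const 2).congr_deriv (by norm_num)
      · exact (((hasDerivAt_id e).smul_const z).const_add x).congr_deriv (by simp)
    refine ((H.diff (e ^ 2 / 2, x + e • z)).hasFDerivAt.comp_hasDerivAt e h1).congr_deriv ?_
    have h4 : ((e, z) : ℝ × Vd d) = e • (1, (0 : Vd d)) + (0, z) := by simp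
    rw [h4, map_add, map_smul, ← H.tderiv_eq, ← H.fd, clm_dot (fderiv ℝ (φ (e ^ 2 / 2)) (x + e • z))]
    rfl
  have key := hasDerivAt_integral_of_dominated_loc_of_deriv_le (μ := (volume : Measure (Vd d)))
    (F := fun c z => φ (c ^ 2 / 2) (x + c • z) * gz z)
    (F' := fun e z => (e * tderiv φ (e ^ 2 / 2) (x + e • z)
      + dotp z (gradv (φ (e ^ 2 / 2)) (x + e • z))) * gz z) (x₀ := c)
    (bound := fun z => (|c| + 1) * B1 * gz z + d * B2 * (‖z‖ * gz z))
    (Metric.ball_mem_nhds c one_pos)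
    (Eventually.of_forall fun e => ((H.cont.comp (hpath e)).mul hgzc).aestronglyMeasurable)
    ((gz_int.const_mul B0).mono' ((H.cont.comp (hpath c)).mul hgzc).aestronglyMeasurable
      (Eventually.of_forall fun z => by
        rw [Real.norm_eq_abs, abs_mul, abs_of_pos (gz_pos z)]
        exact mul_le_mul_of_nonneg_right (hB0 _ hcm.1 _) (gz_pos z).le))
    ?_ ?_ ((gz_int.const_mul _).add (gz_int1.const_mul _))
    (Eventually.of_forall fun z e _ => hder z e)
  · refine key.2.congr_deriv ?_
    have i1 : Integrable (fun z => c * (tderiv φ (c ^ 2 / 2) (x + c • z) * gz z)) := by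
      refine Integrable.const_mul ((gz_int.const_mul B1).mono'
        ((H.cont_td.comp (hpath c)).mul hgzc).aestronglyMeasurable (Eventually.of_forall fun z => ?_)) c
      rw [Real.norm_eq_abs, Pi.mul_apply, abs_mul, abs_of_pos (gz_pos z)]
      exact mul_le_mul_of_nonneg_right (hB1 _ hcm.1 _) (gz_pos z).le
    have hsm : ∀ i : Fin d, ContDiff ℝ 1 (fun z => gradv (φ (c ^ 2 / 2)) (x + c • z) i) := by
      intro i
      have : (fun z => gradv (φ (c ^ 2 / 2)) (x + c • z) i) =
        (fun q => fderiv ℝ (unc φ) q (0, Pi.single i 1)) ∘ fun z => (c ^ 2 / 2, x + c • z) :=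
        funext fun z => H.fd _ _ _
      rw [this]
      exact (H.cd1 _).comp (by fun_prop)
    have hfd : ∀ (i : Fin d) (z : Vd d), fderiv ℝ (fun z => gradv (φ (c ^ 2 / 2)) (x + c • z) i) z (Pi.single i 1)
        = c * D2 (φ (c ^ 2 / 2)) (x + c • z) (Pi.single i 1) (Pi.single i 1) := by
      intro i z
      have h1 : ContDiff ℝ 1 (fun y => fderiv ℝ (φ (c ^ 2 / 2)) y (Pi.single i 1)) :=
        ((H.cx _).fderiv_right (m := 1) (by norm_num)).clm_apply contDiff_const
      have h2 : HasFDerivAt (fun z : Vd d => x + c • z) (c • ContinuousLinearMap.id ℝ (Vd d)) z :=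
        ((hasFDerivAt_id z).const_smul c).const_add x
      have h3 := (h1.differentiable (by norm_num) (x + c • z)).hasFDerivAt.comp z h2
      have h4 : fderiv ℝ (fun z => gradv (φ (c ^ 2 / 2)) (x + c • z) i) z = _ := h3.fderiv
      rw [h4]
      simp [D2]
    have hDc : ∀ i : Fin d, Continuous (fun q : ℝ × Vd d => D2 (φ q.1) q.2 (Pi.single i 1) (Pi.single i 1)) := by
      intro i
      have : (fun q : ℝ × Vd d => D2 (φ q.1) q.2 (Pi.single i 1) (Pi.single i 1)) =
        fun q => fderiv ℝ (fun q => fderiv ℝ (unc φ) q (0, Pi.single i 1)) q (0, Pi.single i 1) :=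
        funext (fun q => H.D2_eq q.1 q.2 _ _)
      rw [this]
      exact (((H.cd1 _).fderiv_right (m := 0) (by norm_num)).clm_apply contDiff_const).continuous
    have hDb : ∀ i : Fin d, ∃ B, ∀ z, |D2 (φ (c ^ 2 / 2)) (x + c • z) (Pi.single i 1) (Pi.single i 1)| ≤ B := by
      intro i
      obtain ⟨B, hB⟩ := per2_bdd (f := fun s x => D2 (φ s) x (Pi.single i 1) (Pi.single i 1))
        (fun s => fderiv_per (fderiv_per (H.per s) _) _) (hDc i) T
      exact ⟨B, fun z => hB _ hcm.1 _⟩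
    have hst : ∀ i : Fin d, ∫ z, z i * gradv (φ (c ^ 2 / 2)) (x + c • z) i * gz z =
        ∫ z, c * (D2 (φ (c ^ 2 / 2)) (x + c • z) (Pi.single i 1) (Pi.single i 1) * gz z) := by
      intro i
      obtain ⟨B, hB⟩ := hDb i
      have := stein (hsm i) (B := max B2 (|c| * B)) i (fun z => le_max_of_le_left
        ((norm_le_pi_norm _ i).trans (hB2 _ hcm.1 _))) (fun z => by
          rw [hfd, abs_mul]
          exact le_max_of_le_right (mul_le_mul_of_nonneg_left (hB z) (abs_nonneg _)))
      rw [this]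
      refine integral_congr_ae (Eventually.of_forall fun z => ?_)
      simp only [hfd, mul_assoc]
    have i2 : ∀ i ∈ (Finset.univ : Finset (Fin d)), Integrable (fun z => z i * gradv (φ (c ^ 2 / 2)) (x + c • z) i * gz z) := by
      intro i _
      have : Continuous (fun z : Vd d => gradv (φ (c ^ 2 / 2)) (x + c • z) i) := (hsm i).continuous
      refine (gz_int1.const_mul B2).mono' (by fun_prop) (Eventually.of_forall fun z => ?_)
      rw [Real.norm_eq_abs, abs_mul, abs_mul, abs_of_pos (gz_pos z)]
      have h1 : |z i| ≤ ‖z‖ := norm_le_pi_norm z i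
      have h2 : |gradv (φ (c ^ 2 / 2)) (x + c • z) i| ≤ B2 := (norm_le_pi_norm _ i).trans (hB2 _ hcm.1 _)
      have h3 := gz_pos z
      calc _ ≤ ‖z‖ * B2 * gz z := by gcongr
        _ = _ := by ring
    have i3 : ∀ i ∈ (Finset.univ : Finset (Fin d)), Integrable (fun z => c * (D2 (φ (c ^ 2 / 2)) (x + c • z) (Pi.single i 1) (Pi.single i 1) * gz z)) := by
      intro i _
      obtain ⟨B, hB⟩ := hDb i
      refine Integrable.const_mul ((gz_int.const_mul B).mono' (((hDc i).comp (hpath c)).mul hgzc).aestronglyMeasurable (Eventually.of_forall fun z => ?_)) c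
      rw [Real.norm_eq_abs, Pi.mul_apply, abs_mul, abs_of_pos (gz_pos z)]
      exact mul_le_mul_of_nonneg_right (hB _) (gz_pos z).le
    have e1 : ∀ z, (c * tderiv φ (c ^ 2 / 2) (x + c • z) + dotp z (gradv (φ (c ^ 2 / 2)) (x + c • z))) * gz z =
        c * (tderiv φ (c ^ 2 / 2) (x + c • z) * gz z) + ∑ i, z i * gradv (φ (c ^ 2 / 2)) (x + c • z) i * gz z := by
      intro z; rw [← Finset.sum_mul, dotp]; ring
    have e2 : ∀ z, c * ((tderiv φ (c ^ 2 / 2) (x + c • z) + lapl (φ (c ^ 2 / 2)) (x + c • z)) * gz z) =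
        c * (tderiv φ (c ^ 2 / 2) (x + c • z) * gz z) + ∑ i, c * (D2 (φ (c ^ 2 / 2)) (x + c • z) (Pi.single i 1) (Pi.single i 1) * gz z) := by
      intro z; rw [← Finset.mul_sum, ← Finset.sum_mul, lapl]; ring
    simp_rw [e1]
    rw [← integral_const_mul]
    simp_rw [e2]
    rw [integral_add i1 (integrable_finsetSum _ i2), integral_add i1 (integrable_finsetSum _ i3),
      integral_finsetSum _ i2, integral_finsetSum _ i3]
    simp_rw [hst]
  · refine Continuous.aestronglyMeasurable ?_
    have h1 := H.cont_td.comp (hpath c)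
    have h2 := H.cont_grad.comp (hpath c)
    refine ((continuous_const.mul h1).add ?_).mul hgzc
    exact continuous_finsetSum _ fun i _ => (continuous_apply i).mul ((continuous_apply i).comp h2)
  · refine Eventually.of_forall fun z e he => ?_
    obtain ⟨h1, h2⟩ := hmem e he
    rw [Real.norm_eq_abs, abs_mul, abs_of_pos (gz_pos z)]
    have h3 := gz_pos z
    have h4 : |e * tderiv φ (e ^ 2 / 2) (x + e • z)| ≤ (|c| + 1) * B1 := by
      rw [abs_mul]
      exact mul_le_mul h2 (hB1 _ h1 _) (abs_nonneg _) (by positivity)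
    have h5 : |dotp z (gradv (φ (e ^ 2 / 2)) (x + e • z))| ≤ d * (‖z‖ * B2) :=
      (dotp_abs_le _ _).trans (by have := hB2 _ h1 (x + e • z); gcongr)
    calc _ ≤ ((|c| + 1) * B1 + d * (‖z‖ * B2)) * gz z :=
          mul_le_mul_of_nonneg_right ((abs_add_le _ _).trans (add_le_add h4 h5)) h3.le
      _ = _ := by ring


def Zg (d : ℕ) : ℝ := ∫ z : Vd d, gz z

lemma Zg_pos (d : ℕ) : 0 < Zg d := by
  unfold Zg
  refine (integral_pos_iff_support_of_nonneg (fun z => (gz_pos z).le) gz_int).2 ?_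
  have : Function.support (gz : Vd d → ℝ) = univ := by
    ext z; simp [(gz_pos z).ne']
  rw [this]; exact Measure.measure_univ_pos.2 (NeZero.ne _)

def dens (k : Vd d → ℝ) (_hk : Continuous k) (h0 : ∀ z, 0 ≤ k z) (hi : Integrable k)
    (hp : 0 < ∫ z, k z) : ProbabilityMeasure (Vd d) :=
  ⟨volume.withDensity fun z => ENNReal.ofReal ((∫ z, k z)⁻¹ * k z), ⟨by
    rw [withDensity_apply _ MeasurableSet.univ, Measure.restrict_univ,
      ← ofReal_integral_eq_lintegral_ofReal (hi.const_mul _)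
        (Eventually.of_forall fun z => mul_nonneg (inv_nonneg.2 hp.le) (h0 z)),
      integral_const_mul, inv_mul_cancel₀ hp.ne', ENNReal.ofReal_one]⟩⟩

lemma dens_int {k : Vd d → ℝ} (hk : Continuous k) (h0 : ∀ z, 0 ≤ k z) (hi : Integrable k)
    (hp : 0 < ∫ z, k z) (f : Vd d → ℝ) :
    ∫ z, f z ∂(dens k hk h0 hi hp : Measure (Vd d)) = (∫ z, k z)⁻¹ * ∫ z, f z * k z := by
  have h1 : (dens k hk h0 hi hp : Measure (Vd d)) =
    volume.withDensity fun z => ENNReal.ofReal ((∫ z, k z)⁻¹ * k z) := rfl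
  rw [h1, integral_withDensity_eq_integral_toReal_smul (by fun_prop) (by simp), ← integral_const_mul]
  refine integral_congr_ae (Eventually.of_forall fun z => ?_)
  simp only [smul_eq_mul]
  rw [ENNReal.toReal_ofReal (mul_nonneg (inv_nonneg.2 hp.le) (h0 z))]; ring

def gam (d : ℕ) : ProbabilityMeasure (Vd d) :=
  dens gz gz_cd.continuous (fun z => (gz_pos z).le) gz_int (Zg_pos d)

lemma gam_int (f : Vd d → ℝ) : ∫ z, f z ∂(gam d : Measure (Vd d)) = (Zg d)⁻¹ * ∫ z, f z * gz z :=
  dens_int _ _ _ _ f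

def heat (μ : PTd d) (s : ℝ) : PTd d := cv μ (gam d) (√(2 * s))

lemma heat_zero (μ : PTd d) : heat μ 0 = μ := by simp [heat, cv_zero]

lemma heat_cont (μ : PTd d) : Continuous (heat μ) :=
  cont_cv (m := fun _ => μ) continuous_const _ (by fun_prop)

lemma heat_fp (μ : PTd d) {φ : ℝ → Vd d → ℝ} (H : IsTestFun φ) {T : ℝ} (hT : 0 ≤ T) :
    ∫ s in (0:ℝ)..T, ig (heat μ s) (fun y => tderiv φ s (secT y) + lapl (φ s) (secT y)) =
      ig (heat μ T) (fun y => φ T (secT y)) - ig μ (fun y => φ 0 (secT y)) := by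
  set f : ℝ → Vd d → ℝ := fun s x => tderiv φ s x + lapl (φ s) x with hf
  have hfp : ∀ s, Per (f s) := fun s x z => by simp only [hf, tderiv_per H s x z, lapl_per (H.per s) x z]
  have hfc : Continuous (fun q : ℝ × Vd d => f q.1 q.2) := H.cont_td.add H.cont_lapl
  have hfT : Continuous (fun q : ℝ × Td d => f q.1 (secT q.2)) := Per.cont2 hfp hfc
  have hfs : ∀ s, Continuous (fun y : Td d => f s (secT y)) := fun s =>
    hfT.comp (by fun_prop : Continuous fun y : Td d => (s, y))
  have hd : ∀ c, HasDerivAt (fun c : ℝ => ig (cv μ (gam d) c) (fun y => φ (c ^ 2 / 2) (secT y)))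
      (c * ig (cv μ (gam d) c) (fun y => f (c ^ 2 / 2) (secT y))) c := by
    intro c
    have e1 : ∀ c, ig (cv μ (gam d) c) (fun y => φ (c ^ 2 / 2) (secT y)) =
        ig μ (fun x => (Zg d)⁻¹ * ∫ z, φ (c ^ 2 / 2) (secT x + c • z) * gz z) := by
      intro c
      rw [ig_cv' _ _ _ (test_contT' H _)]
      refine congrArg _ (funext fun x => ?_)
      rw [gam_int]
      simp_rw [(H.per _).sec_add]
    have e2 : ∀ c, ig (cv μ (gam d) c) (fun y => f (c ^ 2 / 2) (secT y)) =
        ig μ (fun x => (Zg d)⁻¹ * ∫ z, f (c ^ 2 / 2) (secT x + c • z) * gz z) := by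
      intro c
      rw [ig_cv' _ _ _ (hfs _)]
      refine congrArg _ (funext fun x => ?_)
      rw [gam_int]
      simp_rw [(hfp _).sec_add]
    have m1 : ∀ c, Integrable (fun x => (Zg d)⁻¹ * ∫ z, φ (c ^ 2 / 2) (secT x + c • z) * gz z) (μ : Measure (Td d)) := by
      intro c
      refine ((cv_int μ (gam d) c (test_contT' H (c ^ 2 / 2))).integral_prod_left).congr
        (Eventually.of_forall fun x => ?_)
      simp only [gam_int, (H.per _).sec_add]
    have m2 : ∀ c, Integrable (fun x => (Zg d)⁻¹ * ∫ z, f (c ^ 2 / 2) (secT x + c • z) * gz z) (μ : Measure (Td d)) := by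
      intro c
      refine ((cv_int μ (gam d) c (hfs (c ^ 2 / 2))).integral_prod_left).congr
        (Eventually.of_forall fun x => ?_)
      simp only [gam_int, (hfp _).sec_add]
    simp_rw [e1]
    set T' : ℝ := (|c| + 1) ^ 2 with hT'
    obtain ⟨B, hB⟩ := per2_bdd hfp hfc T'
    have key := hasDerivAt_integral_of_dominated_loc_of_deriv_le (μ := (μ : Measure (Td d)))
      (F := fun c x => (Zg d)⁻¹ * ∫ z, φ (c ^ 2 / 2) (secT x + c • z) * gz z)
      (F' := fun c x => (Zg d)⁻¹ * (c * ∫ z, f (c ^ 2 / 2) (secT x + c • z) * gz z)) (x₀ := c)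
      (bound := fun _ => (|c| + 1) * B)
      (Metric.ball_mem_nhds c one_pos) (Eventually.of_forall fun e => (m1 e).1) (m1 c)
      (((m2 c).const_mul c).congr (Eventually.of_forall fun x => by ring)).1
      (Eventually.of_forall fun x e he => ?_) (integrable_const _)
      (Eventually.of_forall fun x e he => (heat_pt H (secT x) e).const_mul _)
    · refine key.2.congr_deriv ?_
      rw [e2, ← ig_smul]
      exact congrArg _ (funext fun x => by ring)
    · rw [Metric.mem_ball, Real.dist_eq] at he
      have h1 : |e| ≤ |c| + 1 := by
        have := abs_add_le (e - c) c
        rw [sub_add_cancel] at this; linarith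
      have h2 : e ^ 2 / 2 ∈ Icc (-T') T' := by
        refine ⟨by nlinarith [sq_nonneg e, sq_nonneg (|c| + 1)], ?_⟩
        rw [hT', ← sq_abs e]
        have := abs_nonneg e
        nlinarith
      have h3 : (Zg d)⁻¹ * (e * ∫ z, f (e ^ 2 / 2) (secT x + e • z) * gz z) =
        e * ∫ z, f (e ^ 2 / 2) (secT x + e • z) ∂(gam d : Measure (Vd d)) := by rw [gam_int]; ring
      rw [h3, Real.norm_eq_abs, abs_mul]
      have h4 := norm_integral_le_of_norm_le_const (μ := (gam d : Measure (Vd d)))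
        (f := fun z => f (e ^ 2 / 2) (secT x + e • z)) (C := B) (Eventually.of_forall fun z => hB _ h2 _)
      simp only [probReal_univ, mul_one, Real.norm_eq_abs] at h4
      exact mul_le_mul h1 h4 (abs_nonneg _) (by positivity)
  have hcc : Continuous (fun c : ℝ => c * ig (cv μ (gam d) c) (fun y => f (c ^ 2 / 2) (secT y))) := by
    refine continuous_id.mul (cont_pair' (f := fun c y => f (c ^ 2 / 2) (secT y)) ?_
      (cont_cv (m := fun _ => μ) continuous_const _ continuous_id))
    exact hfT.comp (by fun_prop : Continuous fun q : ℝ × Td d => (q.1 ^ 2 / 2, q.2))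
  have hF := intervalIntegral.integral_eq_sub_of_hasDerivAt (a := 0) (b := √(2 * T)) (fun c _ => hd c)
    (hcc.intervalIntegrable _ _)
  have hs : (√(2 * T)) ^ 2 / 2 = T := by rw [Real.sq_sqrt (by linarith)]; ring
  have hh : Continuous (fun s => ig (heat μ s) (fun y => f s (secT y))) :=
    cont_pair' (f := fun s y => f s (secT y)) hfT (heat_cont μ)
  have hsub := intervalIntegral.integral_comp_mul_deriv (a := 0) (b := √(2 * T)) (f := fun c : ℝ => c ^ 2 / 2)
    (f' := fun c => c) (g := fun s => ig (heat μ s) (fun y => f s (secT y)))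
    (fun c _ => ((hasDerivAt_pow 2 c).div_const 2).congr_deriv (by norm_num)) continuousOn_id hh
  have e0 : ((0:ℝ) ^ 2 / 2) = 0 := by norm_num
  simp only [hs, e0] at hsub hF
  rw [cv_zero] at hF
  rw [← hsub, heat, ← hF]
  refine intervalIntegral.integral_congr fun c hc => ?_
  rw [uIcc_of_le (Real.sqrt_nonneg _)] at hc
  have : √(2 * (c ^ 2 / 2)) = c := by rw [mul_div_cancel₀ _ (two_ne_zero), Real.sqrt_sq hc.1]
  simp only [Function.comp, heat, this]
  ring

lemma act_heat (S : MFGSetting d) : ∃ B, 0 ≤ B ∧ ∀ (μ : PTd d) (T : ℝ), 0 ≤ T →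
    Act S (heat μ) 0 T (B * T) := by
  obtain ⟨b, B, hb, hB, hH⟩ := S.H_growth
  refine ⟨B, hB, fun μ T hT φ hφ => ?_⟩
  have h1 := heat_fp μ hφ hT
  have hc1 : Continuous (fun q : ℝ × Td d => tderiv φ q.1 (secT q.2) + lapl (φ q.1) (secT q.2)) :=
    Per.cont2 (g := fun s x => tderiv φ s x + lapl (φ s) x)
      (fun s x z => by simp only [tderiv_per hφ s x z, lapl_per (hφ.per s) x z]) (hφ.cont_td.add hφ.cont_lapl)
  have hL := LL_cont S hφ
  have h2 : ∫ s in (0:ℝ)..T, ig (heat μ s) (LL S φ s) ≤ ∫ s in (0:ℝ)..T,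
      (ig (heat μ s) (fun y => tderiv φ s (secT y) + lapl (φ s) (secT y)) + B) := by
    refine intervalIntegral.integral_mono_on hT (LL_ii S hT (heat_cont μ).continuousOn hφ)
      (((cont_pair' (f := fun s y => tderiv φ s (secT y) + lapl (φ s) (secT y)) hc1 (heat_cont μ)).add
        continuous_const).intervalIntegrable _ _) fun s _ => ?_
    have hcs := hc1.comp (by fun_prop : Continuous fun y : Td d => (s, y))
    have := ig_mono (heat μ s) (f := LL S φ s)
      (g := fun y => (tderiv φ s (secT y) + lapl (φ s) (secT y)) + B)
      (hL.comp (by fun_prop : Continuous fun y : Td d => (s, y))) (hcs.add continuous_const) fun y => by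
        have h4 := (hH (secT y) (gradv (φ s) (secT y))).1
        have h5 := sqnorm_nonneg (gradv (φ s) (secT y))
        unfold LL LLv
        have := mul_nonneg hb.le h5
        linarith
    refine this.trans (le_of_eq ?_)
    rw [ig_add _ (f := fun y => tderiv φ s (secT y) + lapl (φ s) (secT y)) (g := fun _ => B) hcs continuous_const]
    simp [ig]
  have hii : IntervalIntegrable (fun s => ig (heat μ s) (fun y => tderiv φ s (secT y) + lapl (φ s) (secT y)))
      volume 0 T := (cont_pair' (f := fun s y => tderiv φ s (secT y) + lapl (φ s) (secT y)) hc1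
    (heat_cont μ)).intervalIntegrable _ _
  rw [intervalIntegral.integral_add hii intervalIntegrable_const, intervalIntegral.integral_const, smul_eq_mul, sub_zero, mul_comm T] at h2
  have h3 : heat μ 0 = μ := heat_zero μ
  rw [h3]
  change ∫ s in (0:ℝ)..T, ig (heat μ s) _ = _ at h1
  linarith [h1, h2]


def kap (K : Td d → ℝ) (hK : Continuous K) (h0 : ∀ z, 0 ≤ K z)
    (hp : 0 < ∫ z, K z) : ProbabilityMeasure (Vd d) :=
  ⟨(volume.withDensity fun z => ENNReal.ofReal ((∫ z, K z)⁻¹ * K z)).map lft, by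
    have : IsProbabilityMeasure (volume.withDensity fun z : Td d => ENNReal.ofReal ((∫ z, K z)⁻¹ * K z)) := ⟨by
      have hi : Integrable K := int_cont hK _
      rw [withDensity_apply _ MeasurableSet.univ, Measure.restrict_univ,
        ← ofReal_integral_eq_lintegral_ofReal (hi.const_mul _)
          (Eventually.of_forall fun z => mul_nonneg (inv_nonneg.2 hp.le) (h0 z)),
        integral_const_mul, inv_mul_cancel₀ hp.ne', ENNReal.ofReal_one]⟩
    exact Measure.isProbabilityMeasure_map measurable_lft.aemeasurable⟩

lemma kap_int {K : Td d → ℝ} (hK : Continuous K) (h0 : ∀ z, 0 ≤ K z)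
    (hp : 0 < ∫ z, K z) {f : Vd d → ℝ} (hf : Continuous f) :
    ∫ z, f z ∂(kap K hK h0 hp : Measure (Vd d)) = (∫ z, K z)⁻¹ * ∫ z, f (lft z) * K z := by
  have h1 : (kap K hK h0 hp : Measure (Vd d)) =
    (volume.withDensity fun z => ENNReal.ofReal ((∫ z, K z)⁻¹ * K z)).map lft := rfl
  rw [h1, integral_map measurable_lft.aemeasurable hf.aestronglyMeasurable,
    integral_withDensity_eq_integral_toReal_smul (by fun_prop) (by simp), ← integral_const_mul]
  refine integral_congr_ae (Eventually.of_forall fun z => ?_)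
  simp only [smul_eq_mul]
  rw [ENNReal.toReal_ofReal (mul_nonneg (inv_nonneg.2 hp.le) (h0 z))]; ring

lemma kap_ae {K : Td d → ℝ} (hK : Continuous K) (h0 : ∀ z, 0 ≤ K z)
    (hp : 0 < ∫ z, K z) {r : ℝ} (hr : ∀ y, r < ‖y‖ → K y = 0) :
    ∀ᵐ v ∂(kap K hK h0 hp : Measure (Vd d)), ‖v‖ ≤ r := by
  have h1 : (kap K hK h0 hp : Measure (Vd d)) =
    (volume.withDensity fun z => ENNReal.ofReal ((∫ z, K z)⁻¹ * K z)).map lft := rfl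
  rw [h1, ae_map_iff measurable_lft.aemeasurable (measurableSet_le measurable_norm measurable_const),
    ae_withDensity_iff (by fun_prop)]
  refine Eventually.of_forall fun y hy => ?_
  by_contra hc
  push Not at hc
  exact hy (by rw [hr y (hc.trans_le (norm_lft y))]; simp)

lemma conv_swap (ν : PTd d) {K f : Td d → ℝ} (hK : Continuous K) (hf : Continuous f) :
    ig ν (fun x => ∫ y, f (x + y) * K y) = ∫ y, f y * ig ν (fun x => K (y - x)) := by
  have e1 : ∀ x : Td d, ∫ y, f (x + y) * K y = ∫ y, f y * K (y - x) := by
    intro x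
    have := integral_add_left_eq_self (μ := (volume : Measure (Td d))) (fun y => f y * K (y - x)) x
    rw [← this]
    simp only [add_sub_cancel_left]
  simp_rw [e1]
  unfold ig
  have hc : Continuous (fun q : Td d × Td d => f q.2 * K (q.2 - q.1)) := by fun_prop
  obtain ⟨C, hC⟩ := isCompact_univ.exists_bound_of_continuousOn hc.continuousOn
  rw [integral_integral_swap (Integrable.of_bound (C := C) hc.aestronglyMeasurable
    (Eventually.of_forall fun q => hC q trivial))]
  simp_rw [integral_const_mul]

lemma ig_cv_kap {K : Td d → ℝ} (hK : Continuous K) (h0 : ∀ z, 0 ≤ K z)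
    (hp : 0 < ∫ z, K z) (ν : PTd d) {f : Td d → ℝ} (hf : Continuous f) :
    ig (cv ν (kap K hK h0 hp) 1) f = (∫ z, K z)⁻¹ * ∫ y, f y * ig ν (fun x => K (y - x)) := by
  rw [ig_cv' _ _ _ hf, ← conv_swap ν hK hf, ← ig_smul]
  refine congrArg _ (funext fun x => ?_)
  rw [kap_int hK h0 hp (f := fun v => f (x + pj ((1:ℝ) • v)))
    (hf.comp (continuous_const.add (continuous_pj.comp (by fun_prop))))]
  simp only [one_smul, pj_lft]

lemma one_int_pos (d : ℕ) : 0 < ∫ _z : Td d, (1:ℝ) := by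
  have : IsProbabilityMeasure (volume : Measure (Td d)) := (haar d).2
  simp

def ku (d : ℕ) : ProbabilityMeasure (Vd d) :=
  kap (fun _ => 1) continuous_const (fun _ => zero_le_one) (one_int_pos d)

lemma cv_ku (μ : PTd d) : cv μ (ku d) 1 = haar d := by
  refine ptd_ext fun f hf => ?_
  have := ig_cv_kap continuous_const (fun _ => zero_le_one) (one_int_pos d) μ hf
  have h2 : IsProbabilityMeasure (volume : Measure (Td d)) := (haar d).2
  have h1 : ig μ (fun _ => (1:ℝ)) = 1 := by simp [ig]
  rw [h1] at this
  simp only [integral_const, probReal_univ, smul_eq_mul, mul_one, inv_one, one_mul] at this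
  exact this

lemma ku_ae (d : ℕ) : ∀ᵐ v ∂(ku d : Measure (Vd d)), ‖v‖ ≤ 1 :=
  kap_ae continuous_const (fun _ => zero_le_one) (one_int_pos d) fun y hy =>
    absurd (norm_Td_le y) (not_le.2 hy)

lemma dom_mix {c : ℝ} (hc : 0 ≤ c) (hc1 : c < 1) {ν μ : PTd d}
    (h : ∀ f : Td d → ℝ, Continuous f → (∀ y, 0 ≤ f y) → c * ig ν f ≤ ig μ f) :
    ∃ ρ, μ = mix (1 - c) ν ρ := by
  set νm : Measure (Td d) := ENNReal.ofReal c • (ν : Measure (Td d)) with hνm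
  have hfin : IsFiniteMeasure νm := ⟨by simp [hνm]⟩
  have hle : νm ≤ (μ : Measure (Td d)) := by
    have hcl : ∀ F : Set (Td d), IsClosed F → νm F ≤ (μ : Measure (Td d)) F := by
      intro F hF
      refine ge_of_tendsto (tendsto_lintegral_thickenedIndicator_of_isClosed (μ : Measure (Td d)) hF
        (δs := fun n : ℕ => 1 / ((n:ℝ) + 1)) (fun n => by positivity) tendsto_one_div_add_atTop_nhds_zero_nat)
        (Eventually.of_forall fun n => ?_)
      have hn : (0:ℝ) < 1 / ((n:ℝ) + 1) := by positivity
      have h1 := h (fun y => (thickenedIndicator hn F y : ℝ)) (by fun_prop) (fun y => NNReal.coe_nonneg _)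
      have e1 : ∀ p : PTd d, ENNReal.ofReal (ig p (fun y => (thickenedIndicator hn F y : ℝ))) =
          ∫⁻ y, thickenedIndicator hn F y ∂(p : Measure (Td d)) := by
        intro p
        unfold ig
        rw [ofReal_integral_eq_lintegral_ofReal (int_cont (by fun_prop) _)
          (Eventually.of_forall fun y => NNReal.coe_nonneg _)]
        simp
      have h2 := ENNReal.ofReal_le_ofReal h1
      rw [ENNReal.ofReal_mul hc, e1, e1] at h2
      refine le_trans ?_ h2
      simp only [hνm, Measure.smul_apply, smul_eq_mul]
      gcongr
      exact measure_le_lintegral_thickenedIndicator _ hF.measurableSet hn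
    refine Measure.le_iff.2 fun A hA => ?_
    rw [hA.measure_eq_iSup_isClosed_of_ne_top (measure_ne_top νm A)]
    refine iSup_le fun F => iSup_le fun hFA => iSup_le fun hF => ?_
    exact (hcl F hF).trans (measure_mono hFA)
  set ρm : Measure (Td d) := (μ : Measure (Td d)) - νm with hρm
  have hadd : ρm + νm = (μ : Measure (Td d)) := Measure.sub_add_cancel_of_le hle
  have hmass : ρm univ = ENNReal.ofReal (1 - c) := by
    have := congrArg (fun m : Measure (Td d) => m univ) hadd
    simp only [Measure.add_apply, hνm, Measure.smul_apply, measure_univ, smul_eq_mul, mul_one] at this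
    rw [ENNReal.ofReal_sub _ hc, ENNReal.ofReal_one]
    exact ENNReal.eq_sub_of_add_eq (by simp) this
  have hc1' : ENNReal.ofReal (1 - c) ≠ 0 := by simpa using hc1
  refine ⟨⟨(ENNReal.ofReal (1 - c))⁻¹ • ρm, ⟨by
    rw [Measure.smul_apply, hmass, smul_eq_mul, ENNReal.inv_mul_cancel hc1' (by simp)]⟩⟩, ?_⟩
  apply Subtype.ext
  have h3 : (1 - c) ∈ Icc (0:ℝ) 1 := ⟨by linarith, by linarith⟩
  refine Eq.trans ?_ (mix_coe h3 _ _).symm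
  unfold lineComb
  refine hadd.symm.trans ?_
  rw [add_comm]
  congr 1
  · rw [sub_sub_cancel]
  · show ρm = ENNReal.ofReal (1 - c) • ((ENNReal.ofReal (1 - c))⁻¹ • ρm)
    rw [smul_smul, ENNReal.mul_inv_cancel hc1' (by simp), one_smul]


def Sq (y : Td d) : ℝ := ∑ i, ‖y i‖ ^ 2
def Nc (d : ℕ) (c : ℝ) : ℝ := (Zg d)⁻¹ * (c ^ d)⁻¹
def GK (c : ℝ) (y : Td d) : ℝ := Nc d c * exp (-(Sq y) / (2 * c ^ 2))
def KK (r c : ℝ) (y : Td d) : ℝ := GK c y * max 0 (1 - ‖y‖ / r)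

lemma Nc_pos (d : ℕ) {c : ℝ} (hc : 0 < c) : 0 < Nc d c := by
  have := Zg_pos d
  unfold Nc; positivity

lemma Sq_nonneg (y : Td d) : 0 ≤ Sq y := Finset.sum_nonneg fun i _ => sq_nonneg _

lemma Sq_le (y : Td d) : Sq y ≤ d := by
  have : ∀ i ∈ Finset.univ, ‖y i‖ ^ 2 ≤ (1:ℝ) := fun i _ => by
    have := (norm_le_pi_norm y i).trans (norm_Td_le y)
    have := norm_nonneg (y i)
    nlinarith
  have := Finset.sum_le_sum this
  simpa [Sq] using this

lemma Sq_lip (y y' : Td d) : |Sq y - Sq y'| ≤ 2 * d * dist y y' := by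
  unfold Sq
  rw [← Finset.sum_sub_distrib]
  refine (Finset.abs_sum_le_sum_abs _ _).trans ?_
  have : ∀ i ∈ Finset.univ, |‖y i‖ ^ 2 - ‖y' i‖ ^ 2| ≤ 2 * dist y y' := fun i _ => by
    have h1 := (norm_le_pi_norm y i).trans (norm_Td_le y)
    have h2 := (norm_le_pi_norm y' i).trans (norm_Td_le y')
    have h3 : |‖y i‖ - ‖y' i‖| ≤ dist y y' := by
      rw [dist_eq_norm]
      exact (abs_norm_sub_norm_le _ _).trans (norm_le_pi_norm (y - y') i)
    rw [sq_sub_sq, abs_mul, abs_of_nonneg (by positivity)]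
    have := abs_nonneg (‖y i‖ - ‖y' i‖)
    nlinarith [norm_nonneg (y i), norm_nonneg (y' i)]
  refine (Finset.sum_le_sum this).trans (le_of_eq ?_)
  simp; ring

lemma exp_lip {a b : ℝ} (ha : 0 ≤ a) (hb : 0 ≤ b) : |exp (-a) - exp (-b)| ≤ |a - b| := by
  have key : ∀ a b : ℝ, 0 ≤ a → exp (-a) - exp (-b) ≤ |a - b| := by
    intro a b ha
    have h1 : exp (-b) = exp (-a) * exp (a - b) := by rw [← exp_add]; ring_nf
    have h2 := add_one_le_exp (a - b)
    have h3 : exp (-a) ≤ 1 := exp_le_one_iff.2 (by linarith)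
    have h4 := exp_pos (-a)
    have h5 : -(a - b) ≤ |a - b| := neg_le_abs _
    have h6 := abs_nonneg (a - b)
    rw [h1]
    nlinarith
  rw [abs_le]
  have h1 := key a b ha
  have h2 := key b a hb
  rw [abs_sub_comm b a] at h2
  constructor <;> linarith

lemma Sq_cont : Continuous (Sq : Td d → ℝ) := by unfold Sq; fun_prop
lemma GK_cont (c : ℝ) : Continuous (GK c : Td d → ℝ) := by
  have := Sq_cont (d := d)
  unfold GK; fun_prop
lemma GK_pos {c : ℝ} (hc : 0 < c) (y : Td d) : 0 < GK c y := mul_pos (Nc_pos d hc) (exp_pos _)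
lemma KK_cont (r c : ℝ) : Continuous (KK r c : Td d → ℝ) := by
  have := GK_cont (d := d) c
  unfold KK; fun_prop

lemma KK_lip {r c : ℝ} (hr : 0 < r) (hc : 0 < c) : ∃ L, 0 ≤ L ∧ ∀ y y' : Td d,
    |KK r c y - KK r c y'| ≤ L * dist y y' := by
  have hN := Nc_pos d hc
  refine ⟨Nc d c * (d / c ^ 2) + Nc d c * r⁻¹, by positivity, fun y y' => ?_⟩
  have h1 : |GK c y - GK c y'| ≤ Nc d c * (d / c ^ 2) * dist y y' := by
    unfold GK
    rw [← mul_sub, abs_mul, abs_of_pos hN, mul_assoc]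
    refine mul_le_mul_of_nonneg_left ?_ hN.le
    have := exp_lip (a := Sq y / (2 * c ^ 2)) (b := Sq y' / (2 * c ^ 2))
      (div_nonneg (Sq_nonneg _) (by positivity)) (div_nonneg (Sq_nonneg _) (by positivity))
    rw [neg_div, neg_div]
    refine this.trans ?_
    rw [← sub_div, abs_div, abs_of_pos (by positivity : 0 < 2 * c ^ 2), div_le_iff₀ (by positivity)]
    refine (Sq_lip y y').trans (le_of_eq ?_)
    field_simp
  have h2 : |max 0 (1 - ‖y‖ / r) - max 0 (1 - ‖y'‖ / r)| ≤ r⁻¹ * dist y y' := by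
    refine (abs_max_sub_max_le_max _ _ _ _).trans ?_
    rw [sub_self, abs_zero, sub_sub_sub_cancel_left, ← sub_div, abs_div, abs_of_pos hr]
    refine max_le (by positivity) ?_
    rw [div_eq_inv_mul]
    refine mul_le_mul_of_nonneg_left ?_ (by positivity)
    rw [abs_sub_comm, dist_eq_norm]
    exact abs_norm_sub_norm_le _ _
  have h3 : |GK c y'| ≤ Nc d c := by
    rw [abs_of_pos (GK_pos hc _), GK]
    refine mul_le_of_le_one_right hN.le (exp_le_one_iff.2 ?_)
    exact div_nonpos_of_nonpos_of_nonneg (by linarith [Sq_nonneg y']) (by positivity)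
  have h4 : |max 0 (1 - ‖y‖ / r)| ≤ 1 := by
    rw [abs_of_nonneg (le_max_left _ _)]
    exact max_le zero_le_one (by have := norm_nonneg y; have : 0 ≤ ‖y‖ / r := by positivity
                                 linarith)
  have e : KK r c y - KK r c y' = (GK c y - GK c y') * max 0 (1 - ‖y‖ / r) +
    GK c y' * (max 0 (1 - ‖y‖ / r) - max 0 (1 - ‖y'‖ / r)) := by unfold KK; ring
  rw [e]
  refine (abs_add_le _ _).trans ?_
  rw [abs_mul, abs_mul, add_mul]
  refine add_le_add ?_ ?_
  · exact (mul_le_of_le_one_right (abs_nonneg _) h4).trans h1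
  · rw [mul_assoc]
    exact mul_le_mul h3 h2 (abs_nonneg _) hN.le

def boxV (d : ℕ) : Set (Vd d) := {x | ∀ i, x i ∈ Ioc (-(1/2) : ℝ) (-(1/2) + 1)}

lemma box_meas (d : ℕ) : MeasurableSet (boxV d) :=
  MeasurableSet.univ_pi' (fun _ => measurableSet_Ioc)

lemma box_int {f : Td d → ℝ} (hf : Continuous f) : ∫ y, f y = ∫ v in boxV d, f (pj v) := by
  have h1 := measurePreserving_pi (ι := Fin d) (fun _ => (volume : Measure ℝ).restrict (Ioc (-(1/2) : ℝ) (-(1/2) + 1)))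
    (fun _ => (volume : Measure (AddCircle (1:ℝ)))) (fun i => AddCircle.measurePreserving_mk 1 (-(1/2)))
  rw [← Measure.restrict_pi_pi] at h1
  have h2 : (univ.pi fun _ : Fin d => Ioc (-(1/2) : ℝ) (-(1/2) + 1)) = boxV d := by
    ext v; simp [boxV]
  rw [h2] at h1
  have h3 := h1.map_eq
  have h4 : (volume : Measure (Td d)) = Measure.map (pj : Vd d → Td d) (volume.restrict (boxV d)) := h3.symm
  rw [h4, integral_map continuous_pj.aemeasurable hf.aestronglyMeasurable]

lemma box_Sq {v : Vd d} (hv : v ∈ boxV d) : Sq (pj v) = sqnorm v := by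
  unfold Sq sqnorm
  refine Finset.sum_congr rfl fun i _ => ?_
  have : ‖(pj v) i‖ = |v i| := by
    refine (AddCircle.norm_coe_eq_abs_iff 1 one_ne_zero).2 ?_
    have := hv i
    rw [abs_le, abs_one]
    constructor <;> linarith [this.1, this.2]
  rw [this, sq_abs]

lemma box_out {v : Vd d} (hv : v ∉ boxV d) : 1 / 2 ≤ ‖v‖ := by
  by_contra hc
  push Not at hc
  refine hv fun i => ?_
  have := (norm_le_pi_norm v i).trans_lt hc
  rw [Real.norm_eq_abs, abs_lt] at this
  constructor <;> linarith [this.1, this.2]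

lemma gz_scale {c : ℝ} (hc : 0 < c) (v : Vd d) : gz (c⁻¹ • v) = exp (-(sqnorm v) / (2 * c ^ 2)) := by
  rw [gz, sqnorm_smul]
  congr 1
  field_simp

lemma scale_int {c : ℝ} (hc : 0 < c) (g : Vd d → ℝ) :
    (Zg d)⁻¹ * ∫ z, g (c • z) * gz z = Nc d c * ∫ v, g v * exp (-(sqnorm v) / (2 * c ^ 2)) := by
  have := Measure.integral_comp_smul_of_nonneg (volume : Measure (Vd d))
    (fun v => g v * exp (-(sqnorm v) / (2 * c ^ 2))) c (hR := hc.le)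
  rw [Module.finrank_fin_fun, smul_eq_mul] at this
  rw [Nc, mul_assoc, ← this]
  congr 2
  funext z
  rw [← gz_scale hc, inv_smul_smul₀ hc.ne']

lemma gzc_int {c : ℝ} (hc : 0 < c) : Integrable (fun v : Vd d => exp (-(sqnorm v) / (2 * c ^ 2))) := by
  have := gz_int0 (d := d) (b := (2 * c ^ 2)⁻¹) (by positivity)
  refine this.congr (Eventually.of_forall fun z => ?_)
  simp only; congr 1; ring

lemma gzc_int1 {c : ℝ} (hc : 0 < c) :
    Integrable (fun v : Vd d => ‖v‖ * exp (-(sqnorm v) / (2 * c ^ 2))) := by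
  have := (gz_int1 (d := d)).comp_smul (inv_ne_zero hc.ne')
  refine (this.const_mul c).congr (Eventually.of_forall fun v => ?_)
  simp only
  rw [gz_scale hc, norm_smul, Real.norm_of_nonneg (inv_nonneg.2 hc.le), ← mul_assoc, ← mul_assoc,
    mul_inv_cancel₀ hc.ne', one_mul]

lemma sect {c : ℝ} (hc : 0 < c) (x : Td d) {f : Td d → ℝ} (hf : Continuous f) (h0 : ∀ y, 0 ≤ f y) :
    ∫ y, f (x + y) * GK c y ≤ ∫ z, f (x + pj (c • z)) ∂(gam d : Measure (Vd d)) := by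
  rw [gam_int, scale_int hc (fun v => f (x + pj v)), box_int (f := fun y => f (x + y) * GK c y) ((hf.comp (by fun_prop)).mul (GK_cont c))]
  have e : ∫ v in boxV d, f (x + pj v) * GK c (pj v) =
      ∫ v in boxV d, Nc d c * (f (x + pj v) * exp (-(sqnorm v) / (2 * c ^ 2))) := by
    refine setIntegral_congr_fun (box_meas d) fun v hv => ?_
    rw [GK, box_Sq hv]; ring
  rw [e, integral_const_mul]
  refine mul_le_mul_of_nonneg_left ?_ (Nc_pos d hc).le
  obtain ⟨C, hC⟩ := isCompact_univ.exists_bound_of_continuousOn hf.continuousOn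
  refine setIntegral_le_integral ?_ (Eventually.of_forall fun v => mul_nonneg (h0 _) (exp_pos _).le)
  refine (gzc_int hc).bdd_mul (c := C) ?_ (Eventually.of_forall fun v => hC _ trivial)
  exact (hf.comp (continuous_const.add continuous_pj)).aestronglyMeasurable

lemma heat_dom {c : ℝ} (hc : 0 < c) (μ : PTd d) {f : Td d → ℝ} (hf : Continuous f) (h0 : ∀ y, 0 ≤ f y) :
    ∫ y, f y * ig μ (fun x => GK c (y - x)) ≤ ig (cv μ (gam d) c) f := by
  rw [← conv_swap μ (GK_cont c) hf, ig_cv' _ _ _ hf]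
  have hc2 : Continuous (fun q : Td d × Td d => f (q.1 + q.2) * GK c q.2) :=
    (hf.comp (by fun_prop)).mul ((GK_cont c).comp continuous_snd)
  obtain ⟨C, hC⟩ := isCompact_univ.exists_bound_of_continuousOn hc2.continuousOn
  have : Integrable (fun q : Td d × Td d => f (q.1 + q.2) * GK c q.2) ((μ : Measure (Td d)).prod volume) :=
    Integrable.of_bound (C := C) hc2.aestronglyMeasurable (Eventually.of_forall fun q => hC q trivial)
  exact integral_mono this.integral_prod_left (cv_int μ (gam d) c hf).integral_prod_left
    fun x => sect hc x hf h0

lemma KK_mass {r c : ℝ} (hr : 0 < r) (hr1 : r ≤ 1 / 2) (hc : 0 < c) :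
    1 - c / r * ((Zg d)⁻¹ * ∫ z : Vd d, ‖z‖ * gz z) ≤ ∫ y : Td d, KK r c y := by
  have e1 := scale_int (d := d) hc (fun v => 1 - ‖v‖ / r)
  have e2 : (Zg d)⁻¹ * ∫ z : Vd d, (1 - ‖c • z‖ / r) * gz z =
      1 - c / r * ((Zg d)⁻¹ * ∫ z : Vd d, ‖z‖ * gz z) := by
    have : ∀ z : Vd d, (1 - ‖c • z‖ / r) * gz z = gz z - c / r * (‖z‖ * gz z) := fun z => by
      rw [norm_smul, Real.norm_of_nonneg hc.le]; ring
    simp_rw [this]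
    rw [integral_sub gz_int (gz_int1.const_mul _), integral_const_mul, mul_sub]
    have : (Zg d)⁻¹ * ∫ z : Vd d, gz z = 1 := inv_mul_cancel₀ (Zg_pos d).ne'
    rw [this]; ring
  rw [← e2, e1, box_int (KK_cont r c), ← integral_const_mul]
  have hi : Integrable (fun v : Vd d => Nc d c * ((1 - ‖v‖ / r) * exp (-(sqnorm v) / (2 * c ^ 2)))) := by
    refine (((gzc_int hc).sub ((gzc_int1 hc).const_mul r⁻¹)).const_mul (Nc d c)).congr
      (Eventually.of_forall fun v => ?_)
    simp only [Pi.sub_apply]; ring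
  have hr' : ∀ v : Vd d, v ∈ (boxV d)ᶜ → Nc d c * ((1 - ‖v‖ / r) * exp (-(sqnorm v) / (2 * c ^ 2))) ≤ 0 := by
    intro v hv
    have := box_out hv
    have h1 : 1 ≤ ‖v‖ / r := by rw [le_div_iff₀ hr]; linarith
    have h2 := Nc_pos d hc
    have h3 := exp_pos (-(sqnorm v) / (2 * c ^ 2))
    exact mul_nonpos_of_nonneg_of_nonpos h2.le (mul_nonpos_of_nonpos_of_nonneg (by linarith) h3.le)
  rw [← integral_add_compl (box_meas d) hi]
  have h5 := setIntegral_nonpos (μ := (volume : Measure (Vd d))) (box_meas d).compl hr'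
  have h6 : ∫ v in boxV d, Nc d c * ((1 - ‖v‖ / r) * exp (-(sqnorm v) / (2 * c ^ 2))) ≤
      ∫ v in boxV d, KK r c (pj v) := by
    have hfin : volume (boxV d) < ⊤ := by
      refine (measure_mono (t := Metric.closedBall (0 : Vd d) 1) fun v hv => ?_).trans_lt
        (measure_closedBall_lt_top (μ := (volume : Measure (Vd d))))
      rw [mem_closedBall_zero_iff, pi_norm_le_iff_of_nonneg zero_le_one]
      intro i
      rw [Real.norm_eq_abs, abs_le]
      have := hv i
      constructor <;> linarith [this.1, this.2]
    obtain ⟨C, hC⟩ := isCompact_univ.exists_bound_of_continuousOn (KK_cont (d := d) r c).continuousOn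
    refine setIntegral_mono_on hi.integrableOn ?_ (box_meas d) fun v hv => ?_
    · exact Measure.integrableOn_of_bounded hfin.ne
        ((KK_cont r c).comp continuous_pj).aestronglyMeasurable (M := C) (Eventually.of_forall fun v => hC _ trivial)
    · rw [KK, GK, box_Sq hv, mul_assoc]
      refine mul_le_mul_of_nonneg_left ?_ (Nc_pos d hc).le
      rw [mul_comm]
      refine mul_le_mul_of_nonneg_left ?_ (exp_pos _).le
      refine le_max_of_le_right ?_
      have := norm_pj_le v
      have : ‖pj v‖ / r ≤ ‖v‖ / r := by gcongr
      linarith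
  linarith

lemma smooth_dom (d : ℕ) {r : ℝ} (hr : 0 < r) (hr1 : r ≤ 1 / 2) : ∃ τ, 0 < τ ∧ τ ≤ r ∧
    ∃ κ : ProbabilityMeasure (Vd d), (∀ᵐ y ∂(κ : Measure (Vd d)), ‖y‖ ≤ r) ∧
    ∃ δ > 0, ∀ μ ν : PTd d, W1 μ ν < δ → ∃ ρ, heat μ τ = mix (2 * r) (cv ν κ 1) ρ := by
  set M := (Zg d)⁻¹ * ∫ z : Vd d, ‖z‖ * gz z with hM
  have hM0 : 0 ≤ M := mul_nonneg (inv_nonneg.2 (Zg_pos d).le)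
    (integral_nonneg fun z => mul_nonneg (norm_nonneg _) (gz_pos z).le)
  set c := r ^ 2 / (M + 1) with hc
  have hc0 : 0 < c := by positivity
  have hcr : c / r * M ≤ r := by
    rw [hc, div_div, div_mul_eq_mul_div, div_le_iff₀ (by positivity)]
    nlinarith [sq_nonneg r]
  have hc1 : c ≤ r ^ 2 := div_le_self (by positivity) (by linarith)
  have hc2 : c ≤ 1 := by nlinarith
  have hcτ : c ^ 2 / 2 ≤ r := by nlinarith
  have hp : 1 - r ≤ ∫ y : Td d, KK r c y := by
    have := KK_mass (d := d) hr hr1 hc0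
    linarith
  have hp0 : 0 < ∫ y : Td d, KK r c y := by linarith
  have hK0 : ∀ y : Td d, 0 ≤ KK r c y := fun y => mul_nonneg (GK_pos hc0 y).le (le_max_left _ _)
  obtain ⟨L, hL0, hL⟩ := KK_lip (d := d) hr hc0
  set g0 := Nc d c * exp (-(d:ℝ) / (2 * c ^ 2)) with hg0
  have hg0p : 0 < g0 := mul_pos (Nc_pos d hc0) (exp_pos _)
  have hG : ∀ y : Td d, g0 ≤ GK c y := fun y => by
    refine mul_le_mul_of_nonneg_left (exp_le_exp.2 ?_) (Nc_pos d hc0).le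
    have := Sq_le y
    gcongr
  refine ⟨c ^ 2 / 2, by positivity, hcτ, kap (KK r c) (KK_cont r c) hK0 hp0,
    kap_ae _ _ _ fun y hy => ?_, r * g0 / (L + 1), by positivity, fun μ ν hW => ?_⟩
  · rw [KK, max_eq_left, mul_zero]
    have : 1 ≤ ‖y‖ / r := by rw [le_div_iff₀ hr]; linarith
    linarith
  have h2r : 2 * r = 1 - (1 - 2 * r) := by ring
  rw [h2r]
  refine dom_mix (by linarith) (by linarith) fun f hf h0 => ?_
  have hs : √(2 * (c ^ 2 / 2)) = c := by rw [mul_div_cancel₀ _ two_ne_zero, Real.sqrt_sq hc0.le]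
  rw [heat, hs, ig_cv_kap _ _ _ _ hf]
  refine le_trans ?_ (heat_dom hc0 μ hf h0)
  have hKy : ∀ y, Continuous fun x : Td d => KK r c (y - x) := fun y => (KK_cont r c).comp (by fun_prop)
  have hGy : ∀ y, Continuous fun x : Td d => GK c (y - x) := fun y => (GK_cont c).comp (by fun_prop)
  have hpt : ∀ y, ig ν (fun x => KK r c (y - x)) ≤ (1 + r) * ig μ (fun x => GK c (y - x)) := by
    intro y
    have h1 : ig ν (fun x => KK r c (y - x)) - ig μ (fun x => KK r c (y - x)) ≤ L * W1 ν μ :=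
      lip_le_W1 ν μ hL0 fun x x' => by
        have := hL (y - x) (y - x')
        rwa [dist_sub_left] at this
    have h2 : ig μ (fun x => KK r c (y - x)) ≤ ig μ (fun x => GK c (y - x)) := by
      refine ig_mono μ (hKy y) (hGy y) fun x => mul_le_of_le_one_right (GK_pos hc0 _).le ?_
      have : 0 ≤ ‖y - x‖ / r := by positivity
      exact max_le zero_le_one (by linarith)
    have h3 : g0 ≤ ig μ (fun x => GK c (y - x)) := by
      have := ig_mono μ (f := fun _ => g0) continuous_const (hGy y) fun x => hG _
      simpa [ig] using this
    have h4 : L * W1 ν μ ≤ r * g0 := by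
      rw [W1_symm]
      have := W1_nonneg μ ν
      rw [lt_div_iff₀ (by positivity)] at hW
      nlinarith
    nlinarith
  have hcG : Continuous (fun y : Td d => f y * ig μ (fun x => GK c (y - x))) :=
    hf.mul (cont_pair' (f := fun y x => GK c (y - x)) ((GK_cont c).comp (by fun_prop)) continuous_const)
  have hcK : Continuous (fun y : Td d => f y * ig ν (fun x => KK r c (y - x))) :=
    hf.mul (cont_pair' (f := fun y x => KK r c (y - x)) ((KK_cont r c).comp (by fun_prop)) continuous_const)
  have hmono : ∫ y, f y * ig ν (fun x => KK r c (y - x)) ≤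
      (1 + r) * ∫ y, f y * ig μ (fun x => GK c (y - x)) := by
    rw [← integral_const_mul]
    refine integral_mono (int_cont hcK _) ((int_cont hcG _).const_mul _) fun y => ?_
    have := mul_le_mul_of_nonneg_left (hpt y) (h0 y)
    simp only; linarith
  have hI : 0 ≤ ∫ y, f y * ig μ (fun x => GK c (y - x)) :=
    integral_nonneg fun y => mul_nonneg (h0 y) (integral_nonneg fun x => (GK_pos hc0 _).le)
  set I := ∫ y, f y * ig μ (fun x => GK c (y - x))
  set J := ∫ y, f y * ig ν (fun x => KK r c (y - x))
  set p := ∫ y : Td d, KK r c y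
  have : (1 - 2 * r) * (p⁻¹ * J) = ((1 - 2 * r) * J) / p := by field_simp
  rw [this, div_le_iff₀ hp0]
  have h7 : (1 - 2 * r) * J ≤ (1 - 2 * r) * ((1 + r) * I) := mul_le_mul_of_nonneg_left hmono (by linarith)
  have h8 : I * (1 - r) ≤ I * p := mul_le_mul_of_nonneg_left hp hI
  nlinarith [mul_nonneg hI (sq_nonneg r)]


lemma Fc_lip (S : MFGSetting d) : ∃ L, 0 ≤ L ∧ ∀ μ ν, |S.Fc μ - S.Fc ν| ≤ L * W1 μ ν := by
  refine ⟨d * max S.CF 0, by positivity, fun ν μ => ?_⟩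
  have hg : ∀ p : Measure (Td d), IsProbabilityMeasure p → ∀ y y' : Td d,
      |S.Fd p (secT y) - S.Fd p (secT y')| ≤ d * max S.CF 0 * dist y y' := by
    intro p hp y y'
    have hper : Per (S.Fd p) := S.Fd_per p
    have e : S.Fd p (secT y) = S.Fd p (secT y' + lft (y - y')) := by
      rw [← hper.sec_add, pj_lft, add_sub_cancel]
    rw [e]
    refine (per_lip (S.Fd_smooth p hp) hper (B := max S.CF 0) (fun x v w => ?_) (le_max_right _ _) _ _).trans ?_
    · refine (S.Fd_D2_bound p hp x v w).trans ?_
      gcongr; exact le_max_left _ _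
    · rw [add_sub_cancel_left, dist_eq_norm]
      exact mul_le_mul_of_nonneg_left (norm_lft _) (by positivity)
  rw [S.flat_deriv μ ν]
  have := norm_setIntegral_le_of_norm_le_const (μ := (volume : Measure ℝ)) (s := Icc (0:ℝ) 1)
    (C := d * max S.CF 0 * W1 ν μ) (f := fun t => ((∫ y, S.Fd (lineComb t μ ν) (secT y) ∂(ν : Measure (Td d))) -
        ∫ y, S.Fd (lineComb t μ ν) (secT y) ∂(μ : Measure (Td d)))) (by simp) fun t ht => ?_
  · simpa using this
  · have hp : IsProbabilityMeasure (lineComb t μ ν) := by rw [← mix_coe ht]; infer_instance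
    have h1 := lip_le_W1 ν μ (φ := fun y => S.Fd (lineComb t μ ν) (secT y)) (by positivity) (hg _ hp)
    have h2 := lip_le_W1 μ ν (φ := fun y => S.Fd (lineComb t μ ν) (secT y)) (by positivity) (hg _ hp)
    rw [W1_symm μ ν] at h2
    rw [Real.norm_eq_abs, abs_le]
    constructor <;> linarith

lemma Fc_cont (S : MFGSetting d) : Continuous S.Fc := by
  rw [← W1Continuous_iff]
  obtain ⟨L, hL0, hL⟩ := Fc_lip S
  intro μ ε hε
  refine ⟨ε / (L + 1), by positivity, fun ν hν => ?_⟩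
  have := hL ν μ
  rw [W1_symm] at this
  rw [lt_div_iff₀ (by positivity)] at hν
  have := W1_nonneg μ ν
  nlinarith

lemma W1_cv (μ : PTd d) (κ : ProbabilityMeasure (Vd d)) {c r : ℝ}
    (h : ∀ᵐ y ∂(κ : Measure (Vd d)), ‖y‖ ≤ r) : W1 (cv μ κ c) μ ≤ |c| * r := by
  refine W1_le _ _ fun φ hφ => ?_
  have e := ig_cv μ κ c hφ.continuous
  change ig (cv μ κ c) φ - ig μ φ ≤ _
  rw [e]
  have hint : Integrable (fun y => ig μ (fun x => φ (x + pj (c • y)))) (κ : Measure (Vd d)) :=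
    (cv_int μ κ c hφ.continuous).integral_prod_right
  have := integral_mono_ae hint (integrable_const (ig μ φ + |c| * r)) (by
    filter_upwards [h] with y hy
    have : ig μ (fun x => φ (x + pj (c • y))) ≤ ig μ (fun x => φ x + |c| * r) := by
      refine ig_mono μ (hφ.continuous.comp (by fun_prop)) (hφ.continuous.add continuous_const) fun x => ?_
      have h1 := hφ.dist_le_mul (x + pj (c • y)) x
      rw [Real.dist_eq, dist_eq_norm, add_sub_cancel_left, NNReal.coe_one, one_mul] at h1
      have h2 := norm_pj_le (c • y)
      rw [norm_smul, Real.norm_eq_abs] at h2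
      have h3 := le_abs_self (φ (x + pj (c • y)) - φ x)
      have h4 : |c| * ‖y‖ ≤ |c| * r := by gcongr
      linarith
    refine this.trans (le_of_eq ?_)
    rw [ig_add μ hφ.continuous continuous_const]
    simp [ig])
  simp only [integral_const, probReal_univ, one_smul] at this
  linarith

lemma W1_mix {e : ℝ} (he : e ∈ Icc (0:ℝ) 1) (μ ν : PTd d) : W1 (mix e μ ν) μ ≤ 2 * e := by
  refine W1_le _ _ fun φ hφ => ?_
  change ig (mix e μ ν) φ - ig μ φ ≤ _
  rw [ig_mix he _ _ hφ.continuous]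
  have h1 : ig ν φ - ig μ φ ≤ 2 * (1 : NNReal) := W1_bd ν μ hφ
  rw [NNReal.coe_one, mul_one] at h1
  have := mul_le_mul_of_nonneg_left h1 he.1
  linarith

lemma mix_self {e : ℝ} (he : e ∈ Icc (0:ℝ) 1) (μ : PTd d) : mix e μ μ = μ := by
  refine ptd_ext fun f hf => ?_
  change ig (mix e μ μ) f = ig μ f
  rw [ig_mix he _ _ hf]; ring

lemma glue {S : MFGSetting d} {m₁ m₂ : ℝ → PTd d} {a b c C₁ C₂ : ℝ} (hab : a ≤ b) (hbc : b ≤ c)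
    (h1 : ContinuousOn m₁ (Icc a b)) (h2 : ContinuousOn m₂ (Icc b c)) (e : m₁ b = m₂ b)
    (a1 : Act S m₁ a b C₁) (a2 : Act S m₂ b c C₂) :
    ∃ m : ℝ → PTd d, ContinuousOn m (Icc a c) ∧ m a = m₁ a ∧ m c = m₂ c ∧ Act S m a c (C₁ + C₂) := by
  set m : ℝ → PTd d := fun s => if s ≤ b then m₁ s else m₂ s with hm
  have e1 : ∀ s ∈ Icc a b, m s = m₁ s := fun s hs => if_pos hs.2
  have e2 : ∀ s ∈ Icc b c, m s = m₂ s := fun s hs => by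
    by_cases h : s ≤ b
    · have : s = b := le_antisymm h hs.1
      rw [this, e1 b ⟨hab, le_rfl⟩, e]
    · exact if_neg h
  have c1 : ContinuousOn m (Icc a b) := h1.congr e1
  have c2 : ContinuousOn m (Icc b c) := h2.congr e2
  refine ⟨m, ?_, e1 a (left_mem_Icc.2 hab), e2 c (right_mem_Icc.2 hbc),
    Act.concat hab hbc c1 c2 (a1.congr hab e1) (a2.congr hbc e2)⟩
  rw [← Icc_union_Icc_eq_Icc hab hbc]
  exact c1.union_of_isClosed c2 isClosed_Icc isClosed_Icc

lemma kin_lower (S : MFGSetting d) : ∃ K, 0 ≤ K ∧ ∀ m α s, -K ≤ kin S m α s := by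
  obtain ⟨K, hK0, hK⟩ := S.Hstar_bounds
  refine ⟨K, hK0, fun m α s => ?_⟩
  unfold kin ig
  by_cases hi : Integrable (fun y => S.Hstar (secT y) (α s y)) (m s : Measure (Td d))
  · have := integral_mono (integrable_const (-K)) hi fun y => (hK (secT y) (α s y)).1
    simpa using this
  · rw [integral_undef hi]; linarith

lemma act_sub (S : MFGSetting d) : ∃ K, 0 ≤ K ∧ ∀ (m : ℝ → PTd d) (a b C : ℝ), a < b →
    ContinuousOn m (Icc a b) → Act S m a b C → -K * (b - a) ≤ C ∧
    ∀ s t, a ≤ s → s ≤ t → t ≤ b → Act S m s t (C + K * (b - a)) := by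
  obtain ⟨K, hK0, hK⟩ := kin_lower S
  refine ⟨K, hK0, fun m a b C hab hm h => ?_⟩
  obtain ⟨α, hα, hC⟩ := lemR S hab hm h
  have hlow : ∀ s t, a ≤ s → s ≤ t → t ≤ b → -K * (t - s) ≤ ∫ x in s..t, kin S m α x := by
    intro s t hs hst ht
    have hi := (lemA S hst (hm.mono (Icc_subset_Icc hs ht)) (hα.sub hs ht)).1
    have := intervalIntegral.integral_mono_on hst intervalIntegrable_const hi fun x _ => hK m α x
    simp only [intervalIntegral.integral_const, smul_eq_mul] at this
    linarith
  refine ⟨(hlow a b le_rfl hab.le le_rfl).trans hC, fun s t hs hst ht => ?_⟩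
  obtain ⟨hi, hA⟩ := lemA S hst (hm.mono (Icc_subset_Icc hs ht)) (hα.sub hs ht)
  refine hA.mono ?_
  have i1 := (lemA S hs (hm.mono (Icc_subset_Icc le_rfl (hst.trans ht))) (hα.sub le_rfl (hst.trans ht))).1
  have i2 := (lemA S ht (hm.mono (Icc_subset_Icc (hs.trans hst) le_rfl)) (hα.sub (hs.trans hst) le_rfl)).1
  have e := intervalIntegral.integral_add_adjacent_intervals i1 hi
  have e2 := intervalIntegral.integral_add_adjacent_intervals (i1.trans hi) i2
  have l1 := hlow a s le_rfl hs (hst.trans ht)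
  have l2 := hlow t b (hs.trans hst) ht le_rfl
  have : K * (t - s) ≥ 0 := mul_nonneg hK0 (by linarith)
  nlinarith

def FI (S : MFGSetting d) (m : ℝ → PTd d) (a b : ℝ) : ℝ := ∫ s in a..b, S.Fc (m s)

lemma Fc_ii (S : MFGSetting d) {m : ℝ → PTd d} {a b : ℝ} (hab : a ≤ b)
    (hm : ContinuousOn m (Icc a b)) : IntervalIntegrable (fun s => S.Fc (m s)) volume a b := by
  refine ContinuousOn.intervalIntegrable ?_
  rw [uIcc_of_le hab]; exact (Fc_cont S).comp_continuousOn hm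

def Cor (S : MFGSetting d) (lam : ℝ) (χ : PTd d → ℝ) : Prop :=
  Continuous χ ∧
  (∀ (m : ℝ → PTd d) (T C : ℝ), 0 < T → ContinuousOn m (Icc 0 T) → Act S m 0 T C →
    χ (m 0) ≤ C + FI S m 0 T + χ (m T) + lam * T) ∧
  (∀ (μ : PTd d) (T ε : ℝ), 0 < T → 0 < ε → ∃ m C, m 0 = μ ∧ ContinuousOn m (Icc 0 T) ∧ Act S m 0 T C ∧
    C + FI S m 0 T + χ (m T) + lam * T ≤ χ μ + ε)

lemma adm_of_act (S : MFGSetting d) {m : ℝ → PTd d} {T C : ℝ} (hT : 0 < T)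
    (hm : ContinuousOn m (Icc 0 T)) (h : Act S m 0 T C) :
    ∃ α, AdmOn S 1 (m 0) T m α ∧ ∫ s in (0:ℝ)..T, runCost S m α s ≤ C + FI S m 0 T := by
  obtain ⟨α, hα, hC⟩ := lemR S hT hm h
  have hi := (lemA S hT.le hm hα).1
  have hF := Fc_ii S hT.le hm
  have e : runCost S m α = fun s => kin S m α s + S.Fc (m s) := rfl
  refine ⟨α, ⟨rfl, (W1ContOn_iff _ _).2 hm, hα.fp, hα.meas, hα.l2, ?_⟩, ?_⟩
  · rw [e]; exact hi.add hF
  · rw [e, intervalIntegral.integral_add hi hF, FI]; linarith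

lemma act_of_adm (S : MFGSetting d) {μ : PTd d} {m : ℝ → PTd d} {α : ℝ → Td d → Vd d} {T : ℝ} (hT : 0 < T)
    (h : AdmOn S 1 μ T m α) : ContinuousOn m (Icc 0 T) ∧ ∃ C, Act S m 0 T C ∧
      ∫ s in (0:ℝ)..T, runCost S m α s = C + FI S m 0 T := by
  obtain ⟨h0, hc, hfp, hmeas, hl2, -⟩ := h
  have hm := (W1ContOn_iff _ _).1 hc
  have hα : Ctl m α 0 T := ⟨hmeas, hl2, hfp⟩
  obtain ⟨hi, hA⟩ := lemA S hT.le hm hα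
  refine ⟨hm, _, hA, ?_⟩
  have e : runCost S m α = fun s => kin S m α s + S.Fc (m s) := rfl
  rw [e, intervalIntegral.integral_add hi (Fc_ii S hT.le hm), FI]

lemma FI_bd (S : MFGSetting d) : ∃ M, 0 ≤ M ∧ (∀ μ, |S.Fc μ| ≤ M) ∧
    ∀ (m : ℝ → PTd d) a b, |FI S m a b| ≤ M * |b - a| := by
  obtain ⟨M, hM⟩ := S.Fc_bounded
  exact ⟨M, (abs_nonneg _).trans (hM (haar d)), hM, fun m a b => by
    rw [FI, ← Real.norm_eq_abs]
    exact intervalIntegral.norm_integral_le_of_norm_le_const fun s _ => hM _⟩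

lemma chi_bd {χ : PTd d → ℝ} (h : Continuous χ) : ∃ B, ∀ μ, |χ μ| ≤ B := by
  obtain ⟨C, hC⟩ := isCompact_univ.exists_bound_of_continuousOn h.continuousOn
  exact ⟨C, fun μ => hC μ trivial⟩

lemma dpp_nonempty (S : MFGSetting d) (χ : PTd d → ℝ) (lam : ℝ) {t : ℝ} (ht : 0 < t) (μ : PTd d) :
    (DPPval S 1 χ lam t μ).Nonempty := by
  obtain ⟨B, -, hB⟩ := act_heat S
  obtain ⟨α, hα, -⟩ := adm_of_act S ht (heat_cont μ).continuousOn (hB μ t ht.le)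
  rw [heat_zero] at hα
  exact ⟨_, heat μ, α, hα, rfl⟩

lemma cor_iff (S : MFGSetting d) (lam : ℝ) (χ : PTd d → ℝ) : IsCorrector S 1 lam χ ↔ Cor S lam χ := by
  unfold IsCorrector Cor
  rw [W1Continuous_iff]
  refine and_congr_right fun hχ => ?_
  obtain ⟨B, hB⟩ := chi_bd hχ
  obtain ⟨M, hM0, -, hM⟩ := FI_bd S
  obtain ⟨K, hK0, hK⟩ := act_sub S
  constructor
  · intro h
    constructor
    · intro m T C hT hm hA
      obtain ⟨α, hα, hC⟩ := adm_of_act S hT hm hA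
      rw [h (m 0) T hT]
      have hmem : (∫ s in (0:ℝ)..T, runCost S m α s) + χ (m T) + lam * T ∈ DPPval S 1 χ lam T (m 0) :=
        ⟨m, α, hα, rfl⟩
      refine (csInf_le ?_ hmem).trans (by linarith)
      refine ⟨-K * T - M * T - B + lam * T, ?_⟩
      rintro _ ⟨m', α', h', rfl⟩
      obtain ⟨hm', C', hA', e'⟩ := act_of_adm S hT h'
      have h1 := (hK m' 0 T C' hT hm' hA').1
      have h2 := (abs_le.1 (hM m' 0 T)).1
      have h3 := (abs_le.1 (hB (m' T))).1
      rw [sub_zero] at h1 h2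
      rw [abs_of_pos hT] at h2
      rw [e']; linarith
    · intro μ T ε hT hε
      obtain ⟨r, ⟨m, α, hα, rfl⟩, hr⟩ := exists_lt_of_csInf_lt (dpp_nonempty S χ lam hT μ)
        (show sInf (DPPval S 1 χ lam T μ) < χ μ + ε by rw [← h μ T hT]; linarith)
      obtain ⟨hm, C, hA, e⟩ := act_of_adm S hT hα
      exact ⟨m, C, hα.1, hm, hA, by rw [e] at hr; linarith⟩
  · rintro ⟨h1, h2⟩ μ t ht
    have hlow : ∀ r ∈ DPPval S 1 χ lam t μ, χ μ ≤ r := by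
      rintro _ ⟨m, α, hα, rfl⟩
      obtain ⟨hm, C, hA, e⟩ := act_of_adm S ht hα
      have := h1 m t C ht hm hA
      rw [hα.1] at this
      rw [e]; linarith
    refine le_antisymm (le_csInf (dpp_nonempty S χ lam ht μ) hlow) (le_of_forall_pos_le_add fun ε hε => ?_)
    obtain ⟨m, C, h0, hm, hA, hC⟩ := h2 μ t ε ht hε
    obtain ⟨α, hα, hC'⟩ := adm_of_act S ht hm hA
    rw [h0] at hα
    have hmem : (∫ s in (0:ℝ)..t, runCost S m α s) + χ (m t) + lam * t ∈ DPPval S 1 χ lam t μ :=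
      ⟨m, α, hα, rfl⟩
    exact (csInf_le ⟨χ μ, hlow⟩ hmem).trans (by linarith)


lemma sqn_bd {y : Vd d} (hy : ‖y‖ ≤ 1) {c : ℝ} (hc : c ^ 2 = 4) : sqnorm (c • y) ≤ 4 * d := by
  rw [sqnorm_smul, hc]
  have h1 := sqnorm_le_norm y
  have h2 : ‖y‖ ^ 2 ≤ 1 := pow_le_one₀ (norm_nonneg _) hy
  have h3 : (d:ℝ) * ‖y‖ ^ 2 ≤ d * 1 := mul_le_mul_of_nonneg_left h2 (Nat.cast_nonneg d)
  linarith

lemma bridge (S : MFGSetting d) : ∃ A B, 0 ≤ A ∧ 0 ≤ B ∧ ∀ (ρ : PTd d) (m : ℝ → PTd d) (C : ℝ),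
    ContinuousOn m (Icc 0 1) → Act S m 0 1 C → ∃ m' : ℝ → PTd d, m' 0 = ρ ∧ m' 1 = m 1 ∧
    ContinuousOn m' (Icc 0 1) ∧ Act S m' 0 1 (B + A * C) := by
  obtain ⟨A, K, hA, hK, hH⟩ := S.H_P1
  obtain ⟨B, hB, hheat⟩ := act_heat S
  obtain ⟨K', hK', hsub⟩ := act_sub S
  set E := K * (1 + 4 * d) with hE
  have hE0 : 0 ≤ E := by positivity
  refine ⟨A, A * (B * (1/2)) + E + A * K', hA.le, by positivity, fun ρ m C hm h => ?_⟩
  have key : ∀ c₀ c₁ : ℝ, c₁ ^ 2 = 4 → ∀ I : Set ℝ, ∀ᵐ y ∂(ku d : Measure (Vd d)), ∀ s ∈ I, ∀ x p,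
      A * S.H x (A⁻¹ • p) ≤ S.H (x + (c₀ + c₁ * s) • y) p + dotp (c₁ • y) p + E := by
    intro c₀ c₁ hc I
    filter_upwards [ku_ae d] with y hy s _ x p
    refine (hH x (x + (c₀ + c₁ * s) • y) p (c₁ • y)).trans ?_
    have := mul_le_mul_of_nonneg_left (sqn_bd hy hc) hK
    rw [hE]; linarith
  obtain ⟨c1, a1⟩ := act_cv S (a := 0) (b := 1/2) (by norm_num) (heat_cont ρ).continuousOn
    (hheat ρ (1/2) (by norm_num)) (ku d) hA (key 0 2 (by norm_num) _)
  have h2 := (hsub m 0 1 C one_pos hm h).2 (1/2) 1 (by norm_num) (by norm_num) le_rfl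
  obtain ⟨c2, a2⟩ := act_cv S (a := 1/2) (b := 1) (by norm_num)
    (hm.mono (Icc_subset_Icc (by norm_num) le_rfl)) h2 (ku d) hA (key 2 (-2) (by norm_num) _)
  obtain ⟨m', hc, e0, e1, ha⟩ := glue (by norm_num) (by norm_num) c1 c2
    (by norm_num [cv_ku]) a1 a2
  refine ⟨m', ?_, ?_, hc, ha.mono ?_⟩
  · rw [e0]; simp [cv_zero, heat_zero]
  · rw [e1]; norm_num [cv_zero]
  · apply le_of_eq; ring

lemma osc (S : MFGSetting d) (lam : ℝ) : ∃ B, 0 ≤ B ∧ ∀ χ, Cor S lam χ → ∀ ρ ν, χ ρ ≤ χ ν + B := by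
  obtain ⟨A, B, hA, hB, hbr⟩ := bridge S
  obtain ⟨K, hK0, hsub⟩ := act_sub S
  obtain ⟨M, hM0, -, hM⟩ := FI_bd S
  have hl := abs_nonneg lam
  refine ⟨B + A * (1 + M + |lam|) + M + |lam| + 1 + |lam| + K + M, by positivity, fun χ hχ ρ ν => ?_⟩
  obtain ⟨ν0, -, hmin⟩ := isCompact_univ.exists_isMinOn ⟨haar d, trivial⟩ hχ.1.continuousOn
  have hmin' : ∀ μ, χ ν0 ≤ χ μ := fun μ => hmin (mem_univ μ)
  obtain ⟨m, C, h0, hm, hact, hC⟩ := hχ.2.2 ν0 1 1 one_pos one_pos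
  obtain ⟨m', e0, e1, hm', hact'⟩ := hbr ρ m C hm hact
  have h1 := hχ.2.1 m' 1 _ one_pos hm' hact'
  rw [e0, e1] at h1
  have f1 := abs_le.1 (hM m 0 1)
  have f2 := abs_le.1 (hM m' 0 1)
  have l1 := (hsub m 0 1 C one_pos hm hact).1
  norm_num at f1 f2 l1
  have g1 := hmin' (m 1)
  have g2 := hmin' ν
  have la := le_abs_self lam
  have lb := neg_abs_le lam
  have hCu : C ≤ 1 + M + |lam| := by linarith
  have := mul_le_mul_of_nonneg_left hCu hA
  linarith

set_option maxHeartbeats 1000000 in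
lemma equi (S : MFGSetting d) (lam : ℝ) : ∃ Q r1 : ℝ, 0 ≤ Q ∧ 0 < r1 ∧ ∀ r, 0 < r → r ≤ r1 →
    ∃ δ > 0, ∀ χ, Cor S lam χ → ∀ μ ν, W1 μ ν < δ → χ μ ≤ χ ν + Q * r := by
  obtain ⟨A, B, hA, hB, hbr⟩ := bridge S
  obtain ⟨K, hK0, hsub⟩ := act_sub S
  obtain ⟨M, hM0, -, hM⟩ := FI_bd S
  obtain ⟨L, hL0, hL⟩ := Fc_lip S
  obtain ⟨Bo, hBo, hosc⟩ := osc S lam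
  obtain ⟨Bh, hBh, hheat⟩ := act_heat S
  obtain ⟨K2, E, r0, hK2, hE, hr0, hP2⟩ := S.H_P2
  have hl := abs_nonneg lam
  have la := le_abs_self lam
  have lb := neg_abs_le lam
  set Cm := 1 + Bo + M + |lam| + K with hCm
  have hCm0 : 0 ≤ Cm := by positivity
  set Q1 := K2 * Cm + E + 2 * (1 + K2) * Cm + 2 * (B + A * Cm) with hQ1
  refine ⟨Q1 + 5 * L + 1 + (Bh + M + |lam|), min r0 (1/2), by positivity, by positivity, fun r hr hr1 => ?_⟩
  have hrr0 : r ≤ r0 := hr1.trans (min_le_left _ _)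
  have hr12 : r ≤ 1/2 := hr1.trans (min_le_right _ _)
  obtain ⟨τ, hτ, hτr, κ, hκ, δ, hδ, hdom⟩ := smooth_dom d hr hr12
  refine ⟨δ, hδ, fun χ hχ μ ν hμν => ?_⟩
  obtain ⟨ρ, hρ⟩ := hdom μ ν hμν
  have p1 := hχ.2.1 (heat μ) τ _ hτ (heat_cont μ).continuousOn (hheat μ τ hτ.le)
  rw [heat_zero, hρ] at p1
  obtain ⟨m, C, h0, hm, hact, hC⟩ := hχ.2.2 ν 1 r one_pos hr
  have f1 := abs_le.1 (hM m 0 1)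
  have l1 := (hsub m 0 1 C one_pos hm hact).1
  have f0 := abs_le.1 (hM (heat μ) 0 τ)
  rw [sub_zero, abs_of_pos hτ] at f0
  norm_num at f1 l1
  have o1 := hosc χ hχ ν (m 1)
  have hCu : |C| ≤ Cm := abs_le.2 ⟨by linarith, by linarith⟩
  obtain ⟨m', e0, e1, hm', hact'⟩ := hbr ρ m C hm hact
  have he : 2 * r ∈ Icc (0:ℝ) 1 := ⟨by linarith, by linarith⟩
  obtain ⟨c2, a2⟩ := act_cv S zero_le_one hm hact κ (A := 1 + K2 * r) (E := E * r) (c₀ := 1) (c₁ := -1)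
    (by positivity) (by
      filter_upwards [hκ] with y hy s hs x p
      refine hP2 r hr.le hrr0 _ _ _ _ ?_ ?_
      · rw [sub_add_cancel_left, norm_neg, norm_smul, Real.norm_eq_abs]
        have h1 : |1 + -1 * s| ≤ 1 := abs_le.2 ⟨by linarith [hs.1, hs.2], by linarith [hs.1]⟩
        calc _ ≤ 1 * r := mul_le_mul h1 hy (norm_nonneg _) zero_le_one
          _ = r := one_mul r
      · rw [neg_one_smul, norm_neg]; exact hy)
  have c3 := contOn_mix he c2 hm'
  have a3 := Act.mix zero_le_one he c2 hm' a2 hact'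
  have p2 := hχ.2.1 _ 1 _ one_pos c3 a3
  have s0 : (1:ℝ) + -1 * 0 = 1 := by norm_num
  have s1 : (1:ℝ) + -1 * 1 = 0 := by norm_num
  simp only [s0, s1, cv_zero, e0, e1, mix_self he, h0] at p2
  have hF : FI S (fun s => mix (2 * r) (cv (m s) κ (1 + -1 * s)) (m' s)) 0 1 ≤ FI S m 0 1 + 5 * L * r := by
    have i1 := Fc_ii S zero_le_one c3
    have i2 := Fc_ii S zero_le_one hm
    have : ∫ s in (0:ℝ)..1, S.Fc (mix (2 * r) (cv (m s) κ (1 + -1 * s)) (m' s)) ≤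
        ∫ s in (0:ℝ)..1, (S.Fc (m s) + 5 * L * r) := by
      refine intervalIntegral.integral_mono_on zero_le_one i1 (i2.add intervalIntegrable_const) fun s hs => ?_
      have w1 := W1_mix he (cv (m s) κ (1 + -1 * s)) (m' s)
      have w2 := W1_cv (m s) κ (c := 1 + -1 * s) hκ
      have h1 : |1 + -1 * s| ≤ 1 := abs_le.2 ⟨by linarith [hs.1, hs.2], by linarith [hs.1]⟩
      have w3 := mul_le_mul_of_nonneg_right h1 hr.le
      have w4 := W1_triangle (mix (2 * r) (cv (m s) κ (1 + -1 * s)) (m' s)) (cv (m s) κ (1 + -1 * s)) (m s)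
      have w5 := (abs_le.1 (hL (mix (2 * r) (cv (m s) κ (1 + -1 * s)) (m' s)) (m s))).2
      have w6 : W1 (mix (2 * r) (cv (m s) κ (1 + -1 * s)) (m' s)) (m s) ≤ 5 * r := by linarith
      have w7 := mul_le_mul_of_nonneg_left w6 hL0
      linarith
    rw [intervalIntegral.integral_add i2 intervalIntegrable_const] at this
    simp only [intervalIntegral.integral_const, smul_eq_mul, sub_zero, one_mul] at this
    exact this
  have hcost : (1 - 2 * r) * ((1 + K2 * r) * C + E * r * (1 - 0)) + 2 * r * (B + A * C) ≤ C + Q1 * r := by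
    have b1 := abs_le.1 hCu
    have t1 : K2 * C ≤ K2 * Cm := mul_le_mul_of_nonneg_left b1.2 hK2
    have t2 : A * C ≤ A * Cm := mul_le_mul_of_nonneg_left b1.2 hA
    have t3 : -((1 + K2 * r) * C) ≤ (1 + K2) * Cm := by
      have q1 : (1 + K2 * r) * (-C) ≤ (1 + K2 * r) * Cm := mul_le_mul_of_nonneg_left (by linarith) (by positivity)
      have q2 : (1 + K2 * r) * Cm ≤ (1 + K2) * Cm := by
        refine mul_le_mul_of_nonneg_right ?_ hCm0
        have q3 : K2 * r ≤ K2 * 1 := mul_le_mul_of_nonneg_left (by linarith) hK2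
        linarith
      linarith
    have t4 : 0 ≤ E * r * r := by positivity
    have key : K2 * C + E - 2 * ((1 + K2 * r) * C) + 2 * (B + A * C) ≤ Q1 := by rw [hQ1]; linarith
    have t5 := mul_le_mul_of_nonneg_right key hr.le
    have t6 : (1 - 2 * r) * ((1 + K2 * r) * C + E * r * (1 - 0)) + 2 * r * (B + A * C) =
      C + (K2 * C + E - 2 * ((1 + K2 * r) * C) + 2 * (B + A * C)) * r - 2 * (E * r * r) := by ring
    rw [t6]; linarith
  have x1 : Bh * τ ≤ Bh * r := mul_le_mul_of_nonneg_left hτr hBh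
  have x2 : M * τ ≤ M * r := mul_le_mul_of_nonneg_left hτr hM0
  have x3 : lam * τ ≤ |lam| * r := (mul_le_mul_of_nonneg_right la hτ.le).trans (mul_le_mul_of_nonneg_left hτr hl)
  linarith


lemma Cor.add_const {S : MFGSetting d} {lam : ℝ} {χ : PTd d → ℝ} (h : Cor S lam χ) (c : ℝ) :
    Cor S lam (fun μ => χ μ + c) := by
  refine ⟨h.1.add continuous_const, fun m T C hT hm ha => ?_, fun μ T ε hT hε => ?_⟩
  · have := h.2.1 m T C hT hm ha
    linarith
  · obtain ⟨m, C, h0, hm, ha, hC⟩ := h.2.2 μ T ε hT hε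
    exact ⟨m, C, h0, hm, ha, by linarith⟩

lemma Cor.lim {S : MFGSetting d} {lam : ℝ} {χs : ℕ → PTd d → ℝ} {χ : PTd d → ℝ}
    (h : ∀ n, Cor S lam (χs n)) (hu : TendstoUniformly χs χ atTop) : Cor S lam χ := by
  refine ⟨hu.continuous (Frequently.of_forall fun n => (h n).1), fun m T C hT hm ha => ?_, fun μ T ε hT hε => ?_⟩
  · refine le_of_tendsto_of_tendsto' (hu.tendsto_at (m 0))
      (((hu.tendsto_at (m T)).const_add (C + FI S m 0 T)).add_const (lam * T)) fun n => ?_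
    exact (h n).2.1 m T C hT hm ha
  · obtain ⟨n, hn⟩ := (Metric.tendstoUniformly_iff.1 hu (ε / 3) (by positivity)).exists
    obtain ⟨m, C, h0, hm, ha, hC⟩ := (h n).2.2 μ T (ε / 3) hT (by positivity)
    refine ⟨m, C, h0, hm, ha, ?_⟩
    have h1 := abs_lt.1 (hn μ)
    have h2 := abs_lt.1 (hn (m T))
    linarith [h1.1, h1.2, h2.1, h2.2]

lemma cor_compact (S : MFGSetting d) (lam : ℝ) (χs : ℕ → PTd d → ℝ) (h : ∀ n, Cor S lam (χs n))
    (h0 : ∀ n, χs n (haar d) = 0) : ∃ χ, Cor S lam χ ∧ ∃ φ : ℕ → ℕ, StrictMono φ ∧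
      TendstoUniformly (fun n => χs (φ n)) χ atTop := by
  obtain ⟨B, hB0, hB⟩ := osc S lam
  obtain ⟨Q, r1, hQ, hr1, heq⟩ := equi S lam
  let A : Set (BoundedContinuousFunction (PTd d) ℝ) := {f | Cor S lam f ∧ f (haar d) = 0}
  have hA : IsCompact (closure A) := by
    refine BoundedContinuousFunction.arzela_ascoli (Icc (-B) B) isCompact_Icc A ?_ ?_
    · rintro f μ ⟨hf, hf0⟩
      have h1 := hB f hf μ (haar d)
      have h2 := hB f hf (haar d) μ
      rw [hf0] at h1 h2
      exact ⟨by linarith, by linarith⟩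
    · intro μ
      rw [Metric.equicontinuousAt_iff_right]
      intro ε hε
      set r := min r1 (ε / (2 * (Q + 1))) with hr
      have hr0 : 0 < r := by positivity
      have hQr : Q * r < ε := by
        have h1 : (Q + 1) * r ≤ (Q + 1) * (ε / (2 * (Q + 1))) :=
          mul_le_mul_of_nonneg_left (min_le_right _ _) (by positivity)
        have h2 : (Q + 1) * (ε / (2 * (Q + 1))) = ε / 2 := by field_simp
        linarith
      obtain ⟨δ, hδ, hδ'⟩ := heq r hr0 (min_le_left _ _)
      have hev : ∀ᶠ ν in nhds μ, W1 ν μ < δ := by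
        have := (W1_cont μ).tendsto μ
        rw [W1_self] at this
        exact this.eventually (gt_mem_nhds hδ)
      filter_upwards [hev] with ν hν f
      have h1 := hδ' f.1 f.2.1 ν μ hν
      have h2 := hδ' f.1 f.2.1 μ ν (by rwa [W1_symm])
      exact abs_lt.2 ⟨by linarith, by linarith⟩
  obtain ⟨f, -, φ, hφ, hf⟩ := hA.tendsto_subseq (x := fun n => BoundedContinuousFunction.mkOfCompact ⟨χs n, (h n).1⟩)
    fun n => subset_closure ⟨h n, h0 n⟩
  have hu : TendstoUniformly (fun n => χs (φ n)) f atTop := BoundedContinuousFunction.tendsto_iff_tendstoUniformly.1 hf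
  exact ⟨f, Cor.lim (fun n => h (φ n)) hu, φ, hφ, hu⟩

def cst (S : MFGSetting d) (lam : ℝ) (χ : PTd d → ℝ) (m : ℝ → PTd d) (s t : ℝ) : ℝ :=
  χ (m s) - χ (m t) - lam * (t - s) - FI S m s t

def Cal (S : MFGSetting d) (lam : ℝ) (χ : PTd d → ℝ) (m : ℝ → PTd d) : Prop :=
  Continuous m ∧ ∀ s t, s < t → Act S m s t (cst S lam χ m s t)

lemma cal_of_isCal {S : MFGSetting d} {lam : ℝ} {m : ℝ → PTd d} {α : ℝ → Td d → Vd d}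
    (h : IsCalibrated S 1 lam m α) : ∃ χ, Cor S lam χ ∧ Cal S lam χ m := by
  obtain ⟨hc, hfp, hmeas, hl2, hi, χ, hχ, hcal⟩ := h
  have hm : Continuous m := continuousOn_univ.1 ((W1ContOn_iff _ _).1 hc)
  refine ⟨χ, (cor_iff S lam χ).1 hχ, hm, fun s t hst => ?_⟩
  have hα : Ctl m α s t := ⟨hmeas, hl2 s t, fun s₁ s₂ _ h2 _ => hfp s₁ s₂ h2⟩
  obtain ⟨hk, ha⟩ := lemA S hst.le hm.continuousOn hα
  refine ha.mono (le_of_eq ?_)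
  have e := hcal s t hst
  have e1 : runCost S m α = fun s => kin S m α s + S.Fc (m s) := rfl
  rw [e1, intervalIntegral.integral_add hk (Fc_ii S hst.le hm.continuousOn)] at e
  rw [cst, FI]; linarith

lemma Cal.add_const {S : MFGSetting d} {lam : ℝ} {χ : PTd d → ℝ} {m : ℝ → PTd d}
    (h : Cal S lam χ m) (c : ℝ) : Cal S lam (fun μ => χ μ + c) m := by
  refine ⟨h.1, fun s t hst => ?_⟩
  convert h.2 s t hst using 1
  simp [cst]

lemma cal_smooth (S : MFGSetting d) (lam : ℝ) {g : Vd d → ℝ} (hg : ContDiff ℝ 2 g) (hp : Per g)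
    {ε : ℝ} (hε : 0 < ε) : ∃ δ > 0, ∀ χ m, Cor S lam χ → Cal S lam χ m → ∀ s t, s < t → t < s + δ →
      ig (m s) (fun y => g (secT y)) - ig (m t) (fun y => g (secT y)) ≤ ε := by
  obtain ⟨B, hB0, hB⟩ := osc S lam
  obtain ⟨M, hM0, -, hM⟩ := FI_bd S
  have hl := abs_nonneg lam
  set Cm := B + |lam| + M with hCm
  set k := (Cm + 1) / ε with hk
  have hk0 : 0 < k := by positivity
  have hT := test_smul (test_space hg hp) k
  have hLc : Continuous (LL S (fun _ x => k * g x) 0) := (LL_cont S hT).comp (by fun_prop : Continuous fun y => ((0:ℝ), y))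
  have hL0 : ∀ s, LL S (fun _ x => k * g x) s = LL S (fun _ x => k * g x) 0 := by
    intro s; funext y; simp [LL, LLv, tderiv]
  obtain ⟨N, hN⟩ := isCompact_univ.exists_bound_of_continuousOn hLc.continuousOn
  have hN' : ∀ y, |LL S (fun _ x => k * g x) 0 y| ≤ N := fun y => hN y trivial
  have hN0 : 0 ≤ N := (abs_nonneg _).trans (hN' 0)
  refine ⟨min 1 (1 / (N + 1)), by positivity, fun χ m hχ hm s t hst htd => ?_⟩
  have t1 : t - s < 1 := by linarith [min_le_left 1 (1 / (N + 1))]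
  have t2 : (t - s) * (N + 1) ≤ 1 := by
    rw [← le_div_iff₀ (by positivity)]; linarith [min_le_right 1 (1 / (N + 1))]
  have h1 := hm.2 s t hst _ hT
  simp only [hL0] at h1
  rw [ig_smul, ig_smul] at h1
  have h2 : -(N * (t - s)) ≤ ∫ x in s..t, ig (m x) (LL S (fun _ x => k * g x) 0) := by
    have := intervalIntegral.norm_integral_le_of_norm_le_const (a := s) (b := t) (C := N)
      (f := fun x => ig (m x) (LL S (fun _ x => k * g x) 0)) fun x _ => abs_ig_le (m x) hN'
    rw [abs_of_pos (by linarith : 0 < t - s), Real.norm_eq_abs] at this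
    exact (abs_le.1 this).1
  have h3 : cst S lam χ m s t ≤ Cm := by
    have f1 := abs_le.1 (hM m s t)
    rw [abs_of_pos (by linarith : 0 < t - s)] at f1
    have f2 := hB χ hχ (m s) (m t)
    have f3 : M * (t - s) ≤ M * 1 := mul_le_mul_of_nonneg_left t1.le hM0
    have f4 : -(lam * (t - s)) ≤ |lam| * 1 := by
      rw [← neg_mul]
      exact mul_le_mul (neg_le_abs lam) t1.le (by linarith) hl
    rw [cst]; linarith [f1.1]
  have h4 : k * (ig (m s) (fun y => g (secT y)) - ig (m t) (fun y => g (secT y))) ≤ Cm + 1 := by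
    nlinarith
  have h5 : (Cm + 1) = k * ε := by rw [hk]; field_simp
  rw [h5] at h4
  exact le_of_mul_le_mul_left h4 hk0

lemma cal_mod (S : MFGSetting d) (lam : ℝ) {f : Td d → ℝ} (hf : Continuous f)
    {ε : ℝ} (hε : 0 < ε) : ∃ δ > 0, ∀ χ m, Cor S lam χ → Cal S lam χ m → ∀ s t, |s - t| < δ →
      |ig (m s) f - ig (m t) f| ≤ ε := by
  obtain ⟨g, hg, hp, hgf⟩ := smooth_dense hf (show 0 < ε / 3 by positivity)
  obtain ⟨δ, hδ, h1⟩ := cal_smooth S lam hg hp (show 0 < ε / 3 by positivity)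
  obtain ⟨δ', hδ', h2⟩ := cal_smooth S lam hg.neg (fun x z => by rw [hp x z]) (show 0 < ε / 3 by positivity)
  have hgc : Continuous (fun y : Td d => g (secT y)) := test_contT' (test_space hg hp) 0
  have hd : ∀ μ : PTd d, |ig μ (fun y => g (secT y)) - ig μ f| ≤ ε / 3 := fun μ => by
    rw [← ig_sub μ hgc hf]; exact abs_ig_le μ fun y => (hgf y).le
  have main : ∀ χ m, Cor S lam χ → Cal S lam χ m → ∀ s t, s < t → t < s + min δ δ' →
      |ig (m s) f - ig (m t) f| ≤ ε := by
    intro χ m hχ hm s t hst ht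
    have a1 := h1 χ m hχ hm s t hst (by linarith [min_le_left δ δ'])
    have a2 := h2 χ m hχ hm s t hst (by linarith [min_le_right δ δ'])
    have e : ∀ μ : PTd d, ig μ (fun y => -g (secT y)) = - ig μ (fun y => g (secT y)) := fun μ => integral_neg _
    have a3 : ig (m s) (fun y => -g (secT y)) - ig (m t) (fun y => -g (secT y)) ≤ ε / 3 := a2
    rw [e, e] at a3
    have b1 := abs_le.1 (hd (m s))
    have b2 := abs_le.1 (hd (m t))
    exact abs_le.2 ⟨by linarith [b1.1, b1.2, b2.1, b2.2], by linarith [b1.1, b1.2, b2.1, b2.2]⟩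
  refine ⟨min δ δ', by positivity, fun χ m hχ hm s t hst => ?_⟩
  rcases lt_trichotomy s t with h | h | h
  · exact main χ m hχ hm s t h (by rw [abs_sub_comm, abs_of_pos (by linarith)] at hst; linarith)
  · rw [h, sub_self, abs_zero]; exact hε.le
  · rw [abs_sub_comm]; exact main χ m hχ hm t s h (by rw [abs_of_pos (by linarith)] at hst; linarith)

lemma diag_subseq {X ι : Type*} [TopologicalSpace X] [CompactSpace X] [FirstCountableTopology X] [Countable ι]
    (u : ℕ → ι → X) : ∃ (a : ι → X) (φ : ℕ → ℕ), StrictMono φ ∧ ∀ i, Tendsto (fun n => u (φ n) i) atTop (nhds (a i)) := by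
  obtain ⟨a, φ, hφ, h⟩ := CompactSpace.tendsto_subseq u
  exact ⟨a, φ, hφ, fun i => tendsto_pi_nhds.1 h i⟩

lemma cal_compact (S : MFGSetting d) (lam : ℝ) (χs : ℕ → PTd d → ℝ) (ms : ℕ → ℝ → PTd d)
    (h : ∀ n, Cor S lam (χs n)) (hm : ∀ n, Cal S lam (χs n) (ms n)) :
    ∃ m : ℝ → PTd d, Continuous m ∧ ∃ φ : ℕ → ℕ, StrictMono φ ∧
      ∀ t, Tendsto (fun n => ms (φ n) t) atTop (nhds (m t)) := by
  obtain ⟨mq, φ, hφ, hq'⟩ := diag_subseq (fun (n : ℕ) (q : ℚ) => ms n q)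
  have hT : ∀ t, ∃ μ, Tendsto (fun n => ms (φ n) t) atTop (nhds μ) := by
    intro t
    obtain ⟨μ, ψ, hψ, hμ⟩ := CompactSpace.tendsto_subseq (X := PTd d) (fun n => ms (φ n) t)
    refine ⟨μ, ProbabilityMeasure.tendsto_iff_forall_integral_tendsto.2 fun f => ?_⟩
    refine tendsto_nhds_of_cauchySeq_of_subseq ?_ hψ.tendsto_atTop
      (ProbabilityMeasure.tendsto_iff_forall_integral_tendsto.1 hμ f)
    rw [Metric.cauchySeq_iff']
    intro ε hε
    obtain ⟨δ, hδ, hmod⟩ := cal_mod S lam f.continuous (show 0 < ε / 4 by positivity)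
    obtain ⟨q, hq1, hq2⟩ := exists_rat_btwn (show t < t + δ by linarith)
    have hc : CauchySeq (fun n => ∫ y, f y ∂(ms (φ n) q : Measure (Td d))) :=
      (ProbabilityMeasure.tendsto_iff_forall_integral_tendsto.1 (hq' q) f).cauchySeq
    obtain ⟨N, hN⟩ := Metric.cauchySeq_iff'.1 hc (ε / 4) (by positivity)
    refine ⟨N, fun n hn => ?_⟩
    have c1 := abs_lt.1 (hN n hn)
    have hqt : |t - q| < δ := abs_lt.2 ⟨by linarith, by linarith⟩
    have c2 := abs_le.1 (hmod _ _ (h (φ n)) (hm (φ n)) t q hqt)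
    have c3 := abs_le.1 (hmod _ _ (h (φ N)) (hm (φ N)) t q hqt)
    unfold ig at c2 c3
    exact abs_lt.2 ⟨by linarith [c1.1, c1.2, c2.1, c2.2, c3.1, c3.2], by linarith [c1.1, c1.2, c2.1, c2.2, c3.1, c3.2]⟩
  choose m hmt using hT
  refine ⟨m, ?_, φ, hφ, hmt⟩
  rw [← continuousOn_univ]
  refine cont_of_pair fun f hf => ?_
  rw [continuousOn_univ, Metric.continuous_iff]
  intro t ε hε
  obtain ⟨δ, hδ, hmod⟩ := cal_mod S lam hf (show 0 < ε / 2 by positivity)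
  refine ⟨δ, hδ, fun s hs => ?_⟩
  have hl : ∀ t, Tendsto (fun n => ig (ms (φ n) t) f) atTop (nhds (ig (m t) f)) := fun t =>
    ProbabilityMeasure.tendsto_iff_forall_integral_tendsto.1 (hmt t) (BoundedContinuousFunction.mkOfCompact ⟨f, hf⟩)
  have : |ig (m s) f - ig (m t) f| ≤ ε / 2 :=
    le_of_tendsto' ((hl s).sub (hl t)).abs fun n => hmod _ _ (h (φ n)) (hm (φ n)) s t hs
  exact lt_of_le_of_lt this (by linarith)

lemma Cal.lim {S : MFGSetting d} {lam : ℝ} {χs : ℕ → PTd d → ℝ} {χ : PTd d → ℝ}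
    {ms : ℕ → ℝ → PTd d} {m : ℝ → PTd d} (h : ∀ n, Cal S lam (χs n) (ms n)) (hχ : Continuous χ)
    (hu : TendstoUniformly χs χ atTop) (hm : Continuous m)
    (ht : ∀ t, Tendsto (fun n => ms n t) atTop (nhds (m t))) : Cal S lam χ m := by
  have hl : ∀ t (f : Td d → ℝ), Continuous f → Tendsto (fun n => ig (ms n t) f) atTop (nhds (ig (m t) f)) :=
    fun t f hf => ProbabilityMeasure.tendsto_iff_forall_integral_tendsto.1 (ht t)
      (BoundedContinuousFunction.mkOfCompact ⟨f, hf⟩)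
  refine ⟨hm, fun s t hst φ hφ => ?_⟩
  have d1 : Tendsto (fun n => ∫ x in s..t, ig (ms n x) (LL S φ x)) atTop
      (nhds (∫ x in s..t, ig (m x) (LL S φ x))) := by
    obtain ⟨N, hN⟩ := (isCompact_Icc (a := s) (b := t)).prod (isCompact_univ (X := Td d))
      |>.exists_bound_of_continuousOn (LL_cont S hφ).continuousOn
    refine intervalIntegral.tendsto_integral_filter_of_dominated_convergence (fun _ => N)
      (Eventually.of_forall fun n => ?_) (Eventually.of_forall fun n => ?_) intervalIntegrable_const
      (Eventually.of_forall fun x _ => ?_)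
    · exact (cont_pair' (LL_cont S hφ) (h n).1).aestronglyMeasurable
    · refine Eventually.of_forall fun x hx => ?_
      rw [uIoc_of_le hst.le] at hx
      exact abs_ig_le _ fun y => hN (x, y) ⟨Ioc_subset_Icc_self hx, trivial⟩
    · exact hl x _ ((LL_cont S hφ).comp (by fun_prop : Continuous fun y => (x, y)))
  have d2 : Tendsto (fun n => FI S (ms n) s t) atTop (nhds (FI S m s t)) := by
    obtain ⟨M, -, hM, -⟩ := FI_bd S
    refine intervalIntegral.tendsto_integral_filter_of_dominated_convergence (fun _ => M)
      (Eventually.of_forall fun n => ?_) (Eventually.of_forall fun n => ?_) intervalIntegrable_const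
      (Eventually.of_forall fun x _ => ?_)
    · exact ((Fc_cont S).comp (h n).1).aestronglyMeasurable
    · exact Eventually.of_forall fun x _ => hM _
    · exact ((Fc_cont S).tendsto _).comp (ht x)
  have d3 : ∀ r, Tendsto (fun n => χs n (ms n r)) atTop (nhds (χ (m r))) := fun r =>
    hu.tendsto_comp hχ.continuousAt (ht r)
  refine le_of_tendsto_of_tendsto' ((d1.add (hl s _ (test_contT' hφ s))).sub (hl t _ (test_contT' hφ t)))
    ((((d3 s).sub (d3 t)).sub_const (lam * (t - s))).sub d2) fun n => ?_
  exact (h n).2 s t hst φ hφ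


lemma Ctl.congr {m : ℝ → PTd d} {α β : ℝ → Td d → Vd d} {a b : ℝ} (h : Ctl m β a b)
    (hα : Measurable (fun q : ℝ × Td d => α q.1 q.2)) (e : ∀ s ∈ Ioc a b, α s = β s) : Ctl m α a b := by
  refine ⟨hα, ?_, fun s₁ s₂ h1 h2 h3 φ hφ => ?_⟩
  · rw [setLIntegral_congr_fun measurableSet_Ioc (g := fun s => ∫⁻ y, ENNReal.ofReal (sqnorm (β s y)) ∂(m s : Measure (Td d)))]
    · exact h.l2
    · intro s hs
      simp only [e s hs]
  · rw [h.fp s₁ s₂ h1 h2 h3 φ hφ]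
    refine intervalIntegral.integral_congr_ae (Eventually.of_forall fun s hs => ?_)
    rw [uIoc_of_le h2] at hs
    simp only [e s ⟨lt_of_le_of_lt h1 hs.1, hs.2.trans h3⟩]

lemma fp_ii {m : ℝ → PTd d} {α : ℝ → Td d → Vd d} {a b : ℝ} (hab : a ≤ b)
    (hm : ContinuousOn m (Icc a b)) (h : Ctl m α a b) {φ : ℝ → Vd d → ℝ} (hφ : IsTestFun φ) :
    IntervalIntegrable (fun s => ∫ y, (tderiv φ s (secT y) + 1 * lapl (φ s) (secT y)
        - dotp (α s y) (gradv (φ s) (secT y))) ∂(m s : Measure (Td d))) volume a b := by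
  obtain ⟨κ, hκM, hκ⟩ := exists_kernel hab hm
  have hi := (st_l2 hκ h.meas).1 h.l2
  have hD := dotp_int hφ h.meas hi
  have hT : Integrable _ (stm κ a b) := st_cont (test_tlT hφ)
  have hTD : Integrable (fun q : ℝ × Td d => tderiv φ q.1 (secT q.2) + lapl (φ q.1) (secT q.2)
        - dotp (α q.1 q.2) (gradv (φ q.1) (secT q.2))) (stm κ a b) := hT.sub hD
  simp only [one_mul]
  exact (st_eq hab hκ hTD).1

lemma Ctl.concat {m : ℝ → PTd d} {α : ℝ → Td d → Vd d} {a b c : ℝ} (hab : a ≤ b) (hbc : b ≤ c)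
    (hm : Continuous m) (h : Ctl m α a b) (h' : Ctl m α b c) : Ctl m α a c := by
  refine ⟨h.meas, ?_, fun s₁ s₂ h1 h2 h3 => ?_⟩
  · rw [← Ioc_union_Ioc_eq_Ioc hab hbc]
    exact lt_of_le_of_lt (lintegral_union_le _ _ _) (ENNReal.add_lt_top.2 ⟨h.l2, h'.l2⟩)
  · rcases le_total s₂ b with hs | hs
    · exact h.fp s₁ s₂ h1 h2 hs
    rcases le_total b s₁ with hs' | hs'
    · exact h'.fp s₁ s₂ hs' h2 h3
    intro φ hφ
    have e1 := h.fp s₁ b h1 hs' le_rfl φ hφ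
    have e2 := h'.fp b s₂ le_rfl hs h3 φ hφ
    rw [← intervalIntegral.integral_add_adjacent_intervals (fp_ii hs' hm.continuousOn (h.sub h1 le_rfl) hφ)
      (fp_ii hs hm.continuousOn (h'.sub le_rfl h3) hφ)]
    linarith

lemma FI_add (S : MFGSetting d) {m : ℝ → PTd d} (hm : Continuous m) {a b c : ℝ} (hab : a ≤ b) (hbc : b ≤ c) :
    FI S m a b + FI S m b c = FI S m a c :=
  intervalIntegral.integral_add_adjacent_intervals (Fc_ii S hab hm.continuousOn) (Fc_ii S hbc hm.continuousOn)

lemma isCal_of_cal {S : MFGSetting d} {lam : ℝ} {χ : PTd d → ℝ} {m : ℝ → PTd d}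
    (hχ : Cor S lam χ) (h : Cal S lam χ m) : ∃ α, IsCalibrated S 1 lam m α := by
  have hm := h.1
  have h0 : ∀ k : ℤ, ∃ α, Ctl m α k (k + 1) ∧ ∫ s in (k:ℝ)..(k + 1), kin S m α s ≤ cst S lam χ m k (k + 1) :=
    fun k => lemR S (by linarith) hm.continuousOn (h.2 k (k + 1) (by linarith))
  choose β hβ hβc using h0
  set α : ℝ → Td d → Vd d := fun s y => β (⌈s⌉ - 1) s y with hα
  have hαm : Measurable (fun q : ℝ × Td d => α q.1 q.2) := by
    have h1 : Measurable (fun p : ℤ × (ℝ × Td d) => β p.1 p.2.1 p.2.2) :=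
      measurable_from_prod_countable_right fun k => (hβ k).meas
    have h2 : Measurable (fun q : ℝ × Td d => ((⌈q.1⌉ - 1 : ℤ), q)) :=
      ((Int.measurable_ceil.comp measurable_fst).sub_const 1).prodMk measurable_id
    exact h1.comp h2
  have he : ∀ k : ℤ, ∀ s ∈ Ioc (k:ℝ) (k + 1), α s = β k s := by
    intro k s hs
    have : ⌈s⌉ = k + 1 := by
      rw [Int.ceil_eq_iff]; push_cast; exact ⟨by linarith [hs.1], hs.2⟩
    funext y
    simp only [hα, this, add_sub_cancel_right]
  have hck : ∀ k : ℤ, Ctl m α k (k + 1) := fun k => (hβ k).congr hαm (he k)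
  have hkk : ∀ k : ℤ, ∫ s in (k:ℝ)..(k + 1), kin S m α s ≤ cst S lam χ m k (k + 1) := by
    intro k
    refine le_of_eq_of_le ?_ (hβc k)
    refine intervalIntegral.integral_congr_ae (Eventually.of_forall fun s hs => ?_)
    rw [uIoc_of_le (by linarith)] at hs
    simp only [kin, he k s hs]
  have hN : ∀ (k : ℤ) (n : ℕ), Ctl m α k (k + n + 1) ∧
      ∫ s in (k:ℝ)..(k + n + 1), kin S m α s ≤ cst S lam χ m k (k + n + 1) := by
    intro k n
    induction n with
    | zero => simpa using ⟨hck k, hkk k⟩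
    | succ n ih =>
      have c2 := hck (k + n + 1)
      have i2 := hkk (k + n + 1)
      push_cast at c2 i2 ⊢
      rw [← add_assoc (k:ℝ) n 1]
      have l1 : (k:ℝ) ≤ k + n + 1 := by have : (0:ℝ) ≤ n := Nat.cast_nonneg n
                                        linarith
      have l2 : (k:ℝ) + n + 1 ≤ k + n + 1 + 1 := by linarith
      refine ⟨Ctl.concat l1 l2 hm ih.1 c2, ?_⟩
      rw [← intervalIntegral.integral_add_adjacent_intervals (lemA S l1 hm.continuousOn ih.1).1
        (lemA S l2 hm.continuousOn c2).1]
      refine (add_le_add ih.2 i2).trans (le_of_eq ?_)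
      have := FI_add S hm l1 l2
      unfold cst
      rw [← this]; ring
  have hbig : ∀ a b : ℝ, a ≤ b → ∃ A B : ℝ, A < a ∧ b < B ∧ Ctl m α A B ∧
      ∫ s in A..B, kin S m α s ≤ cst S lam χ m A B := by
    intro a b hab
    obtain ⟨k, hk⟩ := exists_int_lt a
    obtain ⟨n, hn⟩ := exists_nat_gt (b - k)
    exact ⟨k, k + n + 1, hk, by linarith, hN k n⟩
  have hctl : ∀ a b, a ≤ b → Ctl m α a b := fun a b hab => by
    obtain ⟨A, B, hA, hB, hc, -⟩ := hbig a b hab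
    exact hc.sub hA.le hB.le
  have hlow : ∀ a b, a < b → cst S lam χ m a b ≤ ∫ s in a..b, kin S m α s := by
    intro a b hab
    have ha := (lemA S hab.le hm.continuousOn (hctl a b hab.le)).2
    have h1 := ha.shift a
    rw [sub_self] at h1
    have h2 := hχ.2.1 (fun s => m (s + a)) (b - a) _ (by linarith)
      (hm.comp (continuous_id.add continuous_const)).continuousOn h1
    have h3 : FI S (fun s => m (s + a)) 0 (b - a) = FI S m a b := by
      unfold FI
      rw [intervalIntegral.integral_comp_add_right (fun s => S.Fc (m s)) a]
      simp
    simp only [zero_add, sub_add_cancel] at h2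
    rw [h3] at h2
    unfold cst; linarith
  have hkii : ∀ a b, IntervalIntegrable (kin S m α) volume a b := by
    intro a b
    rcases le_total a b with hab | hab
    · exact (lemA S hab hm.continuousOn (hctl a b hab)).1
    · exact (lemA S hab hm.continuousOn (hctl b a hab)).1.symm
  have hup : ∀ a b, a < b → ∫ s in a..b, kin S m α s = cst S lam χ m a b := by
    intro a b hab
    refine le_antisymm ?_ (hlow a b hab)
    obtain ⟨A, B, hA, hB, -, hc⟩ := hbig a b hab.le
    have l1 := hlow A a hA
    have l2 := hlow b B hB
    rw [← intervalIntegral.integral_add_adjacent_intervals (hkii A a) (hkii a B),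
      ← intervalIntegral.integral_add_adjacent_intervals (hkii a b) (hkii b B)] at hc
    have f1 := FI_add S hm hA.le (hab.trans hB).le
    have f2 := FI_add S hm hab.le hB.le
    unfold cst at *
    linarith
  have e1 : runCost S m α = fun s => kin S m α s + S.Fc (m s) := rfl
  have hF : ∀ a b, IntervalIntegrable (fun s => S.Fc (m s)) volume a b := fun a b =>
    ((Fc_cont S).comp hm).intervalIntegrable a b
  refine ⟨α, (W1ContOn_iff _ _).2 hm.continuousOn, fun s₁ s₂ hs => (hctl s₁ s₂ hs).fp s₁ s₂ le_rfl hs le_rfl, hαm,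
    fun t₁ t₂ => ?_, fun t₁ t₂ => ?_, χ, (cor_iff S lam χ).2 hχ, fun t₁ t₂ ht => ?_⟩
  · rcases le_total t₁ t₂ with ht | ht
    · exact (hctl t₁ t₂ ht).l2
    · rw [Ioc_eq_empty (not_lt.2 ht)]; simp
  · rw [e1]; exact (hkii t₁ t₂).add (hF t₁ t₂)
  · rw [e1, intervalIntegral.integral_add (hkii t₁ t₂) (hF t₁ t₂), hup t₁ t₂ ht]
    unfold cst FI; ring

lemma mather_aux (S : MFGSetting d) (lam : ℝ) (f : ℕ → PTd d) (hf : ∀ n, f n ∈ MatherSet S 1 lam) :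
    ∃ μ ∈ MatherSet S 1 lam, ∃ φ : ℕ → ℕ, StrictMono φ ∧
      Tendsto (fun n => W1 (f (φ n)) μ) atTop (nhds 0) := by
  have h1 : ∀ n, ∃ m χ, m 0 = f n ∧ Cor S lam χ ∧ Cal S lam χ m ∧ χ (haar d) = 0 := by
    intro n
    obtain ⟨m, α, hc, h0⟩ := hf n
    obtain ⟨χ, hχ, hm⟩ := cal_of_isCal hc
    exact ⟨m, fun μ => χ μ + -χ (haar d), h0, hχ.add_const _, hm.add_const _, add_neg_cancel _⟩
  choose ms χs h0 hχ hm hz using h1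
  obtain ⟨χ, hχl, φ, hφ, hu⟩ := cor_compact S lam χs hχ hz
  obtain ⟨m, hmc, ψ, hψ, ht⟩ := cal_compact S lam (fun n => χs (φ n)) (fun n => ms (φ n)) (fun n => hχ _) (fun n => hm _)
  have hu' : TendstoUniformly (fun n => χs (φ (ψ n))) χ atTop := fun u hu0 => hψ.tendsto_atTop.eventually (hu u hu0)
  have hcal := Cal.lim (fun n => hm (φ (ψ n))) hχl.1 hu' hmc ht
  obtain ⟨α, hα⟩ := isCal_of_cal hχl hcal
  refine ⟨m 0, ⟨m, α, hα, rfl⟩, φ ∘ ψ, hφ.comp hψ, ?_⟩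
  refine W1_of_tendsto ?_
  have := ht 0
  simp only [h0] at this
  exact this

end

/-- Proposition 2.8 of the paper.  The projected Mather set `𝓜` is a
compact subset of `P(𝕋^d)`: every sequence in `𝓜` has a subsequence converging, in the
1-Wasserstein distance, to an element of `𝓜`. -/
theorem mather_compact (d : ℕ) (S : MFGSetting d) (lam : ℝ)
    (hlam : IsLimitValueV S 1 lam) :
    ∀ f : ℕ → PTd d, (∀ n : ℕ, f n ∈ MatherSet S 1 lam) →
      ∃ μ ∈ MatherSet S 1 lam, ∃ φ : ℕ → ℕ, StrictMono φ ∧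
        Filter.Tendsto (fun n => W1 (f (φ n)) μ) Filter.atTop (nhds 0) := by
  exact mather_aux S lam
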